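/- For every integer k ≥ 3, define M_k = 2^{(k+1)/2} − 1 if k is odd and M_k = (3/2)·2^{k/2} − 1 if k is even. Then: (i) every set of at least M_k points in the plane in general position contains a k-hole or an empty 5-pseudo-triangle; and (ii) there exists a set of M_k − 1 points in general position containing neither a k-hole nor an empty 5-pseudo-triangle. In other words, E(k,5) = M_k. -/

import Mathlib

open Set

noncomputable section

/-- Points of the plane. -/
abbrev Pt : Type := ℝ × ℝ

/-- Two-dimensional cross product. -/
def cross2 (u w : Pt) : ℝ := u.1 * w.2 - u.2 * w.1

/-- A set of points is in general position if no three of its points are collinear. -/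
def GenPos (S : Set Pt) : Prop :=
  ∀ p ∈ S, ∀ q ∈ S, ∀ r ∈ S, p ≠ q → p ≠ r → q ≠ r →
    ¬ Collinear ℝ ({p, q, r} : Set Pt)

/-- `v : ZMod n → Pt` lists the vertices (in cyclic order) of a simple polygon:
vertices are pairwise distinct, non-adjacent edges are disjoint, and adjacent
edges meet exactly in their common vertex. -/
structure IsSimplePolygon (n : ℕ) (v : ZMod n → Pt) : Prop where
  three_le : 3 ≤ n
  inj : Function.Injective v
  nonadj : ∀ i j : ZMod n, i ≠ j → i ≠ j + 1 → j ≠ i + 1 →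
    segment ℝ (v i) (v (i + 1)) ∩ segment ℝ (v j) (v (j + 1)) = ∅
  adj : ∀ i : ZMod n,
    segment ℝ (v i) (v (i + 1)) ∩ segment ℝ (v (i + 1)) (v (i + 2)) = {v (i + 1)}

/-- Twice the signed area of a polygon. -/
def signedArea (n : ℕ) (v : ZMod n → Pt) : ℝ :=
  if h : n = 0 then 0 else
    haveI : NeZero n := ⟨h⟩
    ∑ i : ZMod n, cross2 (v i) (v (i + 1))

/-- The turning cross product at vertex `i`. -/
def vtxCross (n : ℕ) (v : ZMod n → Pt) (i : ZMod n) : ℝ :=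
  cross2 (v i - v (i - 1)) (v (i + 1) - v i)

/-- Vertex `i` of a simple polygon is convex (interior angle `< π`) iff the turn
at `i` has the same (strict) sign as the orientation of the polygon. -/
def IsConvexVtx (n : ℕ) (v : ZMod n → Pt) (i : ZMod n) : Prop :=
  0 < vtxCross n v i * signedArea n v

/-- A pseudo-triangle: a simple polygon in which every vertex is strictly convex or
strictly reflex, with exactly three convex vertices. -/
def IsPseudoTriangle (n : ℕ) (v : ZMod n → Pt) : Prop :=
  IsSimplePolygon n v ∧ (∀ i : ZMod n, vtxCross n v i ≠ 0) ∧
    {i : ZMod n | IsConvexVtx n v i}.ncard = 3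

/-- A standard pseudo-triangle: each of the three side chains has at least two
edges, i.e. no two convex vertices are cyclically adjacent. -/
def IsStandardPseudoTriangle (n : ℕ) (v : ZMod n → Pt) : Prop :=
  IsPseudoTriangle n v ∧
    ∀ i : ZMod n, IsConvexVtx n v i → ¬ IsConvexVtx n v (i + 1)

/-- A mountain: a pseudo-triangle in which exactly one side chain consists of a
single edge (i.e. exactly one cyclically adjacent pair of convex vertices);
a 3-mountain is a triangle. -/
def IsMountain (n : ℕ) (v : ZMod n → Pt) : Prop :=
  IsPseudoTriangle n v ∧
    (n = 3 ∨ {i : ZMod n | IsConvexVtx n v i ∧ IsConvexVtx n v (i + 1)}.ncard = 1)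

/-- The boundary of a polygon: the union of its edges. -/
def polyBoundary (n : ℕ) (v : ZMod n → Pt) : Set Pt :=
  ⋃ i : ZMod n, segment ℝ (v i) (v (i + 1))

/-- The interior of a simple polygon: the union of the bounded connected
components of the complement of its boundary. -/
def polyInterior (n : ℕ) (v : ZMod n → Pt) : Set Pt :=
  {x : Pt | x ∉ polyBoundary n v ∧
    Bornology.IsBounded (connectedComponentIn (polyBoundary n v)ᶜ x)}

/-- A polygon is empty in `S` if its interior contains no point of `S`. -/
def EmptyIn (n : ℕ) (v : ZMod n → Pt) (S : Set Pt) : Prop :=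
  polyInterior n v ∩ S = ∅

/-- `S` contains an empty `ℓ`-pseudo-triangle. -/
def HasEmptyPseudoTriangle (ℓ : ℕ) (S : Set Pt) : Prop :=
  ∃ v : ZMod ℓ → Pt, Set.range v ⊆ S ∧ IsPseudoTriangle ℓ v ∧ EmptyIn ℓ v S

/-- A set of points is in convex position if each of them is a vertex of their
convex hull. -/
def ConvexPos (H : Set Pt) : Prop := ∀ p ∈ H, p ∉ convexHull ℝ (H \ {p})

/-- `H` is a `k`-hole in `S`: `k` points of `S` in convex position whose convex
hull contains no other point of `S` in its interior. -/
def IsHole (k : ℕ) (S H : Set Pt) : Prop :=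
  H ⊆ S ∧ H.ncard = k ∧ ConvexPos H ∧
    ∀ p ∈ S, p ∈ interior (convexHull ℝ H) → p ∈ H

/-- `S` contains a `k`-hole. -/
def HasHole (k : ℕ) (S : Set Pt) : Prop := ∃ H : Set Pt, IsHole k S H

/-- The points of `S` that are vertices of the convex hull of `S`. -/
def hullVertices (S : Set Pt) : Set Pt := {p ∈ S | p ∉ convexHull ℝ (S \ {p})}

/-- The points of `S` lying in the interior of the convex hull of `S`. -/
def interiorPts (S : Set Pt) : Set Pt := {p ∈ S | p ∈ interior (convexHull ℝ S)}

/-- `S` is `λ`-convex: every triangle with vertices in `S` contains at most `λ`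
points of `S` in its interior. -/
def LambdaConvex (lam : ℕ) (S : Set Pt) : Prop :=
  ∀ p ∈ S, ∀ q ∈ S, ∀ r ∈ S,
    (S ∩ interior (convexHull ℝ ({p, q, r} : Set Pt))).ncard ≤ lam

/-- The quantity `M_k` of K\'arolyi et al. -/
def Mval (k : ℕ) : ℕ :=
  if k % 2 = 1 then 2 ^ ((k + 1) / 2) - 1 else 3 * 2 ^ (k / 2 - 1) - 1

open Set
noncomputable section

/-! ### Basic orientation toolkit -/

/-- Orientation determinant. -/
def ori (a b c : Pt) : ℝ := (b.1 - a.1) * (c.2 - a.2) - (b.2 - a.2) * (c.1 - a.1)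

/-- `v` is a strict convex combination of `a b c`. -/
def InT (v a b c : Pt) : Prop :=
  ∃ α β γ : ℝ, 0 < α ∧ 0 < β ∧ 0 < γ ∧ α + β + γ = 1 ∧
    v.1 = α * a.1 + β * b.1 + γ * c.1 ∧ v.2 = α * a.2 + β * b.2 + γ * c.2

/-- General position through determinants. -/
def GP (S : Set Pt) : Prop :=
  ∀ a ∈ S, ∀ b ∈ S, ∀ c ∈ S, a ≠ b → a ≠ c → b ≠ c → ori a b c ≠ 0

/-- Almost convex: every triangle contains at most one point. -/
def AC (S : Set Pt) : Prop :=
  ∀ a ∈ S, ∀ b ∈ S, ∀ c ∈ S, ori a b c ≠ 0 → ∀ u ∈ S, ∀ v ∈ S,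
    InT u a b c → InT v a b c → u = v

lemma ori_rot (a b c : Pt) : ori b c a = ori a b c := by unfold ori; ring
lemma ori_rot' (a b c : Pt) : ori c a b = ori a b c := by unfold ori; ring
lemma ori_swap (a b c : Pt) : ori b a c = - ori a b c := by unfold ori; ring
lemma ori_swap' (a b c : Pt) : ori a c b = - ori a b c := by unfold ori; ring
lemma ori_self1 (a b : Pt) : ori a a b = 0 := by unfold ori; ring
lemma ori_self2 (a b : Pt) : ori a b a = 0 := by unfold ori; ring
lemma ori_self3 (a b : Pt) : ori a b b = 0 := by unfold ori; ring
lemma ori_add (a b c v : Pt) : ori a b v + ori b c v + ori c a v = ori a b c := by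
  unfold ori; ring

lemma InT.rot {v a b c : Pt} (h : InT v a b c) : InT v b c a := by
  obtain ⟨α, β, γ, h1, h2, h3, h4, h5, h6⟩ := h
  exact ⟨β, γ, α, h2, h3, h1, by linarith, by linarith, by linarith⟩

lemma InT.swap {v a b c : Pt} (h : InT v a b c) : InT v b a c := by
  obtain ⟨α, β, γ, h1, h2, h3, h4, h5, h6⟩ := h
  exact ⟨β, α, γ, h2, h1, h3, by linarith, by linarith, by linarith⟩

lemma InT.swap' {v a b c : Pt} (h : InT v a b c) : InT v a c b := h.rot.rot.swap.rot.rot.rot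

lemma InT.of_pos {v a b c : Pt} (h1 : 0 < ori a b v) (h2 : 0 < ori b c v) (h3 : 0 < ori c a v) :
    InT v a b c := by
  have hs := ori_add a b c v
  have hp : 0 < ori a b c := by linarith
  refine ⟨ori b c v / ori a b c, ori c a v / ori a b c, ori a b v / ori a b c,
    by positivity, by positivity, by positivity, ?_, ?_, ?_⟩
  · field_simp; linarith
  · field_simp; unfold ori; ring
  · field_simp; unfold ori; ring

lemma InT.ori_eq {v a b c : Pt} (h : InT v a b c) : ∃ α β γ : ℝ, 0 < α ∧ 0 < β ∧ 0 < γ ∧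
    α + β + γ = 1 ∧ ∀ x y : Pt, ori x y v = α * ori x y a + β * ori x y b + γ * ori x y c := by
  obtain ⟨α, β, γ, h1, h2, h3, h4, h5, h6⟩ := h
  refine ⟨α, β, γ, h1, h2, h3, h4, fun x y => ?_⟩
  have : γ = 1 - α - β := by linarith
  subst this
  unfold ori; rw [h5, h6]; ring

lemma InT.pos {v a b c : Pt} (h : InT v a b c) (hp : 0 < ori a b c) :
    0 < ori a b v ∧ 0 < ori b c v ∧ 0 < ori c a v := by
  obtain ⟨α, β, γ, h1, h2, h3, h4, h5⟩ := h.ori_eq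
  refine ⟨?_, ?_, ?_⟩
  · rw [h5, ori_self2, ori_self3]; simp; positivity
  · rw [h5, ori_self2, ori_self3, ori_rot]; simp; positivity
  · rw [h5, ori_self2, ori_self3, ori_rot']; simp; positivity

lemma inT_iff {v a b c : Pt} (hp : 0 < ori a b c) :
    InT v a b c ↔ 0 < ori a b v ∧ 0 < ori b c v ∧ 0 < ori c a v :=
  ⟨fun h => h.pos hp, fun h => InT.of_pos h.1 h.2.1 h.2.2⟩

lemma collinear_of_ori {a b c : Pt} (h : ori a b c = 0) : Collinear ℝ ({a, b, c} : Set Pt) := by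
  by_cases hab : a = b
  · subst hab
    simpa using collinear_pair ℝ a c
  rw [collinear_iff_of_mem (p₀ := a) (by simp)]
  refine ⟨b - a, ?_⟩
  intro p hp
  have hne : (b.1 - a.1) ^ 2 + (b.2 - a.2) ^ 2 ≠ 0 := by
    intro h0
    apply hab
    ext
    · nlinarith [sq_nonneg (b.1 - a.1), sq_nonneg (b.2 - a.2)]
    · nlinarith [sq_nonneg (b.1 - a.1), sq_nonneg (b.2 - a.2)]
  simp only [mem_insert_iff, mem_singleton_iff] at hp
  rcases hp with rfl | rfl | rfl
  · exact ⟨0, by simp⟩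
  · exact ⟨1, by simp⟩
  · refine ⟨((p.1 - a.1) * (b.1 - a.1) + (p.2 - a.2) * (b.2 - a.2)) /
      ((b.1 - a.1) ^ 2 + (b.2 - a.2) ^ 2), ?_⟩
    unfold ori at h
    ext
    · simp; field_simp; linear_combination (-(b.2 - a.2)) * h
    · simp; field_simp; linear_combination ((b.1 - a.1)) * h

lemma ori_of_collinear {a b c : Pt} (h : Collinear ℝ ({a, b, c} : Set Pt)) : ori a b c = 0 := by
  rw [collinear_iff_of_mem (p₀ := a) (by simp)] at h
  obtain ⟨v, hv⟩ := h
  obtain ⟨r, hr⟩ := hv b (by simp)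
  obtain ⟨s, hs⟩ := hv c (by simp)
  subst hr hs
  unfold ori; simp; ring

lemma genPos_iff {S : Set Pt} : GenPos S ↔ GP S := by
  constructor
  · intro h a ha b hb c hc hab hac hbc h0
    exact h a ha b hb c hc hab hac hbc (collinear_of_ori h0)
  · intro h a ha b hb c hc hab hac hbc h0
    exact h a ha b hb c hc hab hac hbc (ori_of_collinear h0)

lemma InT.mem_convexHull {v a b c : Pt} (h : InT v a b c) {T : Set Pt} (ha : a ∈ T) (hb : b ∈ T)
    (hc : c ∈ T) : v ∈ convexHull ℝ T := by
  obtain ⟨α, β, γ, h1, h2, h3, h4, h5, h6⟩ := h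
  have hv : v = α • a + β • b + γ • c := by
    ext
    · simp [h5]
    · simp [h6]
  rw [hv]
  have hcv := convex_convexHull ℝ T
  have hs := hcv.sum_mem (t := Finset.univ) (w := ![α, β, γ]) (z := ![a, b, c])
    (by intro i _; fin_cases i <;> simp <;> linarith)
    (by simp [Fin.sum_univ_three]; linarith)
    (by intro i _; fin_cases i <;> simp <;> exact subset_convexHull ℝ T ‹_›)
  simpa [Fin.sum_univ_three] using hs

lemma not_between {S : Set Pt} (hS : GP S) {v a b : Pt} (hv : v ∈ S) (ha : a ∈ S) (hb : b ∈ S)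
    (hva : v ≠ a) (hvb : v ≠ b) (hab : a ≠ b) {α β : ℝ} (h : α + β = 1)
    (hv : v = α • a + β • b) : False := by
  apply hS a ha b hb v ‹_› hab hva.symm hvb.symm
  have : α = 1 - β := by linarith
  subst this
  rw [hv]; unfold ori; simp; ring

lemma car {S T : Set Pt} (hS : GP S) (hT : T ⊆ S) {v : Pt} (hv : v ∈ S) (hvT : v ∉ T)
    (h : v ∈ convexHull ℝ T) :
    ∃ a ∈ T, ∃ b ∈ T, ∃ c ∈ T, a ≠ b ∧ a ≠ c ∧ b ≠ c ∧ InT v a b c := by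
  obtain ⟨ι, hι, z, w, hz, hai, hw, hsum, hx⟩ := eq_pos_convex_span_of_mem_convexHull h
  have hcard : Fintype.card ι ≤ 3 := by
    have := hai.card_le_finrank_succ
    have h2 : Module.finrank ℝ (vectorSpan ℝ (Set.range z)) ≤ Module.finrank ℝ Pt :=
      Submodule.finrank_le _
    have h3 : Module.finrank ℝ Pt = 2 := by simp
    rw [h3] at h2
    exact this.trans (by linarith [h2])
  have hzT : ∀ i, z i ∈ T := fun i => hz ⟨i, rfl⟩
  have hinj := hai.injective
  have e := Fintype.equivFin ι
  have hx' : ∑ i : Fin (Fintype.card ι), w (e.symm i) • z (e.symm i) = v := by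
    rw [← hx]; exact Fintype.sum_equiv e.symm _ _ (fun _ => rfl)
  have hs' : ∑ i : Fin (Fintype.card ι), w (e.symm i) = 1 := by
    rw [← hsum]; exact Fintype.sum_equiv e.symm _ _ (fun _ => rfl)
  generalize hn : Fintype.card ι = n at *
  have hne : ∀ i j : Fin n, i ≠ j → z (e.symm i) ≠ z (e.symm j) := by
    intro i j hij h
    exact hij (e.symm.injective (hinj h))
  interval_cases n
  · simp at hs'
  · simp at hs' hx'
    rw [hs'] at hx'
    simp at hx'
    exact absurd (hx' ▸ hzT _) hvT
  · rw [Fin.sum_univ_two] at hx' hs'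
    exact (not_between hS hv (hT (hzT _)) (hT (hzT _)) (fun h => hvT (h ▸ hzT _))
      (fun h => hvT (h ▸ hzT _)) (hne 0 1 (by decide)) hs' hx'.symm).elim
  · rw [Fin.sum_univ_three] at hx' hs'
    refine ⟨_, hzT (e.symm 0), _, hzT (e.symm 1), _, hzT (e.symm 2), hne 0 1 (by decide),
      hne 0 2 (by decide), hne 1 2 (by decide), w (e.symm 0), w (e.symm 1), w (e.symm 2),
      hw _, hw _, hw _, hs', ?_, ?_⟩
    · rw [← hx']; simp
    · rw [← hx']; simp

end

open Set
noncomputable section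

/-- `K ⊆ S` is a (convex, empty) hole, in the hull form. -/
def HoleT (S K : Set Pt) : Prop := K ⊆ S ∧ ∀ v ∈ S, v ∉ convexHull ℝ (K \ {v})

lemma HoleT.mono {S K K' : Set Pt} (h : HoleT S K) (hK : K' ⊆ K) : HoleT S K' :=
  ⟨hK.trans h.1, fun v hv hm => h.2 v hv (convexHull_mono (diff_subset_diff_left hK) hm)⟩

lemma HoleT.not_inT {S K : Set Pt} (h : HoleT S K) {u a b c : Pt} (hu : u ∈ S) (ha : a ∈ K)
    (hb : b ∈ K) (hc : c ∈ K) (hua : u ≠ a) (hub : u ≠ b) (huc : u ≠ c) : ¬ InT u a b c :=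
  fun hi => h.2 u hu (hi.mem_convexHull ⟨ha, hua.symm⟩ ⟨hb, hub.symm⟩ ⟨hc, huc.symm⟩)

lemma HoleT.of_tri {S K : Set Pt} (hS : GP S) (hK : K ⊆ S)
    (h : ∀ a ∈ K, ∀ b ∈ K, ∀ c ∈ K, a ≠ b → a ≠ c → b ≠ c → ∀ u ∈ S, ¬ InT u a b c) :
    HoleT S K := by
  refine ⟨hK, fun v hv hm => ?_⟩
  obtain ⟨a, ha, b, hb, c, hc, hab, hac, hbc, hi⟩ :=
    car hS (diff_subset.trans hK) hv (by simp) hm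
  exact h a ha.1 b hb.1 c hc.1 hab hac hbc v hv hi

lemma HoleT.hasHole {S K : Set Pt} (hf : S.Finite) (h : HoleT S K) {k : ℕ} (hk : k ≤ K.ncard) :
    HasHole k S := by
  obtain ⟨H, hH, hc⟩ := Set.exists_subset_card_eq hk
  have h' := h.mono hH
  refine ⟨H, h'.1, hc, fun p hp => h'.2 p (h'.1 hp), fun p hp hi => ?_⟩
  by_contra hpH
  apply h'.2 p hp
  rw [diff_singleton_eq_self hpH]
  exact interior_subset hi

/-- Affine functional vanishing at `p`. -/
def fl (A B : ℝ) (p y : Pt) : ℝ := A * (y.1 - p.1) + B * (y.2 - p.2)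

lemma exists_fl {T : Set Pt} (hT : T.Finite) {p : Pt} (hp : p ∉ convexHull ℝ T) :
    ∃ A B : ℝ, ∀ y ∈ T, 0 < fl A B p y := by
  obtain ⟨f, u, h1, h2⟩ := geometric_hahn_banach_point_closed (convex_convexHull ℝ T)
    (hT.isClosed_convexHull ℝ) hp
  refine ⟨f (1, 0), f (0, 1), fun y hy => ?_⟩
  have h3 := h2 y (subset_convexHull ℝ T hy)
  have key : ∀ z : Pt, f z = z.1 * f (1, 0) + z.2 * f (0, 1) := by
    intro z
    have : z = z.1 • ((1, 0) : Pt) + z.2 • ((0, 1) : Pt) := by ext <;> simp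
    conv_lhs => rw [this]
    rw [map_add, map_smul, map_smul]; simp
  rw [key] at h1 h3
  unfold fl
  nlinarith

lemma not_mem_of_fl {T : Set Pt} {p : Pt} {A B : ℝ} (h : ∀ y ∈ T, 0 < fl A B p y) :
    p ∉ convexHull ℝ T := by
  intro hp
  have hc : Convex ℝ {y : Pt | 0 < fl A B p y} := by
    intro x hx y hy a b ha hb hab
    have hb' : b = 1 - a := by linarith
    subst hb'
    simp only [mem_setOf_eq] at *
    have : fl A B p (a • x + (1 - a) • y) = a * fl A B p x + (1 - a) * fl A B p y := by
      unfold fl; simp; ring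
    rw [this]
    rcases ha.eq_or_lt with h0 | h0
    · subst h0; simpa using hy
    · have := mul_pos h0 hx
      have := mul_nonneg hb hy.le
      linarith
  have := convexHull_min (t := {y : Pt | 0 < fl A B p y}) h hc hp
  simp [fl] at this

lemma InT.fl_eq {v a b c : Pt} (h : InT v a b c) : ∃ α β γ : ℝ, 0 < α ∧ 0 < β ∧ 0 < γ ∧
    α + β + γ = 1 ∧ ∀ A B p, fl A B p v = α * fl A B p a + β * fl A B p b + γ * fl A B p c := by
  obtain ⟨α, β, γ, h1, h2, h3, h4, h5, h6⟩ := h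
  refine ⟨α, β, γ, h1, h2, h3, h4, fun A B p => ?_⟩
  have : γ = 1 - α - β := by linarith
  subst this
  unfold fl; rw [h5, h6]; ring

lemma fl_self (A B : ℝ) (p : Pt) : fl A B p p = 0 := by unfold fl; ring

lemma fl_pos_of_inT {T : Set Pt} {p v a b c : Pt} {A B : ℝ} (h : ∀ y ∈ T \ {p}, 0 < fl A B p y)
    (ha : a ∈ T) (hb : b ∈ T) (hc : c ∈ T) (hab : a ≠ b) (hi : InT v a b c) :
    0 < fl A B p v := by
  have h0 : ∀ y ∈ T, 0 ≤ fl A B p y := by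
    intro y hy
    by_cases hyp : y = p
    · rw [hyp, fl_self]
    · exact (h y ⟨hy, hyp⟩).le
  obtain ⟨α, β, γ, h1, h2, h3, h4, h5⟩ := hi.fl_eq
  rw [h5]
  have hA := mul_nonneg h1.le (h0 a ha)
  have hB := mul_nonneg h2.le (h0 b hb)
  have hC := mul_nonneg h3.le (h0 c hc)
  by_cases hap : a = p
  · have hbp : b ≠ p := fun h => hab (hap.trans h.symm)
    have := mul_pos h2 (h b ⟨hb, hbp⟩)
    linarith
  · have := mul_pos h1 (h a ⟨ha, hap⟩)
    linarith

/-- L1. -/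
lemma exists_inT_of_max {S K : Set Pt} (hf : S.Finite) (hS : GP S) (hK : HoleT S K)
    (hmax : ∀ K', HoleT S K' → K'.ncard ≤ K.ncard) {x : Pt} (hx : x ∈ S) (hxK : x ∉ K) :
    ∃ p ∈ K, ∃ k ∈ K, ∃ k' ∈ K, p ≠ k ∧ p ≠ k' ∧ k ≠ k' ∧ InT p x k k' := by
  have hKf : K.Finite := hf.subset hK.1
  have main : ∀ n : ℕ, ∀ x ∈ S, x ∉ K → (S ∩ convexHull ℝ (insert x K)).ncard = n →
      ∃ p ∈ K, p ∈ convexHull ℝ (insert x K \ {p}) := by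
    intro n
    induction n using Nat.strong_induction_on with
    | _ n ih =>
    intro x hx hxK hn
    by_contra hcon
    push Not at hcon
    have hins : insert x K ⊆ S := insert_subset hx hK.1
    have hnot : ¬ HoleT S (insert x K) := by
      intro h
      have := hmax _ h
      rw [ncard_insert_of_notMem hxK hKf] at this
      omega
    have : ∃ v ∈ S, v ∈ convexHull ℝ (insert x K \ {v}) := by
      by_contra hc
      push Not at hc
      exact hnot ⟨hins, hc⟩
    obtain ⟨v, hv, hvc⟩ := this
    have hxK' : x ∉ convexHull ℝ K := by
      have := hK.2 x hx
      rwa [diff_singleton_eq_self hxK] at this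
    have hvx : v ≠ x := by
      rintro rfl
      rw [insert_diff_self_of_notMem hxK] at hvc
      exact hxK' hvc
    have hvK : v ∉ K := fun h => hcon v h hvc
    have hvi : v ∉ insert x K := by simp [hvx, hvK]
    rw [diff_singleton_eq_self hvi] at hvc
    obtain ⟨a, ha, b, hb, c, hc, hab, hac, hbc, hi⟩ := car hS hins hv hvi hvc
    have hsub : convexHull ℝ (insert v K) ⊆ convexHull ℝ (insert x K) := by
      apply convexHull_min _ (convex_convexHull ℝ _)
      exact insert_subset hvc ((subset_insert _ _).trans (subset_convexHull ℝ _))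
    have hxv : x ∉ convexHull ℝ (insert v K) := by
      obtain ⟨A, B, hAB⟩ := exists_fl hKf hxK'
      apply not_mem_of_fl (A := A) (B := B)
      intro y hy
      rcases hy with rfl | hy
      · refine fl_pos_of_inT (T := insert x K) ?_ ha hb hc hab hi
        rw [insert_diff_self_of_notMem hxK]; exact hAB
      · exact hAB y hy
    obtain ⟨p, hp, hpc⟩ := ih (S ∩ convexHull ℝ (insert v K)).ncard (by
      rw [← hn]
      apply ncard_lt_ncard _ (hf.subset inter_subset_left)
      refine ⟨inter_subset_inter_right _ hsub, fun h => hxv ?_⟩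
      exact (h ⟨hx, subset_convexHull ℝ _ (mem_insert _ _)⟩).2) v hv hvK rfl
    obtain ⟨A, B, hAB⟩ := exists_fl ((hKf.insert x).subset diff_subset) (hcon p hp)
    refine not_mem_of_fl (A := A) (B := B) ?_ hpc
    rintro y ⟨hy, hyp⟩
    rcases hy with rfl | hy
    · exact fl_pos_of_inT hAB ha hb hc hab hi
    · exact hAB y ⟨Or.inr hy, hyp⟩
  obtain ⟨p, hp, hpc⟩ := main _ x hx hxK rfl
  have hins : insert x K ⊆ S := insert_subset hx hK.1
  obtain ⟨a, ha, b, hb, c, hc, hab, hac, hbc, hi⟩ :=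
    car hS (diff_subset.trans hins) (hK.1 hp) (by simp) hpc
  have hpS := hK.1 hp
  obtain ⟨ha, ha'⟩ := ha
  obtain ⟨hb, hb'⟩ := hb
  obtain ⟨hc, hc'⟩ := hc
  simp only [mem_singleton_iff] at ha' hb' hc'
  refine ⟨p, hp, ?_⟩
  by_cases hax : a = x
  · subst hax
    exact ⟨b, hb.resolve_left (Ne.symm hab), c, hc.resolve_left (Ne.symm hac), Ne.symm hb',
      Ne.symm hc', hbc, hi⟩
  by_cases hbx : b = x
  · subst hbx
    exact ⟨a, ha.resolve_left hab, c, hc.resolve_left (Ne.symm hbc), Ne.symm ha',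
      Ne.symm hc', hac, hi.swap⟩
  by_cases hcx : c = x
  · subst hcx
    exact ⟨a, ha.resolve_left hac, b, hb.resolve_left hbc, Ne.symm ha',
      Ne.symm hb', hab, hi.rot.rot⟩
  exact (hK.not_inT hpS (ha.resolve_left hax) (hb.resolve_left hbx) (hc.resolve_left hcx)
    (Ne.symm ha') (Ne.symm hb') (Ne.symm hc') hi).elim

end

open Set
noncomputable section

/-- The standing assumptions for the upper bound. -/
structure Ctx (S K : Set Pt) : Prop where
  fin : S.Finite
  gp : GP S
  ac : AC S
  hole : HoleT S K
  max : ∀ K', HoleT S K' → K'.ncard ≤ K.ncard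

/-- `x` is attached to `p`. -/
def Att (K : Set Pt) (p x : Pt) : Prop :=
  p ∈ K ∧ ∃ k ∈ K, ∃ k' ∈ K, p ≠ k ∧ p ≠ k' ∧ k ≠ k' ∧ InT p x k k'

lemma InT.ne_vertex {v a b c : Pt} (h : InT v a b c) (hp : ori a b c ≠ 0) :
    v ≠ a ∧ v ≠ b ∧ v ≠ c := by
  obtain ⟨α, β, γ, h1, h2, h3, h4, h5⟩ := h.ori_eq
  have e1 := h5 a b
  have e2 := h5 b c
  rw [ori_self2, ori_self3] at e1 e2
  rw [ori_rot a b c] at e2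
  refine ⟨?_, ?_, ?_⟩
  · rintro rfl
    rw [ori_self2] at e1
    have : γ * ori v b c = 0 := by linarith
    simp [h3.ne', hp] at this
  · rintro rfl
    rw [ori_self3] at e1
    have : γ * ori a v c = 0 := by linarith
    simp [h3.ne', hp] at this
  · rintro rfl
    rw [ori_self3] at e2
    have : α * ori a b v = 0 := by linarith
    simp [h1.ne', hp] at this

lemma fl_ident (A B : ℝ) (p x l r : Pt) :
    fl A B p x * ori p l r + fl A B p l * ori p r x + fl A B p r * ori p x l = 0 := by
  unfold fl ori; ring

lemma Ctx.ex_fl {S K : Set Pt} (C : Ctx S K) {p : Pt} (hp : p ∈ K) :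
    ∃ A B : ℝ, ∀ y ∈ K \ {p}, 0 < fl A B p y :=
  exists_fl ((C.fin.subset C.hole.1).subset sdiff_subset) (C.hole.2 p (C.hole.1 hp))

lemma Att.fl_neg {K : Set Pt} {p x : Pt} (h : Att K p x) {A B : ℝ}
    (hf : ∀ y ∈ K \ {p}, 0 < fl A B p y) : fl A B p x < 0 := by
  obtain ⟨hp, k, hk, k', hk', hpk, hpk', hkk, hi⟩ := h
  obtain ⟨α, β, γ, h1, h2, h3, h4, h5⟩ := hi.fl_eq
  have h6 := h5 A B p
  rw [fl_self] at h6
  have := mul_pos h2 (hf k ⟨hk, hpk.symm⟩)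
  have := mul_pos h3 (hf k' ⟨hk', hpk'.symm⟩)
  have : α * fl A B p x < 0 := by linarith
  by_contra hc
  push Not at hc
  have := mul_nonneg h1.le hc
  linarith

lemma core_l3 {p x l r : Pt} {A B : ℝ} (hx : fl A B p x < 0) (hl : 0 < fl A B p l)
    (hr : 0 < fl A B p r) (h1 : 0 < ori p x l) (h2 : ori p x r < 0) :
    0 < ori p l r ∧ InT p x l r := by
  have hi := fl_ident A B p x l r
  have h3 : 0 < ori p r x := by rw [ori_swap']; linarith
  have h4 : 0 < ori p l r := by
    have := mul_pos hl h3
    have := mul_pos hr h1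
    by_contra hc
    push Not at hc
    have := mul_nonneg_of_nonpos_of_nonpos hx.le hc
    linarith
  refine ⟨h4, InT.of_pos ?_ ?_ ?_⟩
  · rwa [ori_rot]
  · rwa [ori_rot]
  · rwa [ori_rot]

lemma Att.l3 {S K : Set Pt} (C : Ctx S K) {p x l r : Pt} (h : Att K p x) (hl : l ∈ K)
    (hr : r ∈ K) (h1 : 0 < ori p x l) (h2 : ori p x r < 0) :
    0 < ori p l r ∧ InT p x l r := by
  obtain ⟨A, B, hf⟩ := C.ex_fl h.1
  have hlp : l ≠ p := by rintro rfl; rw [ori_self2] at h1; exact lt_irrefl _ h1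
  have hrp : r ≠ p := by rintro rfl; rw [ori_self2] at h2; exact lt_irrefl _ h2
  exact core_l3 (h.fl_neg hf) (hf l ⟨hl, hlp⟩) (hf r ⟨hr, hrp⟩) h1 h2

lemma Att.l3' {S K : Set Pt} (C : Ctx S K) {p x l r : Pt} (h : Att K p x) (hl : l ∈ K)
    (hr : r ∈ K) (h1 : ori p x l * ori p x r < 0) : InT p x l r := by
  rcases mul_neg_iff.1 h1 with ⟨h1, h2⟩ | ⟨h1, h2⟩
  · exact (h.l3 C hl hr h1 h2).2
  · exact (h.l3 C hr hl h2 h1).2.swap'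

lemma Att.ori_ne {S K : Set Pt} (C : Ctx S K) {p x y : Pt} (h : Att K p x) (hx : x ∈ S)
    (hxK : x ∉ K) (hy : y ∈ K) (hyp : y ≠ p) : ori p x y ≠ 0 :=
  C.gp p (C.hole.1 h.1) x hx y (C.hole.1 hy) (fun e => hxK (e ▸ h.1)) hyp.symm
    (fun e => hxK (e ▸ hy))

lemma Att.sides {S K : Set Pt} (C : Ctx S K) {p x : Pt} (h : Att K p x) (hx : x ∈ S)
    (hxK : x ∉ K) : (∃ l ∈ K, 0 < ori p x l) ∧ (∃ r ∈ K, ori p x r < 0) := by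
  have h' := h
  obtain ⟨hp, k, hk, k', hk', hpk, hpk', hkk, hi⟩ := h'
  obtain ⟨α, β, γ, h1, h2, h3, h4, h5⟩ := hi.ori_eq
  have h6 := h5 p x
  rw [ori_self2, ori_self3] at h6
  rcases lt_or_gt_of_ne (h.ori_ne C hx hxK hk hpk.symm) with hc | hc
  · have := mul_pos_of_neg_of_neg hc (neg_lt_zero.2 h2)
    refine ⟨⟨k', hk', ?_⟩, k, hk, hc⟩
    by_contra hcc
    push Not at hcc
    have := mul_nonpos_of_nonneg_of_nonpos h3.le hcc
    linarith
  · have := mul_pos hc h2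
    refine ⟨⟨k, hk, hc⟩, k', hk', ?_⟩
    by_contra hcc
    push Not at hcc
    have := mul_nonneg h3.le hcc
    linarith

lemma Att.ex_opp {S K : Set Pt} (C : Ctx S K) {p x : Pt} (h : Att K p x) (hx : x ∈ S)
    (hxK : x ∉ K) {q : Pt} (hq : q ∈ K) (hqp : q ≠ p) :
    ∃ r ∈ K, r ≠ p ∧ r ≠ q ∧ InT p x q r := by
  obtain ⟨⟨l, hl, hl'⟩, r, hr, hr'⟩ := h.sides C hx hxK
  have hlp : l ≠ p := by rintro rfl; rw [ori_self2] at hl'; exact lt_irrefl _ hl'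
  have hrp : r ≠ p := by rintro rfl; rw [ori_self2] at hr'; exact lt_irrefl _ hr'
  rcases lt_or_gt_of_ne (h.ori_ne C hx hxK hq hqp) with hc | hc
  · exact ⟨l, hl, hlp, by rintro rfl; linarith, h.l3' C hq hl (mul_neg_of_neg_of_pos hc hl')⟩
  · exact ⟨r, hr, hrp, by rintro rfl; linarith, h.l3' C hq hr (mul_neg_of_pos_of_neg hc hr')⟩

lemma beta_lt {α β γ : ℝ} (h1 : 0 < α) (h3 : 0 < γ) (h4 : α + β + γ = 1)
    : β < 1 := by linarith

lemma subst1 {p q a r k : Pt} (h : InT p a q r) (h' : InT q a p k) : InT p a k r := by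
  obtain ⟨α, β, γ, h1, h2, h3, h4, h5, h6⟩ := h
  obtain ⟨α', β', γ', h1', h2', h3', h4', h5', h6'⟩ := h'
  have hb : β * β' < 1 := by nlinarith
  have hd : 0 < 1 - β * β' := by linarith
  refine ⟨(α + β * α') / (1 - β * β'), (β * γ') / (1 - β * β'), γ / (1 - β * β'),
    by positivity, by positivity, by positivity, ?_, ?_, ?_⟩
  · field_simp; linear_combination h4 + β * h4'
  · rw [h5'] at h5; field_simp; linear_combination h5
  · rw [h6'] at h6; field_simp; linear_combination h6

lemma subst2 {p q a b k : Pt} (h : InT p a q k) (h' : InT q b p k) : InT p a b k := by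
  obtain ⟨α, β, γ, h1, h2, h3, h4, h5, h6⟩ := h
  obtain ⟨α', β', γ', h1', h2', h3', h4', h5', h6'⟩ := h'
  have hb : β * β' < 1 := by nlinarith
  have hd : 0 < 1 - β * β' := by linarith
  refine ⟨α / (1 - β * β'), (β * α') / (1 - β * β'), (γ + β * γ') / (1 - β * β'),
    by positivity, by positivity, by positivity, ?_, ?_, ?_⟩
  · field_simp; linear_combination h4 + β * h4'
  · rw [h5'] at h5; field_simp; linear_combination h5
  · rw [h6'] at h6; field_simp; linear_combination h6

/-- degenerate triangles contain nothing -/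
lemma InT.absurd_degen {S : Set Pt} (hS : GP S) {v a b : Pt} (hv : v ∈ S) (ha : a ∈ S)
    (hb : b ∈ S) (hva : v ≠ a) (hvb : v ≠ b) (hab : a ≠ b) : ¬ InT v a b b := by
  rintro ⟨α, β, γ, h1, h2, h3, h4, h5, h6⟩
  refine not_between hS hv ha hb hva hvb hab (α := α) (β := β + γ) (by linarith) ?_
  ext
  · simp [h5]; ring
  · simp [h6]; ring

/-- L2 -/
lemma Att.unique {S K : Set Pt} (C : Ctx S K) {p q x : Pt} (h : Att K p x) (h' : Att K q x)
    (hx : x ∈ S) (hxK : x ∉ K) : p = q := by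
  by_contra hpq
  obtain ⟨r, hr, hrp, hrq, hi⟩ := h.ex_opp C hx hxK h'.1 (Ne.symm hpq)
  obtain ⟨k, hk, hkq, hkp, hi'⟩ := h'.ex_opp C hx hxK h.1 hpq
  have hxne : ∀ y ∈ K, x ≠ y := fun y hy e => hxK (e ▸ hy)
  have e1 := subst1 hi hi'
  have e2 := (subst1 hi' hi).swap'
  have hKS := C.hole.1
  by_cases hkr : k = r
  · subst hkr
    exact e1.absurd_degen C.gp (hKS h.1) hx (hKS hr) (hxne p h.1).symm (Ne.symm hrp)
      (hxne _ hr)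
  · exact hpq (C.ac x hx k (hKS hk) r (hKS hr)
      (C.gp x hx k (hKS hk) r (hKS hr) (hxne _ hk) (hxne _ hr) hkr) p (hKS h.1) q (hKS h'.1) e1 e2)

/-- L4 -/
lemma Att.noncross {S K : Set Pt} (C : Ctx S K) {p q c c' : Pt} (h : Att K p c) (h' : Att K q c')
    (hc : c ∈ S) (hcK : c ∉ K) (hc' : c' ∈ S) (hcK' : c' ∉ K) (hpq : p ≠ q) {k : Pt} (hk : k ∈ K)
    (h1 : ori p c q * ori p c k < 0) (h2 : ori q c' p * ori q c' k < 0) : False := by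
  have hcc : c ≠ c' := by
    rintro rfl
    exact hpq (h.unique C h' hc hcK)
  have i1 := h.l3' C h'.1 hk h1
  have i2 := h'.l3' C h.1 hk h2
  have e1 := subst2 i1 i2
  have e2 := (subst2 i2 i1).swap
  have hKS := C.hole.1
  exact hpq (C.ac c hc c' hc' k (hKS hk)
      (C.gp c hc c' hc' k (hKS hk) hcc (fun e => hcK (e ▸ hk)) (fun e => hcK' (e ▸ hk)))
      p (hKS h.1) q (hKS h'.1) e1 e2)

/-- left side -/
def LS (K : Set Pt) (p x : Pt) : Set Pt := {y ∈ K | 0 < ori p x y}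
/-- right side -/
def RS (K : Set Pt) (p x : Pt) : Set Pt := {y ∈ K | ori p x y < 0}

/-- L5 -/
lemma Att.nested {S K : Set Pt} (C : Ctx S K) {p c c' : Pt} (h : Att K p c) (h' : Att K p c')
    (hc : c ∈ S) (hcK : c ∉ K) (hc' : c' ∈ S) (hcK' : c' ∉ K) :
    LS K p c ⊆ LS K p c' ∨ LS K p c' ⊆ LS K p c := by
  by_contra hcon
  push Not at hcon
  obtain ⟨⟨l, hl, hl'⟩, hcon2⟩ := And.imp_left not_subset.1 hcon
  obtain ⟨m, hm, hm'⟩ := not_subset.1 hcon2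
  have hlp : l ≠ p := by rintro rfl; have := hl.2; rw [ori_self2] at this; exact lt_irrefl _ this
  have hmp : m ≠ p := by rintro rfl; have := hm.2; rw [ori_self2] at this; exact lt_irrefl _ this
  have h1 : ori p c' l < 0 := by
    rcases lt_or_gt_of_ne (h'.ori_ne C hc' hcK' hl.1 hlp) with hh | hh
    · exact hh
    · exact (hl' ⟨hl.1, hh⟩).elim
  have h2 : ori p c m < 0 := by
    rcases lt_or_gt_of_ne (h.ori_ne C hc hcK hm.1 hmp) with hh | hh
    · exact hh
    · exact (hm' ⟨hm.1, hh⟩).elim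
  have e1 := (h.l3 C hl.1 hm.1 hl.2 h2).1
  have e2 := (h'.l3 C hm.1 hl.1 hm.2 h1).1
  rw [ori_swap'] at e2
  linarith

end

open Set
noncomputable section

/-- `z = p + s (a - p) + t (b - p)` -/
def Comb (p a b z : Pt) (s t : ℝ) : Prop :=
  z.1 - p.1 = s * (a.1 - p.1) + t * (b.1 - p.1) ∧ z.2 - p.2 = s * (a.2 - p.2) + t * (b.2 - p.2)

lemma Comb.swap {p a b z : Pt} {s t : ℝ} (h : Comb p a b z s t) : Comb p b a z t s :=
  ⟨by linarith [h.1], by linarith [h.2]⟩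

lemma InT.comb {v p a b : Pt} (h : InT v p a b) :
    ∃ s t : ℝ, 0 < s ∧ 0 < t ∧ s + t < 1 ∧ Comb p a b v s t := by
  obtain ⟨α, β, γ, h1, h2, h3, h4, h5, h6⟩ := h
  refine ⟨β, γ, h2, h3, by linarith, ?_, ?_⟩
  · rw [h5]; linear_combination p.1 * h4
  · rw [h6]; linear_combination p.2 * h4

lemma Comb.inT {v p a b : Pt} {s t : ℝ} (h : Comb p a b v s t) (hs : 0 < s) (ht : 0 < t)
    (hst : s + t < 1) : InT v p a b :=
  ⟨1 - s - t, s, t, by linarith, hs, ht, by ring, by linarith [h.1], by linarith [h.2]⟩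

lemma comb_of_ori {p a b z : Pt} (h1 : 0 < ori p a z) (h2 : 0 < ori p z b) (h3 : 0 < ori p a b) :
    ∃ s t, 0 < s ∧ 0 < t ∧ Comb p a b z s t := by
  refine ⟨ori p z b / ori p a b, ori p a z / ori p a b, by positivity, by positivity, ?_, ?_⟩
  · field_simp; unfold ori; ring
  · field_simp; unfold ori; ring

lemma Comb.ori_right {p a b z : Pt} {s t : ℝ} (h : Comb p a b z s t) (y : Pt) :
    ori p y z = s * ori p y a + t * ori p y b := by
  obtain ⟨h1, h2⟩ := h
  unfold ori
  rw [h1, h2]; ring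

lemma Comb.ori_left {p a b z : Pt} {s t : ℝ} (h : Comb p a b z s t) (y : Pt) :
    ori p z y = s * ori p a y + t * ori p b y := by
  obtain ⟨h1, h2⟩ := h
  unfold ori
  rw [h1, h2]; ring

/-- a combination with sum one is on the line `ab` -/
lemma Comb.ori_line {p a b z : Pt} {s t : ℝ} (h : Comb p a b z s t) :
    ori a b z = (1 - s - t) * ori p a b := by
  obtain ⟨h1, h2⟩ := h
  have e1 : z.1 = p.1 + s * (a.1 - p.1) + t * (b.1 - p.1) := by linarith
  have e2 : z.2 = p.2 + s * (a.2 - p.2) + t * (b.2 - p.2) := by linarith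
  unfold ori
  rw [e1, e2]; ring

lemma Comb.beyond {S : Set Pt} (hS : GP S) {p a b z : Pt} {s t : ℝ} (h : Comb p a b z s t)
    (hs : 0 < s) (ht : 0 < t) (ha : a ∈ S) (hb : b ∈ S) (hz : z ∈ S)
    (hab : a ≠ b) (haz : a ≠ z) (hbz : b ≠ z) (hn : ¬ InT z p a b) : 1 < s + t := by
  rcases lt_trichotomy (s + t) 1 with h1 | h1 | h1
  · exact (hn (h.inT hs ht h1)).elim
  · have := h.ori_line
    exact (hS a ha b hb z hz hab haz hbz (by rw [this]; rw [← h1]; ring)).elim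
  · exact h1

lemma beyond_in {S : Set Pt} (hS : GP S) {p a b z x : Pt} {s t c d e : ℝ} (h : Comb p a b z s t)
    (hs : 0 < s) (ht : 0 < t) (hst : 1 < s + t)
    (ha : a ∈ S) (hb : b ∈ S) (hx : x ∈ S) (hab : a ≠ b) (hax : a ≠ x) (hbx : b ≠ x)
    (hn : ¬ InT x p a b) (hc : 0 < c) (hd : 0 < d) (he : 0 ≤ e) (hcde : c + d + e < 1)
    (h1 : x.1 - p.1 = c * (a.1 - p.1) + d * (z.1 - p.1) + e * (b.1 - p.1))
    (h2 : x.2 - p.2 = c * (a.2 - p.2) + d * (z.2 - p.2) + e * (b.2 - p.2)) : InT x a z b := by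
  have hx' : Comb p a b x (c + d * s) (d * t + e) := by
    obtain ⟨g1, g2⟩ := h
    refine ⟨?_, ?_⟩
    · rw [h1, g1]; ring
    · rw [h2, g2]; ring
  have hb' := hx'.beyond hS (by positivity) (by positivity) ha hb hx hab hax hbx hn
  have hD : 0 < s + t - 1 := by linarith
  have hf : 0 < 1 - c - d - e := by linarith
  obtain ⟨g1, g2⟩ := h
  refine ⟨c + (1 - c - d - e) * s / (s + t - 1), d - (1 - c - d - e) / (s + t - 1),
    e + (1 - c - d - e) * t / (s + t - 1), by positivity, ?_, by positivity, ?_, ?_, ?_⟩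
  · rw [sub_pos, div_lt_iff₀ hD]; nlinarith
  · field_simp; ring
  · field_simp
    linear_combination (s + t - 1) * h1 + (1 - c - d - e) * g1
  · field_simp
    linear_combination (s + t - 1) * h2 + (1 - c - d - e) * g2

/-- sub lemma: closure -/
lemma clos_lemma {S : Set Pt} (hS : GP S) (hA : AC S) {p a b z u v : Pt} {s t : ℝ}
    (h : Comb p a b z s t) (hs : 0 < s) (ht : 0 < t) (hp : p ∈ S)
    (ha : a ∈ S) (hb : b ∈ S) (hz : z ∈ S) (hu : u ∈ S) (hv : v ∈ S)
    (hpa : p ≠ a) (hpb : p ≠ b) (hpz : p ≠ z) (hab : a ≠ b) (haz : a ≠ z) (hbz : b ≠ z)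
    (hE : ∀ w ∈ S, ¬ InT w p a b) (hiu : InT u p a z) (hiv : InT v p u b) : False := by
  have hst := h.beyond hS hs ht ha hb hz hab haz hbz (hE z hz)
  have hpab := hS p hp a ha b hb hpa hpb hab
  have hpaz := hS p hp a ha z hz hpa hpz haz
  have hazb := hS a ha z hz b hb haz hab hbz.symm
  obtain ⟨c, d, hc, hd, hcd, hcu⟩ := hiu.comb
  obtain ⟨c', d', hc', hd', hcd', hcv⟩ := hiv.comb
  have hu3 := hiu.ne_vertex hpaz
  have hub : u ≠ b := by
    rintro rfl
    have e1 := hcu.ori_right a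
    have e2 := h.ori_right a
    rw [ori_self3] at e1 e2
    have e3 : ori p a u = 0 := by
      have := hcu.ori_left a
      have h2 := h.ori_left a
      rw [ori_self3] at this h2
      have h7 : ori p u a * (1 - d * t) = 0 := by
        linear_combination this + d * h2
      have h8 : ori p z a * (1 - d * t) = 0 := by
        linear_combination t * h7 + (1 - d * t) * h2
      rw [ori_swap'] at h8
      have h9 : 1 - d * t = 0 := by
        rcases mul_eq_zero.1 h8 with h | h
        · exact absurd (neg_eq_zero.1 h) hpaz
        · exact h
      exfalso
      have h10 := hcu.ori_left z
      have h11 := h.ori_left z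
      rw [ori_self3] at h10 h11
      have h12 : (s + c * t) * ori p a z = 0 := by linear_combination - h11 - t * h10
      have h13 : 0 < s + c * t := by positivity
      rcases mul_eq_zero.1 h12 with h | h
      · linarith
      · exact hpaz h
    exact hpab e3
  have hpub := hS p hp u hu b hb hu3.1.symm hpb hub
  have hv3 := hiv.ne_vertex hpub
  have hva : v ≠ a := by
    rintro rfl
    obtain ⟨g1, g2⟩ := hcu
    obtain ⟨k1, k2⟩ := hcv
    obtain ⟨m1, m2⟩ := h
    have e1 : (1 - c' * c - c' * d * s) * ori p v b = 0 := by
      unfold ori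
      rw [g1, m1] at k1
      rw [g2, m2] at k2
      linear_combination (b.2 - p.2) * k1 - (b.1 - p.1) * k2
    have e2 : (c' * d * t + d') * ori p v b = 0 := by
      unfold ori
      rw [g1, m1] at k1
      rw [g2, m2] at k2
      linear_combination (v.2 - p.2) * k1 - (v.1 - p.1) * k2
    rcases mul_eq_zero.1 e2 with h | h
    · have : 0 < c' * d * t + d' := by positivity
      linarith
    · exact hpab h
  have i1 : InT u a z b := beyond_in hS h hs ht hst ha hb hu hab hu3.2.1.symm hub.symm (hE u hu)
    hc hd le_rfl (by linarith) (by linarith [hcu.1]) (by linarith [hcu.2])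
  have i2 : InT v a z b := beyond_in hS h hs ht hst ha hb hv hab hva.symm hv3.2.2.symm (hE v hv)
    (c := c' * c) (d := c' * d) (e := d') (by positivity) (by positivity) hd'.le (by nlinarith)
    (by rw [hcv.1, hcu.1]; ring) (by rw [hcv.2, hcu.2]; ring)
  exact hv3.2.1 (hA a ha z hz b hb hazb v hv u hu i2 i1)

/-- sub lemma: cover -/
lemma cover_lemma {S : Set Pt} (hS : GP S) (hA : AC S) {p a b z x y : Pt} {s t : ℝ}
    (h : Comb p a b z s t) (hs : 0 < s) (ht : 0 < t) (hp : p ∈ S)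
    (ha : a ∈ S) (hb : b ∈ S) (hz : z ∈ S) (hx : x ∈ S) (hy : y ∈ S)
    (hpa : p ≠ a) (hpb : p ≠ b) (hpz : p ≠ z) (hab : a ≠ b) (haz : a ≠ z) (hbz : b ≠ z)
    (hE : ∀ w ∈ S, ¬ InT w p a b) (hix : InT x p a z) (hiy : InT y p b z) : False := by
  have hst := h.beyond hS hs ht ha hb hz hab haz hbz (hE z hz)
  have hpab := hS p hp a ha b hb hpa hpb hab
  have hpaz := hS p hp a ha z hz hpa hpz haz
  have hpbz := hS p hp b hb z hz hpb hpz hbz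
  have hazb := hS a ha z hz b hb haz hab hbz.symm
  obtain ⟨c, d, hc, hd, hcd, hcx⟩ := hix.comb
  obtain ⟨c', d', hc', hd', hcd', hcy⟩ := hiy.comb
  have hx3 := hix.ne_vertex hpaz
  have hy3 := hiy.ne_vertex hpbz
  have e1 := h.ori_left a
  have e2 := h.ori_left b
  rw [ori_self3] at e1 e2
  rw [ori_swap' p a b] at e1
  have x1 := hcx.ori_right z
  have y1 := hcy.ori_right z
  rw [ori_self3] at x1 y1
  have hsq : 0 < ori p a b * ori p a b := mul_self_pos.2 hpab
  have hxy : x ≠ y := by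
    rintro rfl
    have : (c * t + c' * s) * ori p a b = 0 := by rw [e1] at x1; rw [e2] at y1; linarith
    rcases mul_eq_zero.1 this with h | h
    · have : 0 < c * t + c' * s := by positivity
      linarith
    · exact hpab h
  have hxb : b ≠ x := by
    rintro rfl
    have : (c * t + s) * ori p a b = 0 := by rw [e1] at x1; linarith
    rcases mul_eq_zero.1 this with h | h
    · have : 0 < c * t + s := by positivity
      linarith
    · exact hpab h
  have hya : a ≠ y := by
    rintro rfl
    have : (t + c' * s) * ori p a b = 0 := by rw [e1, e2] at y1; linarith
    rcases mul_eq_zero.1 this with h | h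
    · have : 0 < t + c' * s := by positivity
      linarith
    · exact hpab h
  have i1 : InT x a z b := beyond_in hS h hs ht hst ha hb hx hab hx3.2.1.symm hxb (hE x hx)
    hc hd le_rfl (by linarith) (by linarith [hcx.1]) (by linarith [hcx.2])
  have i2 : InT y b z a := beyond_in hS h.swap ht hs (by linarith) hb ha hy hab.symm hy3.2.1.symm
    hya (fun hh => hE y hy hh.swap')
    hc' hd' le_rfl (by linarith) (by linarith [hcy.1]) (by linarith [hcy.2])
  exact hxy (hA a ha z hz b hb hazb x hx y hy i1 i2.rot.swap)

/-- sub lemma: the split point sees everybody -/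
lemma split_lemma {S : Set Pt} (hS : GP S) (hA : AC S) {p a b z u v : Pt} {s t : ℝ}
    (hp : p ∈ S) (ha : a ∈ S) (hb : b ∈ S) (hz : z ∈ S) (hu : u ∈ S) (hv : v ∈ S)
    (hpa : p ≠ a) (hpb : p ≠ b) (hpz : p ≠ z) (hab : a ≠ b) (haz : a ≠ z) (hbz : b ≠ z)
    (huz : u ≠ z)
    (hiu : InT u p a b) (h : Comb p a u z s t) (hs : 0 < s) (ht : 0 < t)
    (hiv : InT v p z u) : False := by
  have hpab := hS p hp a ha b hb hpa hpb hab
  have hpbz := hS p hp b hb z hz hpb hpz hbz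
  have hpzb := hS p hp z hz b hb hpz hpb hbz.symm
  have hu3 := hiu.ne_vertex hpab
  have hpzu := hS p hp z hz u hu hpz hu3.1.symm huz.symm
  have hv3 := hiv.ne_vertex hpzu
  obtain ⟨c, d, hc, hd, hcd, hcu⟩ := hiu.comb
  obtain ⟨c', d', hc', hd', hcd', hcv⟩ := hiv.comb
  have hz' : Comb p a b z (s + t * c) (t * d) := by
    obtain ⟨g1, g2⟩ := h
    obtain ⟨k1, k2⟩ := hcu
    exact ⟨by rw [g1, k1]; ring, by rw [g2, k2]; ring⟩
  have hnz : ¬ InT z p a b := fun hi => huz (hA p hp a ha b hb hpab u hu z hz hiu hi)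
  have hbey := hz'.beyond hS (by positivity) (by positivity) ha hb hz hab haz hbz hnz
  have hP : 0 < s + t * c := by positivity
  -- `u` in terms of `z` and `b`
  have hu' : Comb p z b u (c / (s + t * c)) (d * s / (s + t * c)) := by
    obtain ⟨g1, g2⟩ := hz'
    obtain ⟨k1, k2⟩ := hcu
    refine ⟨?_, ?_⟩
    · field_simp; linear_combination (-c) * g1 + (s + t * c) * k1
    · field_simp; linear_combination (-c) * g2 + (s + t * c) * k2
  have hsum : c / (s + t * c) + d * s / (s + t * c) < 1 := by
    rw [← add_div, div_lt_one hP]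
    by_contra hcon
    push Not at hcon
    -- c + d s ≥ s + t c, s + t c + t d > 1, c + d < 1
    have h1 : c * (1 - t) ≥ s * (1 - d) := by linarith
    have h2 : s > 1 - t * (c + d) := by linarith
    have h4 : 0 < 1 - t := by
      by_contra h5
      push Not at h5
      have := mul_nonneg hc.le (by linarith : 0 ≤ t - 1)
      have := mul_pos hs (by linarith : 0 < 1 - d)
      linarith
    have h3 : s > 1 - t := by nlinarith
    nlinarith
  have i1 : InT u p z b := hu'.inT (by positivity) (by positivity) hsum
  have hcv' : Comb p z b v (c' + d' * (c / (s + t * c))) (d' * (d * s / (s + t * c))) := by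
    obtain ⟨g1, g2⟩ := hu'
    obtain ⟨k1, k2⟩ := hcv
    exact ⟨by rw [k1, g1]; ring, by rw [k2, g2]; ring⟩
  have i2 : InT v p z b := hcv'.inT (by positivity) (by positivity) (by nlinarith)
  exact hv3.2.2 (hA p hp z hz b hb hpzb v hv u hu i2 i1)

end

open Set
noncomputable section

open Classical in
lemma clique_lemma {S : Set Pt} (hS : GP S) (hA : AC S) {p : Pt} (hp : p ∈ S) (g : Pt → ℝ) (n : ℕ) :
    ∀ Z : Finset Pt, Z.card = n → (∀ z ∈ Z, z ∈ S) → p ∉ Z →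
      (∀ z ∈ Z, ∀ z' ∈ Z, 0 < ori p z z' ↔ g z < g z') →
      (∀ z ∈ Z, ∀ z' ∈ Z, ∀ u ∈ S, z ≠ z' → InT u p z z' → u ∈ Z) →
      ∃ Q ⊆ Z, Z.card < 2 ^ Q.card ∧ ∀ a ∈ Q, ∀ b ∈ Q, a ≠ b → ∀ u ∈ S, ¬ InT u p a b := by
  induction n using Nat.strong_induction_on with
  | _ n ih =>
  intro Z hn hZS hpZ hg hcl
  have hne : ∀ z ∈ Z, p ≠ z := fun z hz e => hpZ (e ▸ hz)
  have hori : ∀ z ∈ Z, ∀ z' ∈ Z, z ≠ z' → ori p z z' ≠ 0 := fun z hz z' hz' h =>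
    hS p hp z (hZS z hz) z' (hZS z' hz') (hne z hz) (hne z' hz') h
  have htot : ∀ z ∈ Z, ∀ z' ∈ Z, z ≠ z' → g z < g z' ∨ g z' < g z := by
    intro z hz z' hz' h
    rcases lt_or_gt_of_ne (hori z hz z' hz' h) with h1 | h1
    · right; rw [← hg z' hz' z hz, ori_swap']; linarith
    · left; rwa [← hg z hz z' hz']
  have hinj : ∀ z ∈ Z, ∀ z' ∈ Z, g z = g z' → z = z' := by
    intro z hz z' hz' h
    by_contra hc
    rcases htot z hz z' hz' hc with h1 | h1 <;> linarith
  have hcomb : ∀ a ∈ Z, ∀ z ∈ Z, ∀ b ∈ Z, g a < g z → g z < g b →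
      ∃ s t, 0 < s ∧ 0 < t ∧ Comb p a b z s t := by
    intro a ha z hz b hb h1 h2
    exact comb_of_ori ((hg a ha z hz).2 h1) ((hg z hz b hb).2 h2)
      ((hg a ha b hb).2 (h1.trans h2))
  -- points inside a triangle are between
  have hbtw : ∀ a ∈ Z, ∀ b ∈ Z, ∀ u ∈ Z, g a < g b → InT u p a b → g a < g u ∧ g u < g b := by
    intro a ha b hb u hu hab hi
    have h3 := hi.pos ((hg a ha b hb).2 hab)
    refine ⟨(hg a ha u hu).1 h3.1, (hg u hu b hb).1 ?_⟩
    have := h3.2.2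
    rw [ori_rot'] at this
    exact this

  rcases Z.eq_empty_or_nonempty with rfl | hZne
  · exact ⟨∅, by simp, by simp, by simp⟩
  obtain ⟨a, ha, hamin⟩ := Z.exists_min_image g hZne
  obtain ⟨b, hb, hbmax⟩ := Z.exists_max_image g hZne
  by_cases hab : a = b
  · subst hab
    have : Z = {a} := by
      ext z
      simp only [Finset.mem_singleton]
      constructor
      · intro hz
        exact hinj z hz a ha (le_antisymm (hbmax z hz) (hamin z hz))
      · rintro rfl; exact ha
    refine ⟨Z, le_rfl, ?_, ?_⟩
    · rw [this]; simp
    · intro x hx y hy hxy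
      rw [this] at hx hy
      simp at hx hy
      exact (hxy (hx.trans hy.symm)).elim
  have hgab : g a < g b := by
    rcases htot a ha b hb hab with h | h
    · exact h
    · exact absurd (hamin b hb) (not_le.2 h)
  have hamin' : ∀ z ∈ Z, z ≠ a → g a < g z := fun z hz h =>
    lt_of_le_of_ne (hamin z hz) (fun e => h (hinj z hz a ha e.symm))
  have hbmax' : ∀ z ∈ Z, z ≠ b → g z < g b := fun z hz h =>
    lt_of_le_of_ne (hbmax z hz) (fun e => h (hinj z hz b hb e))
  -- recursion tool
  have rec_tool : ∀ Y ⊆ Z, ∀ w ∈ Z, w ∉ Y → (∀ z ∈ Y, ∀ u ∈ S, ¬ InT u p w z) →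
      (∀ z ∈ Y, ∀ z' ∈ Y, ∀ u ∈ Z, g z < g z' → InT u p z z' → u ∈ Y) → Z.card ≤ 2 * Y.card + 1 →
      ∃ Q ⊆ Z, Z.card < 2 ^ Q.card ∧ ∀ a ∈ Q, ∀ b ∈ Q, a ≠ b → ∀ u ∈ S, ¬ InT u p a b := by
    intro Y hY w hw hwY hE hcY hcard
    have hlt : Y.card < n := by
      rw [← hn]
      exact Finset.card_lt_card ⟨hY, fun h => hwY (h hw)⟩
    obtain ⟨Q, hQ, hQc, hQE⟩ := ih Y.card hlt Y rfl (fun z hz => hZS z (hY hz))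
      (fun h => hpZ (hY h)) (fun z hz z' hz' => hg z (hY hz) z' (hY hz')) (by
        intro z hz z' hz' u hu hne hi
        have huZ := hcl z (hY hz) z' (hY hz') u hu hne hi
        rcases htot z (hY hz) z' (hY hz') hne with h | h
        · exact hcY z hz z' hz' u huZ h hi
        · exact hcY z' hz' z hz u huZ h hi.swap')
    refine ⟨insert w Q, Finset.insert_subset hw (hQ.trans hY), ?_, ?_⟩
    · rw [Finset.card_insert_of_notMem (fun h => hwY (hQ h)), pow_succ]
      omega
    · intro x hx y hy hxy u hu hi
      rcases Finset.mem_insert.1 hx with rfl | hx'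
      · rcases Finset.mem_insert.1 hy with rfl | hy
        · exact hxy rfl
        · exact hE y (hQ hy) u hu hi
      · rcases Finset.mem_insert.1 hy with rfl | hy
        · exact hE x (hQ hx') u hu hi.swap'
        · exact hQE x hx' y hy hxy u hu hi
  by_cases hE : ∀ w ∈ S, ¬ InT w p a b
  · -- the hull edge is empty
    set A' := Z.filter (fun z => z ≠ a ∧ ∀ u ∈ S, ¬ InT u p a z) with hA'
    set B' := Z.filter (fun z => z ≠ b ∧ ∀ u ∈ S, ¬ InT u p b z) with hB'
    have hcov : Z ⊆ A' ∪ B' := by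
      intro z hz
      rw [Finset.mem_union, hA', hB', Finset.mem_filter, Finset.mem_filter]
      by_cases hza : z = a
      · subst hza
        exact Or.inr ⟨hz, hab, fun u hu hi => hE u hu hi.swap'⟩
      by_cases hzb : z = b
      · subst hzb
        exact Or.inl ⟨hz, Ne.symm hab, hE⟩
      by_contra hcon
      push Not at hcon
      obtain ⟨x, hx, hix⟩ := hcon.1 hz hza
      obtain ⟨y, hy, hiy⟩ := hcon.2 hz hzb
      obtain ⟨s, t, hs, ht, hc⟩ := hcomb a ha z hz b hb (hamin' z hz hza) (hbmax' z hz hzb)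
      exact cover_lemma hS hA hc hs ht hp (hZS a ha) (hZS b hb) (hZS z hz) hx hy (hne a ha)
        (hne b hb) (hne z hz) hab (Ne.symm hza) (Ne.symm hzb) hE hix hiy
    have hcard : Z.card ≤ A'.card + B'.card :=
      (Finset.card_le_card hcov).trans (Finset.card_union_le _ _)
    have hAc : ∀ z ∈ A', ∀ z' ∈ A', ∀ u ∈ Z, g z < g z' → InT u p z z' → u ∈ A' := by
      intro z hz z' hz' u hu hzz hi
      rw [hA', Finset.mem_filter] at hz hz' ⊢
      obtain ⟨hz, hza, hzE⟩ := hz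
      obtain ⟨hz', hza', hzE'⟩ := hz'
      have hb2 := hbtw z hz z' hz' u hu hzz hi
      have hza2 := hamin' z hz hza
      refine ⟨hu, ?_, fun v hv hiv => ?_⟩
      · rintro rfl; linarith [hb2.1]
      obtain ⟨s, t, hs, ht, hc⟩ := hcomb a ha z hz z' hz' hza2 hzz
      have hzz' : z ≠ z' := by rintro rfl; exact lt_irrefl _ hzz
      exact clos_lemma hS hA hc.swap ht hs hp (hZS z' hz') (hZS a ha) (hZS z hz) (hZS u hu) hv
        (hne z' hz') (hne a ha) (hne z hz) hza' (Ne.symm hzz') (Ne.symm hza)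
        (fun w hw hi => hzE' w hw hi.swap') hi.swap' hiv.swap'
    have hBc : ∀ z ∈ B', ∀ z' ∈ B', ∀ u ∈ Z, g z < g z' → InT u p z z' → u ∈ B' := by
      intro z hz z' hz' u hu hzz hi
      rw [hB', Finset.mem_filter] at hz hz' ⊢
      obtain ⟨hz, hzb, hzE⟩ := hz
      obtain ⟨hz', hzb', hzE'⟩ := hz'
      have hb2 := hbtw z hz z' hz' u hu hzz hi
      have hzb2 := hbmax' z' hz' hzb'
      refine ⟨hu, ?_, fun v hv hiv => ?_⟩
      · rintro rfl; linarith [hb2.2]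
      obtain ⟨s, t, hs, ht, hc⟩ := hcomb z hz z' hz' b hb hzz hzb2
      have hzz' : z ≠ z' := by rintro rfl; exact lt_irrefl _ hzz
      exact clos_lemma hS hA hc hs ht hp (hZS z hz) (hZS b hb) (hZS z' hz') (hZS u hu) hv
        (hne z hz) (hne b hb) (hne z' hz') hzb hzz' (Ne.symm hzb')
        (fun w hw hi => hzE w hw hi.swap') hi hiv.swap'
    rcases le_total A'.card B'.card with h | h
    · exact rec_tool B' (Finset.filter_subset _ _) b hb (by simp [hB'])
        (fun z hz => (Finset.mem_filter.1 hz).2.2) hBc (by omega)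
    · exact rec_tool A' (Finset.filter_subset _ _) a ha (by simp [hA'])
        (fun z hz => (Finset.mem_filter.1 hz).2.2) hAc (by omega)
  · push Not at hE
    obtain ⟨u, hu, hiu⟩ := hE
    have huZ := hcl a ha b hb u hu hab hiu
    have hub := hbtw a ha b hb u huZ hgab hiu
    have hua : u ≠ a := by rintro rfl; exact lt_irrefl _ hub.1
    have hub' : u ≠ b := by rintro rfl; exact lt_irrefl _ hub.2
    have hpab := hS p hp a (hZS a ha) b (hZS b hb) (hne a ha) (hne b hb) hab
    have hpu := hne u huZ
    have hsee1 : ∀ z ∈ Z, g z < g u → ∀ v ∈ S, ¬ InT v p u z := by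
      intro z hz hzu v hv hiv
      have huz : u ≠ z := by rintro rfl; exact lt_irrefl _ hzu
      by_cases hza : z = a
      · subst hza
        have hv3 := hiv.ne_vertex (hori u huZ z hz huz)
        obtain ⟨c, d, hc, hd, hcd, hcu⟩ := hiu.comb
        obtain ⟨c', d', hc', hd', hcd', hcv⟩ := hiv.comb
        refine hv3.2.1 (hA p hp z (hZS z ha) b (hZS b hb) hpab v hv u hu ?_ hiu)
        have : Comb p z b v (c' * c + d') (c' * d) := by
          obtain ⟨g1, g2⟩ := hcu
          obtain ⟨k1, k2⟩ := hcv
          exact ⟨by rw [k1, g1]; ring, by rw [k2, g2]; ring⟩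
        exact this.inT (by positivity) (by positivity) (by nlinarith)
      · have hzb : z ≠ b := by rintro rfl; linarith [hub.2]
        obtain ⟨s, t, hs, ht, hc⟩ := hcomb a ha z hz u huZ (hamin' z hz hza) hzu
        exact split_lemma hS hA hp (hZS a ha) (hZS b hb) (hZS z hz) hu hv (hne a ha) (hne b hb)
          (hne z hz) hab (Ne.symm hza) (Ne.symm hzb) huz hiu hc hs ht hiv.swap'
    have hsee2 : ∀ z ∈ Z, g u < g z → ∀ v ∈ S, ¬ InT v p u z := by
      intro z hz hzu v hv hiv
      have huz : u ≠ z := by rintro rfl; exact lt_irrefl _ hzu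
      by_cases hzb : z = b
      · subst hzb
        have hv3 := hiv.ne_vertex (hori u huZ z hz huz)
        obtain ⟨c, d, hc, hd, hcd, hcu⟩ := hiu.comb
        obtain ⟨c', d', hc', hd', hcd', hcv⟩ := hiv.comb
        refine hv3.2.1 (hA p hp a (hZS a ha) z (hZS z hb) hpab v hv u hu ?_ hiu)
        have : Comb p a z v (c' * c) (c' * d + d') := by
          obtain ⟨g1, g2⟩ := hcu
          obtain ⟨k1, k2⟩ := hcv
          exact ⟨by rw [k1, g1]; ring, by rw [k2, g2]; ring⟩
        exact this.inT (by positivity) (by positivity) (by nlinarith)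
      · have hza : z ≠ a := by rintro rfl; linarith [hub.1]
        obtain ⟨s, t, hs, ht, hc⟩ := hcomb u huZ z hz b hb hzu (hbmax' z hz hzb)
        exact split_lemma hS hA hp (hZS b hb) (hZS a ha) (hZS z hz) hu hv (hne b hb) (hne a ha)
          (hne z hz) (Ne.symm hab) (Ne.symm hzb) (Ne.symm hza) huz hiu.swap' hc.swap ht hs hiv.swap'
    set A' := Z.filter (fun z => g z < g u) with hA'
    set B' := Z.filter (fun z => g u < g z) with hB'
    have hcov : Z ⊆ insert u (A' ∪ B') := by
      intro z hz
      rw [Finset.mem_insert, Finset.mem_union, hA', hB', Finset.mem_filter, Finset.mem_filter]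
      by_cases hzu : z = u
      · exact Or.inl hzu
      rcases htot z hz u huZ hzu with h | h
      · exact Or.inr (Or.inl ⟨hz, h⟩)
      · exact Or.inr (Or.inr ⟨hz, h⟩)
    have hcard : Z.card ≤ A'.card + B'.card + 1 :=
      (Finset.card_le_card hcov).trans ((Finset.card_insert_le _ _).trans
        (Nat.add_le_add_right (Finset.card_union_le _ _) 1))
    rcases le_total A'.card B'.card with h | h
    · refine rec_tool B' (Finset.filter_subset _ _) u huZ (by simp [hB'])
        (fun z hz => hsee2 z (Finset.mem_filter.1 hz).1 (Finset.mem_filter.1 hz).2) ?_ (by omega)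
      intro z hz z' hz' w hw hzz hi
      rw [hB', Finset.mem_filter] at hz hz' ⊢
      exact ⟨hw, hz.2.trans (hbtw z hz.1 z' hz'.1 w hw hzz hi).1⟩
    · refine rec_tool A' (Finset.filter_subset _ _) u huZ (by simp [hA'])
        (fun z hz => hsee1 z (Finset.mem_filter.1 hz).1 (Finset.mem_filter.1 hz).2) ?_ (by omega)
      intro z hz z' hz' w hw hzz hi
      rw [hA', Finset.mem_filter] at hz hz' ⊢
      exact ⟨hw, (hbtw z hz.1 z' hz'.1 w hw hzz hi).2.trans hz'.2⟩

/-- Fan lemma -/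
lemma fan_sorted {S : Set Pt} (hS : GP S) {p a b c v : Pt} (hp : p ∈ S)
    (ha : a ∈ S) (hb : b ∈ S) (hc : c ∈ S) (hv : v ∈ S)
    (hpb : p ≠ b) (hab : a ≠ b) (hac : a ≠ c) (hbc : b ≠ c)
    (h1 : 0 < ori p a b) (h2 : 0 < ori p b c) (h3 : 0 < ori p a c)
    (e1 : ∀ u ∈ S, ¬ InT u p a b) (e2 : ∀ u ∈ S, ¬ InT u p b c) (e3 : ∀ u ∈ S, ¬ InT u p a c)
    (hi : InT v a b c) : False := by
  obtain ⟨s, t, hs, ht, hcb⟩ := comb_of_ori h1 h2 h3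
  have hst := hcb.beyond hS hs ht ha hc hb hac hab hbc.symm (e3 b hb)
  have habc := hS a ha b hb c hc hab hac hbc
  have hv3 := hi.ne_vertex habc
  obtain ⟨α, β, γ, hα, hβ, hγ, hsum, g1, g2⟩ := hi
  obtain ⟨k1, k2⟩ := hcb
  have hα' : α = 1 - β - γ := by linarith
  rcases lt_trichotomy (γ * s) (α * t) with h | h | h
  · refine e1 v hv (Comb.inT (s := α - γ * s / t) (t := β + γ / t) ⟨?_, ?_⟩ ?_ (by positivity) ?_)
    · rw [g1]; field_simp; rw [hα']; linear_combination (-γ) * k1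
    · rw [g2]; field_simp; rw [hα']; linear_combination (-γ) * k2
    · rw [sub_pos, div_lt_iff₀ ht]; exact h
    · have : α - γ * s / t + (β + γ / t) = α + β + γ * (1 - s) / t := by field_simp; ring
      rw [this]
      have : γ * (1 - s) / t < γ := by rw [div_lt_iff₀ ht]; nlinarith
      linarith
  · have hcomb : Comb p b b v (β + γ / t) 0 := by
      refine ⟨?_, ?_⟩
      · rw [g1]; field_simp; rw [hα'] at h ⊢; linear_combination (-γ) * k1 - (a.1 - p.1) * h
      · rw [g2]; field_simp; rw [hα'] at h ⊢; linear_combination (-γ) * k2 - (a.2 - p.2) * h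
    have hvp : p ≠ v := by
      rintro rfl
      have := hcomb.ori_right a
      rw [ori_self2] at this
      have h7 : 0 < (β + γ / t) * ori p a b := by positivity
      linarith
    apply hS p hp b hb v hv hpb hvp (Ne.symm hv3.2.1)
    rw [hcomb.ori_right b, ori_self3]; ring
  · refine e2 v hv (Comb.inT (s := β + α / s) (t := γ - α * t / s) ⟨?_, ?_⟩ (by positivity) ?_ ?_)
    · rw [g1]; field_simp
      have hγ' : γ = 1 - α - β := by linarith
      rw [hγ']; linear_combination (-α) * k1
    · rw [g2]; field_simp
      have hγ' : γ = 1 - α - β := by linarith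
      rw [hγ']; linear_combination (-α) * k2
    · rw [sub_pos, div_lt_iff₀ hs]; exact h
    · have : β + α / s + (γ - α * t / s) = β + γ + α * (1 - t) / s := by field_simp; ring
      rw [this]
      have : α * (1 - t) / s < α := by rw [div_lt_iff₀ hs]; nlinarith
      linarith

lemma fan_lemma {S Y : Set Pt} (hS : GP S) {p : Pt} (hp : p ∈ S) (hY : Y ⊆ S) (hpY : p ∉ Y)
    (htr : ∀ a ∈ Y, ∀ b ∈ Y, ∀ c ∈ Y, 0 < ori p a b → 0 < ori p b c → 0 < ori p a c)
    (hE : ∀ a ∈ Y, ∀ b ∈ Y, a ≠ b → ∀ u ∈ S, ¬ InT u p a b) : HoleT S (insert p Y) := by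
  have hne : ∀ y ∈ Y, p ≠ y := fun y hy e => hpY (e ▸ hy)
  apply HoleT.of_tri hS (insert_subset hp hY)
  have key : ∀ a ∈ Y, ∀ b ∈ Y, ∀ c ∈ Y, a ≠ b → a ≠ c → b ≠ c → ∀ u ∈ S,
      0 < ori p a b → 0 < ori p b c → ¬ InT u a b c := by
    intro a ha b hb c hc hab hac hbc u hu h1 h2 hi
    exact fan_sorted hS hp (hY ha) (hY hb) (hY hc) hu (hne b hb) hab hac hbc h1 h2
      (htr a ha b hb c hc h1 h2) (hE a ha b hb hab) (hE b hb c hc hbc) (hE a ha c hc hac) hi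
  have hor : ∀ a ∈ Y, ∀ b ∈ Y, a ≠ b → 0 < ori p a b ∨ 0 < ori p b a := by
    intro a ha b hb hab
    rcases lt_or_gt_of_ne (hS p hp a (hY ha) b (hY hb) (hne a ha) (hne b hb) hab) with h | h
    · right; rw [ori_swap']; linarith
    · left; exact h
  intro a ha b hb c hc hab hac hbc u hu hi
  rcases ha with rfl | ha
  · have hb := hb.resolve_left (Ne.symm hab)
    have hc := hc.resolve_left (Ne.symm hac)
    exact hE b hb c hc hbc u hu hi
  rcases hb with rfl | hb
  · have hc := hc.resolve_left (Ne.symm hbc)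
    exact hE a ha c hc hac u hu hi.swap
  rcases hc with rfl | hc
  · exact hE a ha b hb hab u hu hi.rot.rot
  rcases hor a ha b hb hab with h1 | h1 <;> rcases hor b hb c hc hbc with h2 | h2 <;>
    rcases hor a ha c hc hac with h3 | h3
  · exact key a ha b hb c hc hab hac hbc u hu h1 h2 hi
  · exact key a ha b hb c hc hab hac hbc u hu h1 h2 hi
  · exact key a ha c hc b hb hac hab hbc.symm u hu h3 h2 hi.swap'
  · exact key c hc a ha b hb hac.symm hbc.symm hab u hu h3 h1 hi.rot.rot
  · exact key b hb a ha c hc hab.symm hbc hac u hu h1 h3 hi.swap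
  · exact key b hb c hc a ha hbc hab.symm hac.symm u hu h2 h3 hi.rot
  · exact key c hc b hb a ha hbc.symm hac.symm hab.symm u hu h2 h1 hi.rot.swap'.rot.rot
  · exact key c hc b hb a ha hbc.symm hac.symm hab.symm u hu h2 h1 hi.rot.swap'.rot.rot

end

open Set
noncomputable section

lemma ori_order {A B : ℝ} {p z z' : Pt} (h : fl A B p z < 0) (h' : fl A B p z' < 0) :
    0 < ori p z z' ↔ (A * (z.2 - p.2) - B * (z.1 - p.1)) / fl A B p z <
      (A * (z'.2 - p.2) - B * (z'.1 - p.1)) / fl A B p z' := by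
  have hAB : 0 < A ^ 2 + B ^ 2 := by
    by_contra hc
    have hA : A = 0 := by nlinarith [sq_nonneg A, sq_nonneg B]
    have hB : B = 0 := by nlinarith [sq_nonneg A, sq_nonneg B]
    rw [hA, hB] at h
    simp [fl] at h
  have hff : 0 < fl A B p z * fl A B p z' := mul_pos_of_neg_of_neg h h'
  have e : (A * (z'.2 - p.2) - B * (z'.1 - p.1)) / fl A B p z' -
      (A * (z.2 - p.2) - B * (z.1 - p.1)) / fl A B p z =
      (A ^ 2 + B ^ 2) * ori p z z' / (fl A B p z * fl A B p z') := by
    have := h.ne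
    have := h'.ne
    field_simp
    unfold fl ori; ring
  rw [← sub_pos (b := (A * (z.2 - p.2) - B * (z.1 - p.1)) / fl A B p z), e]
  rw [div_pos_iff_of_pos_right hff, mul_pos_iff_of_pos_left hAB]

lemma trans_neg {A B : ℝ} {p a b c : Pt} (ha : fl A B p a < 0) (hb : fl A B p b < 0)
    (hc : fl A B p c < 0) (h1 : 0 < ori p a b) (h2 : 0 < ori p b c) : 0 < ori p a c := by
  rw [ori_order ha hb] at h1
  rw [ori_order hb hc] at h2
  rw [ori_order ha hc]
  exact h1.trans h2

lemma fl_neg_eq (A B : ℝ) (p a : Pt) : fl (-A) (-B) p a = - fl A B p a := by unfold fl; ring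

lemma trans_pos {A B : ℝ} {p a b c : Pt} (ha : 0 < fl A B p a) (hb : 0 < fl A B p b)
    (hc : 0 < fl A B p c) (h1 : 0 < ori p a b) (h2 : 0 < ori p b c) : 0 < ori p a c :=
  trans_neg (A := -A) (B := -B) (by rw [fl_neg_eq]; linarith) (by rw [fl_neg_eq]; linarith)
    (by rw [fl_neg_eq]; linarith) h1 h2

lemma Att.card_sides {S K : Set Pt} (C : Ctx S K) {p x : Pt} (h : Att K p x) (hx : x ∈ S)
    (hxK : x ∉ K) : (LS K p x).ncard + (RS K p x).ncard + 1 = K.ncard := by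
  have hKf : K.Finite := C.fin.subset C.hole.1
  have hL : (LS K p x).Finite := hKf.subset (sep_subset _ _)
  have hR : (RS K p x).Finite := hKf.subset (sep_subset _ _)
  have hd : Disjoint (LS K p x) (RS K p x) := by
    rw [Set.disjoint_left]
    intro y h1 h2
    exact lt_asymm h1.2 h2.2
  rw [← ncard_union_eq hd hL hR]
  have hpn : p ∉ LS K p x ∪ RS K p x := by
    rintro (h | h)
    · have := h.2; rw [ori_self2] at this; exact lt_irrefl _ this
    · have := h.2; rw [ori_self2] at this; exact lt_irrefl _ this
  rw [← ncard_insert_of_notMem hpn (hL.union hR)]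
  congr 1
  ext y
  constructor
  · rintro (rfl | h1 | h1)
    · exact h.1
    · exact h1.1
    · exact h1.1
  · intro hy
    by_cases hyp : y = p
    · exact Or.inl hyp
    rcases lt_or_gt_of_ne (h.ori_ne C hx hxK hy hyp) with hc | hc
    · exact Or.inr (Or.inr ⟨hy, hc⟩)
    · exact Or.inr (Or.inl ⟨hy, hc⟩)

lemma RS_eq_of_LS {S K : Set Pt} (C : Ctx S K) {p x x' : Pt} (h : Att K p x) (hx : x ∈ S)
    (hxK : x ∉ K) (h' : Att K p x') (hx' : x' ∈ S) (hxK' : x' ∉ K)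
    (he : LS K p x = LS K p x') : RS K p x = RS K p x' := by
  have aux : ∀ z, Att K p z → z ∈ S → z ∉ K → RS K p z = (K \ {p}) \ LS K p z := by
    intro z hz hzS hzK
    ext y
    constructor
    · intro hy
      refine ⟨⟨hy.1, ?_⟩, fun h2 => lt_asymm hy.2 h2.2⟩
      rintro rfl
      have := hy.2; rw [ori_self2] at this; exact lt_irrefl _ this
    · rintro ⟨⟨hy, hyp⟩, hn⟩
      refine ⟨hy, ?_⟩
      rcases lt_or_gt_of_ne (hz.ori_ne C hzS hzK hy hyp) with hc | hc
      · exact hc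
      · exact (hn ⟨hy, hc⟩).elim
  rw [aux x h hx hxK, aux x' h' hx' hxK', he]

/-- the class of points with the same chord -/
def Cls (S K : Set Pt) (p : Pt) (L : Set Pt) : Set Pt :=
  {x ∈ S | x ∉ K ∧ Att K p x ∧ LS K p x = L}

lemma class_size {S K : Set Pt} (C : Ctx S K) {p x0 : Pt} (h0 : Att K p x0) (hx0 : x0 ∈ S)
    (hxK0 : x0 ∉ K) :
    (Cls S K p (LS K p x0)).ncard + 1 ≤ 2 ^ (min (LS K p x0).ncard (RS K p x0).ncard) := by
  classical
  set L := LS K p x0 with hLdef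
  set R := RS K p x0 with hRdef
  have hKS := C.hole.1
  have hpS := hKS h0.1
  have hKf : K.Finite := C.fin.subset hKS
  have hLK : L ⊆ K := sep_subset _ _
  have hRK : R ⊆ K := sep_subset _ _
  have hZf : (Cls S K p L).Finite := C.fin.subset (sep_subset _ _)
  obtain ⟨A, B, hf⟩ := C.ex_fl h0.1
  have hZL : ∀ z ∈ Cls S K p L, ∀ l ∈ L, 0 < ori p z l := by
    intro z hz l hl
    have : l ∈ LS K p z := by rw [hz.2.2.2]; exact hl
    exact this.2
  have hZR : ∀ z ∈ Cls S K p L, ∀ r ∈ R, ori p z r < 0 := by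
    intro z hz r hr
    have : r ∈ RS K p z := by
      rw [RS_eq_of_LS C hz.2.2.1 hz.1 hz.2.1 h0 hx0 hxK0 hz.2.2.2]; exact hr
    exact this.2
  have hZneg : ∀ z ∈ Cls S K p L, fl A B p z < 0 := fun z hz => hz.2.2.1.fl_neg hf
  have hLp : ∀ l ∈ L, l ≠ p := by
    rintro l hl rfl
    have := hl.2; rw [ori_self2] at this; exact lt_irrefl _ this
  have hRp : ∀ l ∈ R, l ≠ p := by
    rintro l hl rfl
    have := hl.2; rw [ori_self2] at this; exact lt_irrefl _ this
  have hLf : ∀ l ∈ L, 0 < fl A B p l := fun l hl => hf l ⟨hLK hl, hLp l hl⟩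
  have hRf : ∀ l ∈ R, 0 < fl A B p l := fun l hl => hf l ⟨hRK hl, hRp l hl⟩
  obtain ⟨⟨l0, hl0K, hl0⟩, r0, hr0K, hr0⟩ := h0.sides C hx0 hxK0
  have hl0L : l0 ∈ L := ⟨hl0K, hl0⟩
  have hr0R : r0 ∈ R := ⟨hr0K, hr0⟩
  have hpZ : p ∉ Cls S K p L := fun h => h.2.1 h0.1
  have hclosed : ∀ z ∈ Cls S K p L, ∀ z' ∈ Cls S K p L, ∀ u ∈ S, InT u p z z' →
      u ∈ Cls S K p L := by
    intro z hz z' hz' u hu hi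
    obtain ⟨s, t, hs, ht, hst, hcu⟩ := hi.comb
    obtain ⟨α, β, γ, q1, q2, q3, q4, q5⟩ := hi.fl_eq
    have hfu : fl A B p u < 0 := by
      rw [q5, fl_self]
      have := mul_pos_of_neg_of_neg (hZneg z hz) (neg_lt_zero.2 q2)
      have := mul_pos_of_neg_of_neg (hZneg z' hz') (neg_lt_zero.2 q3)
      linarith
    have huK : u ∉ K := by
      intro hK
      by_cases hup : u = p
      · rw [hup, fl_self] at hfu; exact lt_irrefl _ hfu
      · exact lt_asymm hfu (hf u ⟨hK, hup⟩)
    have hul : ∀ l ∈ L, 0 < ori p u l := by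
      intro l hl
      rw [hcu.ori_left]
      have := hZL z hz l hl
      have := hZL z' hz' l hl
      positivity
    have hur : ∀ r ∈ R, ori p u r < 0 := by
      intro r hr
      rw [hcu.ori_left]
      have h1 := mul_neg_of_pos_of_neg hs (hZR z hz r hr)
      have h2 := mul_neg_of_pos_of_neg ht (hZR z' hz' r hr)
      linarith
    have hi2 := (core_l3 hfu (hLf l0 hl0L) (hRf r0 hr0R) (hul l0 hl0L) (hur r0 hr0R)).2
    have hatt : Att K p u := ⟨h0.1, l0, hl0K, r0, hr0K, (hLp l0 hl0L).symm, (hRp r0 hr0R).symm,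
      by rintro rfl; exact lt_asymm hl0 hr0, hi2⟩
    refine ⟨hu, huK, hatt, ?_⟩
    ext y
    constructor
    · intro hy
      by_cases hyp : y = p
      · have := hy.2; rw [hyp, ori_self2] at this; exact (lt_irrefl _ this).elim
      rcases lt_or_gt_of_ne (h0.ori_ne C hx0 hxK0 hy.1 hyp) with hc | hc
      · exact (lt_asymm hy.2 (hur y ⟨hy.1, hc⟩)).elim
      · exact ⟨hy.1, hc⟩
    · intro hy
      exact ⟨hy.1, hul y hy⟩
  obtain ⟨Q, hQZ, hQcard, hQE⟩ := clique_lemma C.gp C.ac hpS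
    (fun z => (A * (z.2 - p.2) - B * (z.1 - p.1)) / fl A B p z) hZf.toFinset.card hZf.toFinset rfl
    (fun z hz => ((hZf.mem_toFinset).1 hz).1) (by rw [hZf.mem_toFinset]; exact hpZ)
    (fun z hz z' hz' => by
      rw [hZf.mem_toFinset] at hz hz'
      exact ori_order (hZneg z hz) (hZneg z' hz'))
    (fun z hz z' hz' u hu _ hi => by
      rw [hZf.mem_toFinset] at hz hz' ⊢
      exact hclosed z hz z' hz' u hu hi)
  have hQZ' : ∀ z ∈ Q, z ∈ Cls S K p L := fun z hz => (hZf.mem_toFinset).1 (hQZ hz)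
  have hQS : (Q : Set Pt) ⊆ S := fun z hz => (hQZ' z hz).1
  -- emptiness of the mixed triangles
  have mixed : ∀ z ∈ Cls S K p L, ∀ l ∈ L, ∀ r ∈ R, ∀ v ∈ S, ¬ InT v p r z ∧ ¬ InT v p l z := by
    intro z hz l hl r hr v hv
    have hlr := core_l3 (hZneg z hz) (hLf l hl) (hRf r hr) (hZL z hz l hl) (hZR z hz r hr)
    have hlrne : l ≠ r := by rintro rfl; exact lt_asymm hl.2 hr.2
    have hzl : z ≠ l := fun e => hz.2.1 (e ▸ hLK hl)
    have hzr : z ≠ r := fun e => hz.2.1 (e ▸ hRK hr)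
    have hzlr := C.gp z hz.1 l (hKS (hLK hl)) r (hKS (hRK hr)) hzl hzr hlrne
    have hpi := hlr.2
    obtain ⟨α, β, γ, h1, h2, h3, h4, h5, h6⟩ := hpi
    constructor
    · intro hi
      have hv3 := hi.ne_vertex (C.gp p hpS r (hKS (hRK hr)) z hz.1 (hRp r hr).symm
        (fun e => hpZ (e ▸ hz)) hzr.symm)
      apply hv3.1
      refine C.ac z hz.1 l (hKS (hLK hl)) r (hKS (hRK hr)) hzlr v hv p hpS ?_ hlr.2
      obtain ⟨α', β', γ', h1', h2', h3', h4', h5', h6'⟩ := hi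
      refine ⟨α' * α + γ', α' * β, α' * γ + β', by positivity, by positivity, by positivity, ?_,
        ?_, ?_⟩
      · linear_combination h4' + α' * h4
      · rw [h5', h5]; ring
      · rw [h6', h6]; ring
    · intro hi
      have hv3 := hi.ne_vertex (C.gp p hpS l (hKS (hLK hl)) z hz.1 (hLp l hl).symm
        (fun e => hpZ (e ▸ hz)) hzl.symm)
      apply hv3.1
      refine C.ac z hz.1 l (hKS (hLK hl)) r (hKS (hRK hr)) hzlr v hv p hpS ?_ hlr.2
      obtain ⟨α', β', γ', h1', h2', h3', h4', h5', h6'⟩ := hi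
      refine ⟨α' * α + γ', α' * β + β', α' * γ, by positivity, by positivity, by positivity, ?_,
        ?_, ?_⟩
      · linear_combination h4' + α' * h4
      · rw [h5', h5]; ring
      · rw [h6', h6]; ring
  have hKE : ∀ a ∈ K, ∀ b ∈ K, p ≠ a → p ≠ b → a ≠ b → ∀ u ∈ S, ¬ InT u p a b := by
    intro a ha b hb hpa hpb hab u hu hi
    have h3 := hi.ne_vertex (C.gp p hpS a (hKS ha) b (hKS hb) hpa hpb hab)
    exact C.hole.not_inT hu h0.1 ha hb h3.1 h3.2.1 h3.2.2 hi
  have hholeR : HoleT S (insert p (R ∪ Q)) := by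
    apply fan_lemma C.gp hpS (union_subset (hRK.trans hKS) hQS)
    · rintro (h | h)
      · exact hRp p h rfl
      · exact hpZ (hQZ' p h)
    · intro a ha b hb c hc h1 h2
      rcases ha with ha | ha <;> rcases hb with hb | hb <;> rcases hc with hc | hc
      · exact trans_pos (hRf a ha) (hRf b hb) (hRf c hc) h1 h2
      · have := hZR c (hQZ' c hc) a ha
        rw [ori_swap']; linarith
      · have := hZR b (hQZ' b hb) c hc
        exact (lt_asymm this h2).elim
      · have := hZR c (hQZ' c hc) a ha
        rw [ori_swap']; linarith
      · have := hZR a (hQZ' a ha) b hb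
        exact (lt_asymm this h1).elim
      · have := hZR a (hQZ' a ha) b hb
        exact (lt_asymm this h1).elim
      · have := hZR b (hQZ' b hb) c hc
        exact (lt_asymm this h2).elim
      · exact trans_neg (hZneg a (hQZ' a ha)) (hZneg b (hQZ' b hb)) (hZneg c (hQZ' c hc)) h1 h2
    · intro a ha b hb hab u hu hi
      rcases ha with ha | ha <;> rcases hb with hb | hb
      · exact hKE a (hRK ha) b (hRK hb) (hRp a ha).symm (hRp b hb).symm hab u hu hi
      · exact (mixed b (hQZ' b hb) l0 hl0L a ha u hu).1 hi
      · exact (mixed a (hQZ' a ha) l0 hl0L b hb u hu).1 hi.swap'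
      · exact hQE a ha b hb hab u hu hi
  have hholeL : HoleT S (insert p (L ∪ Q)) := by
    apply fan_lemma C.gp hpS (union_subset (hLK.trans hKS) hQS)
    · rintro (h | h)
      · exact hLp p h rfl
      · exact hpZ (hQZ' p h)
    · intro a ha b hb c hc h1 h2
      have bad : ∀ l ∈ L, ∀ z ∈ Q, 0 < ori p l z → False := by
        intro l hl z hz h
        have := hZL z (hQZ' z hz) l hl
        rw [ori_swap'] at this; linarith
      rcases ha with ha | ha <;> rcases hb with hb | hb <;> rcases hc with hc | hc
      · exact trans_pos (hLf a ha) (hLf b hb) (hLf c hc) h1 h2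
      · exact (bad b hb c hc h2).elim
      · exact (bad a ha b hb h1).elim
      · exact (bad a ha b hb h1).elim
      · exact hZL a (hQZ' a ha) c hc
      · exact (bad b hb c hc h2).elim
      · exact hZL a (hQZ' a ha) c hc
      · exact trans_neg (hZneg a (hQZ' a ha)) (hZneg b (hQZ' b hb)) (hZneg c (hQZ' c hc)) h1 h2
    · intro a ha b hb hab u hu hi
      rcases ha with ha | ha <;> rcases hb with hb | hb
      · exact hKE a (hLK ha) b (hLK hb) (hLp a ha).symm (hLp b hb).symm hab u hu hi
      · exact (mixed b (hQZ' b hb) a ha r0 hr0R u hu).2 hi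
      · exact (mixed a (hQZ' a ha) b hb r0 hr0R u hu).2 hi.swap'
      · exact hQE a ha b hb hab u hu hi
  have hLfin : L.Finite := hKf.subset hLK
  have hRfin : R.Finite := hKf.subset hRK
  have hcs := h0.card_sides C hx0 hxK0
  rw [← hLdef, ← hRdef] at hcs
  have cardcalc : ∀ X : Set Pt, X ⊆ K → p ∉ X → (insert p (X ∪ Q)).ncard = X.ncard + Q.card + 1 := by
    intro X hX hpX
    have hXf := hKf.subset hX
    rw [ncard_insert_of_notMem _ (hXf.union Q.finite_toSet), ncard_union_eq _ hXf Q.finite_toSet,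
      ncard_coe_finset]
    · rw [Set.disjoint_left]
      intro y hy hyQ
      exact (hQZ' y hyQ).2.1 (hX hy)
    · rintro (h | h)
      · exact hpX h
      · exact hpZ (hQZ' p h)
  have c1 := C.max _ hholeR
  have c2 := C.max _ hholeL
  rw [cardcalc R hRK (fun h => hRp p h rfl)] at c1
  rw [cardcalc L hLK (fun h => hLp p h rfl)] at c2
  have hle : Q.card ≤ min L.ncard R.ncard := by
    rw [le_min_iff]; constructor <;> omega
  have hpow := Nat.pow_le_pow_right (n := 2) (by norm_num) hle
  have hZc : (Cls S K p L).ncard = hZf.toFinset.card := ncard_eq_toFinset_card _ hZf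
  omega

end

open Set
noncomputable section

/-- A family of non-crossing chords on a finite vertex set. -/
structure ChordFam {α : Type*} [DecidableEq α] (V : Finset α)
    (F : Finset (α × Finset α × Finset α)) (m : ℕ) : Prop where
  part : ∀ f ∈ F, f.1 ∉ f.2.1 ∧ f.1 ∉ f.2.2 ∧ Disjoint f.2.1 f.2.2 ∧
    insert f.1 (f.2.1 ∪ f.2.2) = V
  sz : ∀ f ∈ F, m ≤ f.2.1.card ∧ m ≤ f.2.2.card
  nest : ∀ f ∈ F, ∀ g ∈ F, f.1 = g.1 → f.2.1 ⊆ g.2.1 ∨ g.2.1 ⊆ f.2.1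
  nc : ∀ f ∈ F, ∀ g ∈ F, f.1 ≠ g.1 → ∀ k,
    ((g.1 ∈ f.2.1 ∧ k ∈ f.2.2) ∨ (g.1 ∈ f.2.2 ∧ k ∈ f.2.1)) →
    ((f.1 ∈ g.2.1 ∧ k ∈ g.2.2) ∨ (f.1 ∈ g.2.2 ∧ k ∈ g.2.1)) → False

section
variable {α : Type*} [DecidableEq α]

lemma ChordFam.mem_iff {V : Finset α} {F : Finset (α × Finset α × Finset α)} {m : ℕ}
    (h : ChordFam V F m) {f : α × Finset α × Finset α} (hf : f ∈ F) (x : α) :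
    x ∈ V ↔ x = f.1 ∨ x ∈ f.2.1 ∨ x ∈ f.2.2 := by
  rw [← (h.part f hf).2.2.2]; simp

lemma ChordFam.eq_of {V : Finset α} {F : Finset (α × Finset α × Finset α)} {m : ℕ}
    (h : ChordFam V F m) {f g : α × Finset α × Finset α} (hf : f ∈ F) (hg : g ∈ F)
    (h1 : f.1 = g.1) (h2 : f.2.1 = g.2.1) : f = g := by
  have h3 : f.2.2 = g.2.2 := by
    ext x
    have e1 := h.mem_iff hf x
    have e2 := h.mem_iff hg x
    have d1 : x ∈ f.2.1 → x ∉ f.2.2 := fun hx => Finset.disjoint_left.1 (h.part f hf).2.2.1 hx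
    have d2 : x ∈ g.2.1 → x ∉ g.2.2 := fun hx => Finset.disjoint_left.1 (h.part g hg).2.2.1 hx
    have n1 := (h.part f hf).2.1
    have n2 := (h.part g hg).2.1
    by_cases hx : x = f.1
    · subst hx
      constructor
      · intro h; exact (n1 h).elim
      · intro h; rw [h1] at h; exact (n2 h).elim
    · have hx2 : x ≠ g.1 := h1 ▸ hx
      rw [h2] at e1 d1
      constructor
      · intro h4
        have := e2.1 (e1.2 (Or.inr (Or.inr h4)))
        tauto
      · intro h4
        have := e1.1 (e2.2 (Or.inr (Or.inr h4)))
        tauto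
  exact Prod.ext h1 (Prod.ext h2 h3)

lemma chord_core {V : Finset α} {F : Finset (α × Finset α × Finset α)} {m : ℕ} (hm : 1 ≤ m)
    (h : ChordFam V F m) {f : α × Finset α × Finset α} (hf : f ∈ F)
    (hmin : ∀ g ∈ F, f.2.1.card ≤ g.2.1.card ∧ f.2.1.card ≤ g.2.2.card)
    (IH : ∀ V' : Finset α, ∀ F' : Finset (α × Finset α × Finset α), ChordFam V' F' m →
      F'.card < F.card → F'.Nonempty → F'.card + 2 * m ≤ V'.card) :
    F.card + 2 * m ≤ V.card := by
  obtain ⟨v, hv⟩ : f.2.1.Nonempty := by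
    rw [← Finset.card_pos]; have := (h.sz f hf).1; omega
  obtain ⟨pf1, pf2, pf3, pf4⟩ := h.part f hf
  have hvV : v ∈ V := (h.mem_iff hf v).2 (Or.inr (Or.inl hv))
  have hvp : f.1 ≠ v := fun e => pf1 (e ▸ hv)
  -- chords with another base point
  have other : ∀ g ∈ F, g.1 ≠ f.1 → g.1 ∈ f.2.2 ∧
      ((f.1 ∈ g.2.1 ∧ f.2.1 ⊆ g.2.1) ∨ (f.1 ∈ g.2.2 ∧ f.2.1 ⊆ g.2.2)) := by
    intro g hg hgf
    obtain ⟨pg1, pg2, pg3, pg4⟩ := h.part g hg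
    have hqV : g.1 ∈ V := (h.mem_iff hg _).2 (Or.inl rfl)
    have hpV : f.1 ∈ V := (h.mem_iff hf _).2 (Or.inl rfl)
    have hp := ((h.mem_iff hg _).1 hpV).resolve_left (Ne.symm hgf)
    have nc := h.nc f hf g hg (Ne.symm hgf)
    have hgV : ∀ k ∈ f.2.1, k = g.1 ∨ k ∈ g.2.1 ∨ k ∈ g.2.2 := fun k hk =>
      (h.mem_iff hg k).1 ((h.mem_iff hf k).2 (Or.inr (Or.inl hk)))
    have hgV' : ∀ k ∈ f.2.2, k = g.1 ∨ k ∈ g.2.1 ∨ k ∈ g.2.2 := fun k hk =>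
      (h.mem_iff hg k).1 ((h.mem_iff hf k).2 (Or.inr (Or.inr hk)))
    have hq : g.1 ∈ f.2.2 := by
      rcases ((h.mem_iff hf _).1 hqV).resolve_left hgf with hq | hq
      · exfalso
        -- the side of `g` not containing `f.1` is inside `f.2.1 \ {g.1}`
        have sub : ∀ W : Finset α, g.1 ∉ W → W ⊆ V → f.1 ∉ W → (∀ k ∈ f.2.2, k ∉ W) →
            W.card < f.2.1.card := by
          intro W hW hWV hfW hk
          have : W ⊆ f.2.1.erase g.1 := by
            intro x hx
            rw [Finset.mem_erase]
            refine ⟨fun e => hW (e ▸ hx), ?_⟩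
            rcases (h.mem_iff hf x).1 (hWV hx) with h1 | h1 | h1
            · exact (hfW (h1 ▸ hx)).elim
            · exact h1
            · exact (hk x h1 hx).elim
          have h2 := Finset.card_le_card this
          rw [Finset.card_erase_of_mem hq] at h2
          have : 0 < f.2.1.card := Finset.card_pos.2 ⟨_, hq⟩
          omega
        rcases hp with hp | hp
        · have := sub g.2.2 pg2 (fun x hx => (h.mem_iff hg x).2 (Or.inr (Or.inr hx)))
            (fun h2 => Finset.disjoint_left.1 pg3 hp h2)
            (fun k hk hkW => nc k (Or.inl ⟨hq, hk⟩) (Or.inl ⟨hp, hkW⟩))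
          have := (hmin g hg).2
          omega
        · have := sub g.2.1 pg1 (fun x hx => (h.mem_iff hg x).2 (Or.inr (Or.inl hx)))
            (fun h2 => Finset.disjoint_left.1 pg3 h2 hp)
            (fun k hk hkW => nc k (Or.inl ⟨hq, hk⟩) (Or.inr ⟨hp, hkW⟩))
          have := (hmin g hg).1
          omega
      · exact hq
    refine ⟨hq, ?_⟩
    rcases hp with hp | hp
    · refine Or.inl ⟨hp, fun k hk => ?_⟩
      rcases hgV k hk with h1 | h1 | h1
      · exact (Finset.disjoint_left.1 pf3 hk (h1 ▸ hq)).elim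
      · exact h1
      · exact (nc k (Or.inr ⟨hq, hk⟩) (Or.inl ⟨hp, h1⟩)).elim
    · refine Or.inr ⟨hp, fun k hk => ?_⟩
      rcases hgV k hk with h1 | h1 | h1
      · exact (Finset.disjoint_left.1 pf3 hk (h1 ▸ hq)).elim
      · exact (nc k (Or.inr ⟨hq, hk⟩) (Or.inr ⟨hp, h1⟩)).elim
      · exact h1
  -- chords with the same base point
  have same : ∀ g ∈ F, g ≠ f → g.1 = f.1 → v ∈ g.2.1 ∧ f.2.1.card + 1 ≤ g.2.1.card := by
    intro g hg hne hgf
    have hmg := (hmin g hg).1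
    have hsub : f.2.1 ⊆ g.2.1 := by
      rcases h.nest f hf g hg hgf.symm with h1 | h1
      · exact h1
      · rw [Finset.eq_of_subset_of_card_le h1 hmg]
    refine ⟨hsub hv, ?_⟩
    by_contra hc
    have := Finset.eq_of_subset_of_card_le hsub (by omega)
    exact hne (h.eq_of hg hf hgf this.symm)
  -- summary
  have gbase : ∀ g ∈ F, g.1 ≠ v := by
    intro g hg hgv
    by_cases hgf : g.1 = f.1
    · exact hvp (hgf ▸ hgv)
    · have := (other g hg hgf).1
      rw [hgv] at this
      exact Finset.disjoint_left.1 pf3 hv this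
  have big : ∀ g ∈ F, g ≠ f → (v ∈ g.2.1 → m + 1 ≤ g.2.1.card) ∧ (v ∈ g.2.2 → m + 1 ≤ g.2.2.card) := by
    intro g hg hne
    have hX := (h.sz f hf).1
    obtain ⟨pg1, pg2, pg3, pg4⟩ := h.part g hg
    have pgd : v ∈ g.2.1 → v ∉ g.2.2 := fun hx => Finset.disjoint_left.1 pg3 hx
    by_cases hgf : g.1 = f.1
    · have := same g hg hne hgf
      refine ⟨fun _ => by omega, fun h2 => (pgd this.1 h2).elim⟩
    · have aux : ∀ W : Finset α, f.1 ∈ W → f.2.1 ⊆ W → m + 1 ≤ W.card := by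
        intro W h1 h2
        have := Finset.card_le_card (Finset.insert_subset h1 h2)
        rw [Finset.card_insert_of_notMem pf1] at this
        omega
      rcases (other g hg hgf).2 with ⟨h1, h2⟩ | ⟨h1, h2⟩
      · exact ⟨fun _ => aux _ h1 h2, fun h3 => (pgd (h2 hv) h3).elim⟩
      · exact ⟨fun h3 => (pgd h3 (h2 hv)).elim, fun _ => aux _ h1 h2⟩
  set del : α × Finset α × Finset α → α × Finset α × Finset α :=
    fun g => (g.1, g.2.1.erase v, g.2.2.erase v) with hdel
  have hinj : Set.InjOn del (F.erase f : Finset _) := by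
    intro g hg g' hg' he
    have hg := Finset.mem_erase.1 (Finset.mem_coe.1 hg)
    have hg' := Finset.mem_erase.1 (Finset.mem_coe.1 hg')
    simp only [hdel, Prod.mk.injEq] at he
    obtain ⟨e1, e2, e3⟩ := he
    apply h.eq_of hg.2 hg'.2 e1
    have hvv : v ∈ g.2.1 ↔ v ∈ g'.2.1 := by
      by_cases hgf : g.1 = f.1
      · have a1 := (same g hg.2 hg.1 hgf).1
        have a2 := (same g' hg'.2 hg'.1 (e1 ▸ hgf)).1
        exact ⟨fun _ => a2, fun _ => a1⟩
      · have d1 := Finset.disjoint_left.1 (h.part g hg.2).2.2.1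
        have d2 := Finset.disjoint_left.1 (h.part g' hg'.2).2.2.1
        have q1 : f.1 ∈ g.2.1 ↔ f.1 ∈ g'.2.1 := by
          have := congrArg (fun s => f.1 ∈ s) e2
          simpa [hvp] using this
        rcases (other g hg.2 hgf).2 with ⟨h1, h2⟩ | ⟨h1, h2⟩ <;>
          rcases (other g' hg'.2 (e1 ▸ hgf)).2 with ⟨h3, h4⟩ | ⟨h3, h4⟩
        · exact ⟨fun _ => h4 hv, fun _ => h2 hv⟩
        · exact (d2 (q1.1 h1) h3).elim
        · exact (d1 (q1.2 h3) h1).elim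
        · exact ⟨fun h5 => (d1 h5 (h2 hv)).elim, fun h5 => (d2 h5 (h4 hv)).elim⟩
    ext x
    by_cases hx : x = v
    · rw [hx]; exact hvv
    · have := congrArg (fun s => x ∈ s) e2
      simpa [hx] using this
  have hcardF' : ((F.erase f).image del).card = F.card - 1 := by
    rw [Finset.card_image_of_injOn hinj, Finset.card_erase_of_mem hf]
  have hFpos : 0 < F.card := Finset.card_pos.2 ⟨f, hf⟩
  have hfam : ChordFam (V.erase v) ((F.erase f).image del) m := by
    constructor
    · intro g' hg'
      obtain ⟨g, hg, rfl⟩ := Finset.mem_image.1 hg'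
      have hg := Finset.mem_erase.1 hg
      obtain ⟨pg1, pg2, pg3, pg4⟩ := h.part g hg.2
      refine ⟨fun h => pg1 (Finset.mem_of_mem_erase h), fun h => pg2 (Finset.mem_of_mem_erase h),
        ?_, ?_⟩
      · exact Finset.disjoint_of_subset_left (Finset.erase_subset _ _)
          (Finset.disjoint_of_subset_right (Finset.erase_subset _ _) pg3)
      · rw [← pg4]
        ext x
        have := gbase g hg.2
        simp only [hdel, Finset.mem_insert, Finset.mem_union, Finset.mem_erase]
        constructor
        · rintro (rfl | h | h)
          · exact ⟨this, Or.inl rfl⟩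
          · exact ⟨h.1, Or.inr (Or.inl h.2)⟩
          · exact ⟨h.1, Or.inr (Or.inr h.2)⟩
        · rintro ⟨h1, h | h | h⟩
          · exact Or.inl h
          · exact Or.inr (Or.inl ⟨h1, h⟩)
          · exact Or.inr (Or.inr ⟨h1, h⟩)
    · intro g' hg'
      obtain ⟨g, hg, rfl⟩ := Finset.mem_image.1 hg'
      have hg := Finset.mem_erase.1 hg
      have hb := big g hg.2 hg.1
      have hs := h.sz g hg.2
      constructor
      · by_cases hvg : v ∈ g.2.1
        · have := hb.1 hvg
          simp only [hdel]
          rw [Finset.card_erase_of_mem hvg]; omega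
        · simp only [hdel]; rw [Finset.erase_eq_of_notMem hvg]; exact hs.1
      · by_cases hvg : v ∈ g.2.2
        · have := hb.2 hvg
          simp only [hdel]
          rw [Finset.card_erase_of_mem hvg]; omega
        · simp only [hdel]; rw [Finset.erase_eq_of_notMem hvg]; exact hs.2
    · intro g' hg' k' hk' he
      obtain ⟨g, hg, rfl⟩ := Finset.mem_image.1 hg'
      obtain ⟨k, hk, rfl⟩ := Finset.mem_image.1 hk'
      have hg := Finset.mem_erase.1 hg
      have hk := Finset.mem_erase.1 hk
      rcases h.nest g hg.2 k hk.2 he with h1 | h1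
      · exact Or.inl (Finset.erase_subset_erase v h1)
      · exact Or.inr (Finset.erase_subset_erase v h1)
    · intro g' hg' k' hk' he y h1 h2
      obtain ⟨g, hg, rfl⟩ := Finset.mem_image.1 hg'
      obtain ⟨k, hk, rfl⟩ := Finset.mem_image.1 hk'
      have hg := Finset.mem_erase.1 hg
      have hk := Finset.mem_erase.1 hk
      simp only [hdel, Finset.mem_erase] at h1 h2
      exact h.nc g hg.2 k hk.2 he y (by tauto) (by tauto)
  have hVc : (V.erase v).card = V.card - 1 := Finset.card_erase_of_mem hvV
  have hVpos : 0 < V.card := Finset.card_pos.2 ⟨v, hvV⟩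
  rcases ((F.erase f).image del).eq_empty_or_nonempty with he | hne
  · rw [he, Finset.card_empty] at hcardF'
    have hs := h.sz f hf
    have : V.card = f.2.1.card + f.2.2.card + 1 := by
      rw [← pf4, Finset.card_insert_of_notMem (by simp [pf1, pf2]), Finset.card_union_of_disjoint pf3]
    omega
  · have := IH _ _ hfam (by omega) hne
    omega

lemma ChordFam.swap {V : Finset α} {F : Finset (α × Finset α × Finset α)} {m : ℕ}
    (h : ChordFam V F m) : ChordFam V (F.image (fun f => (f.1, f.2.2, f.2.1))) m := by
  constructor
  · intro g' hg'
    obtain ⟨g, hg, rfl⟩ := Finset.mem_image.1 hg'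
    obtain ⟨a, b, c, d⟩ := h.part g hg
    refine ⟨b, a, c.symm, ?_⟩
    simp only
    rw [Finset.union_comm]; exact d
  · intro g' hg'
    obtain ⟨g, hg, rfl⟩ := Finset.mem_image.1 hg'
    exact (h.sz g hg).symm
  · intro g' hg' k' hk' he
    obtain ⟨g, hg, rfl⟩ := Finset.mem_image.1 hg'
    obtain ⟨k, hk, rfl⟩ := Finset.mem_image.1 hk'
    simp only at he ⊢
    have aux : ∀ g ∈ F, ∀ k ∈ F, g.1 = k.1 → g.2.1 ⊆ k.2.1 → k.2.2 ⊆ g.2.2 := by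
      intro g hg k hk he hs x hx
      obtain ⟨a, b, c, d⟩ := h.part k hk
      have hxV := (h.mem_iff hk x).2 (Or.inr (Or.inr hx))
      rcases (h.mem_iff hg x).1 hxV with h1 | h1 | h1
      · rw [h1, he] at hx; exact (b hx).elim
      · exact (Finset.disjoint_left.1 c (hs h1) hx).elim
      · exact h1
    rcases h.nest g hg k hk he with h1 | h1
    · exact Or.inr (aux g hg k hk he h1)
    · exact Or.inl (aux k hk g hg he.symm h1)
  · intro g' hg' k' hk' he y h1 h2
    obtain ⟨g, hg, rfl⟩ := Finset.mem_image.1 hg'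
    obtain ⟨k, hk, rfl⟩ := Finset.mem_image.1 hk'
    simp only at he h1 h2
    exact h.nc g hg k hk he y h1.symm h2.symm

/-- Lemma N -/
lemma chord_bound {m : ℕ} (hm : 1 ≤ m) (n : ℕ) : ∀ (V : Finset α)
    (F : Finset (α × Finset α × Finset α)), F.card = n → ChordFam V F m → F.Nonempty →
    F.card + 2 * m ≤ V.card := by
  induction n using Nat.strong_induction_on with
  | _ n ih =>
  intro V F hn h hne
  have IH : ∀ V' : Finset α, ∀ F' : Finset (α × Finset α × Finset α), ChordFam V' F' m →
      F'.card < F.card → F'.Nonempty → F'.card + 2 * m ≤ V'.card :=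
    fun V' F' h' hlt hne' => ih F'.card (hn ▸ hlt) V' F' rfl h' hne'
  obtain ⟨f, hf, hmin⟩ := F.exists_min_image (fun f => min f.2.1.card f.2.2.card) hne
  have hmin' : ∀ g ∈ F, min f.2.1.card f.2.2.card ≤ g.2.1.card ∧
      min f.2.1.card f.2.2.card ≤ g.2.2.card := by
    intro g hg
    have := hmin g hg
    exact le_min_iff.1 this
  rcases le_total f.2.1.card f.2.2.card with hle | hle
  · rw [min_eq_left hle] at hmin'
    exact chord_core hm h hf hmin' IH
  · rw [min_eq_right hle] at hmin'
    have hc : (F.image (fun f => (f.1, f.2.2, f.2.1))).card = F.card := by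
      apply Finset.card_image_of_injective
      rintro ⟨a, b, c⟩ ⟨a', b', c'⟩ he
      simp only [Prod.mk.injEq] at he ⊢
      exact ⟨he.1, he.2.2, he.2.1⟩
    have := chord_core hm h.swap (f := (f.1, f.2.2, f.2.1)) (Finset.mem_image.2 ⟨f, hf, rfl⟩) (by
      intro g' hg'
      obtain ⟨g, hg, rfl⟩ := Finset.mem_image.1 hg'
      exact (hmin' g hg).symm) (by rw [hc]; exact IH)
    rwa [hc] at this

end

end

open Set
noncomputable section

/-- Upper bound for the size of an almost convex set with largest hole of size `w`. -/
def bnd (w : ℕ) : ℕ := w + ∑ j ∈ Finset.range w, 2 ^ j * (w - 2 * (j + 1))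

lemma bnd_mono {w w' : ℕ} (h : w ≤ w') : bnd w ≤ bnd w' := by
  unfold bnd
  refine Nat.add_le_add h ?_
  refine (Finset.sum_le_sum (g := fun j => 2 ^ j * (w' - 2 * (j + 1))) ?_).trans
    (Finset.sum_le_sum_of_subset (Finset.range_mono h))
  intro j _
  exact Nat.mul_le_mul_left _ (by omega)

lemma bnd_succ (w : ℕ) : bnd (w + 2) = 2 * bnd w + 2 := by
  unfold bnd
  rw [Finset.sum_range_succ', Finset.sum_range_succ]
  have : ∑ j ∈ Finset.range w, 2 ^ (j + 1) * (w + 2 - 2 * (j + 1 + 1)) =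
      2 * ∑ j ∈ Finset.range w, 2 ^ j * (w - 2 * (j + 1)) := by
    rw [Finset.mul_sum]
    refine Finset.sum_congr rfl fun j _ => ?_
    rw [show w + 2 - 2 * (j + 1 + 1) = w - 2 * (j + 1) by omega, pow_succ]; ring
  rw [this, show w + 2 - 2 * (w + 1 + 1) = 0 by omega, show w + 2 - 2 * (0 + 1) = w by omega]
  ring

lemma Mval_odd (i : ℕ) : Mval (2 * i + 3) = 2 ^ (i + 2) - 1 := by
  unfold Mval
  rw [if_pos (by omega), show (2 * i + 3 + 1) / 2 = i + 2 by omega]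

lemma Mval_even (i : ℕ) : Mval (2 * i + 4) = 3 * 2 ^ (i + 1) - 1 := by
  unfold Mval
  rw [if_neg (by omega), show (2 * i + 4) / 2 - 1 = i + 1 by omega]

lemma Mval_bnd {k : ℕ} (hk : 3 ≤ k) : bnd (k - 1) + 1 = Mval k := by
  have h1 : ∀ i, bnd (2 * i + 2) + 2 = 2 ^ (i + 2) := by
    intro i
    induction i with
    | zero => decide
    | succ i ih => rw [show 2 * (i + 1) + 2 = (2 * i + 2) + 2 by ring, bnd_succ, pow_succ]; omega
  have h2 : ∀ i, bnd (2 * i + 3) + 2 = 3 * 2 ^ (i + 1) := by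
    intro i
    induction i with
    | zero => decide
    | succ i ih => rw [show 2 * (i + 1) + 3 = (2 * i + 3) + 2 by ring, bnd_succ, pow_succ]; omega
  rcases Nat.even_or_odd' k with ⟨i, rfl | rfl⟩
  · obtain ⟨i, rfl⟩ : ∃ j, i = j + 2 := ⟨i - 2, by omega⟩
    rw [show 2 * (i + 2) = 2 * i + 4 by ring, Mval_even, show 2 * i + 4 - 1 = 2 * i + 3 by omega]
    have := h2 i; omega
  · obtain ⟨i, rfl⟩ : ∃ j, i = j + 1 := ⟨i - 1, by omega⟩
    rw [show 2 * (i + 1) + 1 = 2 * i + 3 by ring, Mval_odd, show 2 * i + 3 - 1 = 2 * i + 2 by omega]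
    have := h1 i; omega

lemma Ctx.card_le {S K : Set Pt} (C : Ctx S K) : S.ncard ≤ bnd K.ncard := by
  classical
  have hKf : K.Finite := C.fin.subset C.hole.1
  have hLf : ∀ p x, (LS K p x).Finite := fun p x => hKf.subset (sep_subset _ _)
  have hRf : ∀ p x, (RS K p x).Finite := fun p x => hKf.subset (sep_subset _ _)
  have hex : ∀ x : Pt, ∃ p, x ∈ S → x ∉ K → Att K p x := by
    intro x
    by_cases h : x ∈ S ∧ x ∉ K
    · obtain ⟨p, hp, h1⟩ := exists_inT_of_max C.fin C.gp C.hole C.max h.1 h.2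
      exact ⟨p, fun _ _ => ⟨hp, h1⟩⟩
    · exact ⟨x, fun h1 h2 => (h ⟨h1, h2⟩).elim⟩
  choose P hP using hex
  set X : Finset Pt := (C.fin.subset (sdiff_subset : S \ K ⊆ S)).toFinset with hX
  have hXm : ∀ x ∈ X, x ∈ S ∧ x ∉ K := fun x hx => by simpa [hX] using hx
  set ch : Pt → Pt × Finset Pt × Finset Pt :=
    fun x => (P x, (hLf (P x) x).toFinset, (hRf (P x) x).toFinset) with hch
  set F := X.image ch with hF
  set mu : Pt × Finset Pt × Finset Pt → ℕ := fun f => min f.2.1.card f.2.2.card with hmu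
  set V := hKf.toFinset with hV
  have hVc : V.card = K.ncard := (Set.ncard_eq_toFinset_card K hKf).symm
  have hcL : ∀ x, (ch x).2.1.card = (LS K (P x) x).ncard := fun x =>
    (Set.ncard_eq_toFinset_card _ _).symm
  have hcR : ∀ x, (ch x).2.2.card = (RS K (P x) x).ncard := fun x =>
    (Set.ncard_eq_toFinset_card _ _).symm
  have fam : ∀ m, ChordFam V (F.filter (fun f => m ≤ mu f)) m := by
    intro m
    have hmem : ∀ f ∈ F.filter (fun f => m ≤ mu f), ∃ x, x ∈ S ∧ x ∉ K ∧ Att K (P x) x ∧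
        f = ch x ∧ m ≤ mu f := by
      intro f hf
      rw [Finset.mem_filter] at hf
      obtain ⟨x, hx, rfl⟩ := Finset.mem_image.1 hf.1
      obtain ⟨h1, h2⟩ := hXm x hx
      exact ⟨x, h1, h2, hP x h1 h2, rfl, hf.2⟩
    constructor
    · intro f hf
      obtain ⟨x, hxS, hxK, hA, rfl, -⟩ := hmem f hf
      refine ⟨?_, ?_, ?_, ?_⟩
      · simp [hch, LS, ori_self2]
      · simp [hch, RS, ori_self2]
      · rw [Finset.disjoint_left]
        intro y h1 h2
        simp only [hch, Set.Finite.mem_toFinset] at h1 h2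
        exact lt_asymm h1.2 h2.2
      · ext y
        simp only [hch, hV, Set.Finite.mem_toFinset, Finset.mem_insert, Finset.mem_union, LS, RS,
          Set.mem_setOf_eq]
        constructor
        · rintro (rfl | h | h)
          · exact hA.1
          · exact h.1
          · exact h.1
        · intro hy
          by_cases hyp : y = P x
          · exact Or.inl hyp
          · have := hA.ori_ne C hxS hxK hy hyp
            rcases lt_or_gt_of_ne this with h | h
            · exact Or.inr (Or.inr ⟨hy, h⟩)
            · exact Or.inr (Or.inl ⟨hy, h⟩)
    · intro f hf
      obtain ⟨x, hxS, hxK, hA, rfl, h⟩ := hmem f hf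
      exact le_min_iff.1 h
    · intro f hf g hg he
      obtain ⟨x, hxS, hxK, hA, rfl, -⟩ := hmem f hf
      obtain ⟨y, hyS, hyK, hB, rfl, -⟩ := hmem g hg
      simp only [hch] at he ⊢
      rw [← he] at hB ⊢
      rcases hA.nested C hB hxS hxK hyS hyK with h | h
      · exact Or.inl (Set.Finite.toFinset_subset_toFinset.2 h)
      · exact Or.inr (Set.Finite.toFinset_subset_toFinset.2 h)
    · intro f hf g hg he k h1 h2
      obtain ⟨x, hxS, hxK, hA, rfl, -⟩ := hmem f hf
      obtain ⟨y, hyS, hyK, hB, rfl, -⟩ := hmem g hg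
      simp only [hch, Set.Finite.mem_toFinset, LS, RS, Set.mem_setOf_eq] at he h1 h2
      have hk : k ∈ K := by rcases h1 with h | h <;> exact h.2.1
      refine hA.noncross C hB hxS hxK hyS hyK he hk ?_ ?_
      · rcases h1 with h | h
        · exact mul_neg_of_pos_of_neg h.1.2 h.2.2
        · exact mul_neg_of_neg_of_pos h.1.2 h.2.2
      · rcases h2 with h | h
        · exact mul_neg_of_pos_of_neg h.1.2 h.2.2
        · exact mul_neg_of_neg_of_pos h.1.2 h.2.2
  have hcnt : ∀ m, 1 ≤ m → (F.filter (fun f => m ≤ mu f)).card ≤ K.ncard - 2 * m := by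
    intro m hm
    rcases (F.filter (fun f => m ≤ mu f)).eq_empty_or_nonempty with h | h
    · rw [h]; simp
    · have := chord_bound hm _ V _ rfl (fam m) h
      omega
  have hfib : ∀ f ∈ F, (X.filter (fun x => ch x = f)).card ≤
      ∑ j ∈ Finset.range K.ncard, if j + 1 ≤ mu f then 2 ^ j else 0 := by
    intro f hf
    obtain ⟨x, hx, rfl⟩ := Finset.mem_image.1 hf
    obtain ⟨hxS, hxK⟩ := hXm x hx
    have hA := hP x hxS hxK
    have h1 := class_size C hA hxS hxK
    have h2 : (X.filter (fun y => ch y = ch x)).card ≤ (Cls S K (P x) (LS K (P x) x)).ncard := by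
      rw [← Set.ncard_coe_finset]
      refine Set.ncard_le_ncard ?_ (C.fin.subset (sep_subset _ _))
      intro y hy
      simp only [Finset.coe_filter, Set.mem_setOf_eq] at hy
      obtain ⟨hyS, hyK⟩ := hXm y hy.1
      have hB := hP y hyS hyK
      simp only [hch, Prod.mk.injEq] at hy
      obtain ⟨-, e1, e2, e3⟩ := hy
      rw [Set.Finite.toFinset_inj] at e2
      rw [e1] at e2 hB
      exact ⟨hyS, hyK, hB, e2⟩
    have hm : mu (ch x) ≤ K.ncard := by
      have := hA.card_sides C hxS hxK
      have h3 : mu (ch x) ≤ (ch x).2.1.card := min_le_left _ _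
      rw [hcL] at h3
      omega
    have h4 : ∑ j ∈ Finset.range K.ncard, (if j + 1 ≤ mu (ch x) then 2 ^ j else 0) =
        2 ^ mu (ch x) - 1 := by
      rw [← Finset.sum_filter]
      have : (Finset.range K.ncard).filter (fun j => j + 1 ≤ mu (ch x)) =
          Finset.range (mu (ch x)) := by
        ext j; simp only [Finset.mem_filter, Finset.mem_range]; omega
      rw [this, Nat.geomSum_eq (le_refl 2)]; simp
    rw [h4]
    have h5 : mu (ch x) = min (LS K (P x) x).ncard (RS K (P x) x).ncard := by
      simp only [hmu]; rw [hcL, hcR]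
    rw [h5]; omega
  have hXc : X.card ≤ ∑ j ∈ Finset.range K.ncard, 2 ^ j * (K.ncard - 2 * (j + 1)) := by
    rw [Finset.card_eq_sum_card_image ch X]
    refine (Finset.sum_le_sum hfib).trans ?_
    rw [Finset.sum_comm]
    refine Finset.sum_le_sum fun j _ => ?_
    rw [← Finset.sum_filter, Finset.sum_const, smul_eq_mul, mul_comm]
    exact Nat.mul_le_mul_left _ (hcnt (j + 1) (by omega))
  have hS : S.ncard = K.ncard + X.card := by
    have h1 : X.card = (S \ K).ncard := (Set.ncard_eq_toFinset_card _ _).symm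
    have := Set.ncard_sdiff_add_ncard_of_subset C.hole.1 C.fin
    omega
  unfold bnd
  omega

theorem ac_hole {S : Set Pt} (hf : S.Finite) (hg : GP S) (ha : AC S) {k : ℕ} (hk : 3 ≤ k)
    (h : Mval k ≤ S.ncard) : HasHole k S := by
  have hne : ({K | HoleT S K} : Set (Set Pt)).Nonempty := ⟨∅, empty_subset _, by simp⟩
  have hfin : ({K | HoleT S K} : Set (Set Pt)).Finite :=
    hf.finite_subsets.subset (fun K hK => hK.1)
  obtain ⟨K, hK, hmax⟩ := Set.exists_max_image _ Set.ncard hfin hne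
  have C : Ctx S K := ⟨hf, hg, ha, hK, hmax⟩
  refine hK.hasHole hf ?_
  by_contra hc
  have h1 := C.card_le
  have h2 := bnd_mono (show K.ncard ≤ k - 1 by omega)
  have := Mval_bnd hk
  omega

end

open Set
noncomputable section

/-! ### Empty 5-pseudo-triangles -/

lemma mem_seg {x y z : Pt} (h : z ∈ segment ℝ x y) : ∃ s t : ℝ, 0 ≤ s ∧ 0 ≤ t ∧ s + t = 1 ∧
    z.1 = s * x.1 + t * y.1 ∧ z.2 = s * x.2 + t * y.2 := by
  obtain ⟨s, t, hs, ht, hst, rfl⟩ := h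
  exact ⟨s, t, hs, ht, hst, by simp, by simp⟩

lemma seg_ori {x y z : Pt} {s t : ℝ} (hst : s + t = 1) (h1 : z.1 = s * x.1 + t * y.1)
    (h2 : z.2 = s * x.2 + t * y.2) (u w : Pt) : ori u w z = s * ori u w x + t * ori u w y := by
  have : t = 1 - s := by linarith
  subst this
  unfold ori; rw [h1, h2]; ring

lemma seg_disj {u w x y z t : Pt} (hx : ori u w x ≤ 0) (hy : ori u w y ≤ 0) (hz : 0 < ori u w z)
    (ht : 0 < ori u w t) : segment ℝ x y ∩ segment ℝ z t = ∅ := by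
  rw [Set.eq_empty_iff_forall_notMem]
  rintro v ⟨h1, h2⟩
  obtain ⟨a, b, ha, hb, hab, e1, e2⟩ := mem_seg h1
  obtain ⟨c, d, hc, hd, hcd, e3, e4⟩ := mem_seg h2
  have f1 := seg_ori hab e1 e2 u w
  have f2 := seg_ori hcd e3 e4 u w
  have g1 := mul_nonneg ha (neg_nonneg.2 hx)
  have g2 := mul_nonneg hb (neg_nonneg.2 hy)
  have g3 : 0 < c * ori u w z + d * ori u w t := by
    rcases hc.eq_or_lt with h | h
    · have : d = 1 := by linarith
      rw [← h, this]; linarith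
    · have := mul_pos h hz
      have := mul_nonneg hd ht.le
      linarith
  linarith

lemma seg_disj' {u w x y z t : Pt} (hx : ori u w x ≤ 0) (hy : ori u w y ≤ 0) (hz : 0 < ori u w z)
    (ht : 0 < ori u w t) : segment ℝ z t ∩ segment ℝ x y = ∅ := by
  rw [Set.inter_comm]; exact seg_disj hx hy hz ht

lemma seg_adj {a b c : Pt} (h : ori a b c ≠ 0) : segment ℝ a b ∩ segment ℝ b c = {b} := by
  ext v
  constructor
  · rintro ⟨h1, h2⟩
    obtain ⟨s, t, hs, ht, hst, e1, e2⟩ := mem_seg h1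
    obtain ⟨s', t', hs', ht', hst', e3, e4⟩ := mem_seg h2
    have f1 := seg_ori hst e1 e2 a b
    have f2 := seg_ori hst' e3 e4 a b
    rw [ori_self2, ori_self3] at f1
    rw [ori_self3] at f2
    have : t' * ori a b c = 0 := by linarith
    have ht0 : t' = 0 := by simpa [h] using this
    have hs1 : s' = 1 := by linarith
    rw [ht0, hs1] at e3 e4
    simp only [mem_singleton_iff]
    ext <;> linarith
  · rintro rfl
    exact ⟨right_mem_segment _ _ _, left_mem_segment _ _ _⟩

lemma ray_inT {x a u w : Pt} {t : ℝ} (ht : 0 ≤ t)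
    (h : (x + t • (x - a)) ∈ segment ℝ u w) (h1 : ori a u x ≠ 0) (h2 : ori u w x ≠ 0)
    (h3 : ori w a x ≠ 0) : InT x a u w := by
  obtain ⟨s, r, hs, hr, hsr, e1, e2⟩ := mem_seg h
  have hp : 0 < 1 + t := by linarith
  have x1 : x.1 = (t * a.1 + s * u.1 + r * w.1) / (1 + t) := by
    simp at e1; field_simp; linarith
  have x2 : x.2 = (t * a.2 + s * u.2 + r * w.2) / (1 + t) := by
    simp at e2; field_simp; linarith
  have hr1 : r = 1 - s := by linarith
  have o1 : (1 + t) * ori a u x = r * ori a u w := by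
    unfold ori; rw [x1, x2, hr1]; field_simp; ring
  have o2 : (1 + t) * ori u w x = t * ori a u w := by
    unfold ori; rw [x1, x2, hr1]; field_simp; ring
  have o3 : (1 + t) * ori w a x = s * ori a u w := by
    unfold ori; rw [x1, x2, hr1]; field_simp; ring
  have ht' : 0 < t := by
    rcases ht.eq_or_lt with h | h
    · rw [← h] at o2; simp at o2; exact (h2 o2).elim
    · exact h
  have hs' : 0 < s := by
    rcases hs.eq_or_lt with h | h
    · rw [← h] at o3; simp [hp.ne', h3] at o3
    · exact h
  have hr' : 0 < r := by
    rcases hr.eq_or_lt with h | h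
    · rw [← h] at o1; simp [hp.ne', h1] at o1
    · exact h
  refine ⟨t / (1 + t), s / (1 + t), r / (1 + t), by positivity, by positivity, by positivity,
    ?_, ?_, ?_⟩
  · field_simp; linarith
  · rw [x1]; ring
  · rw [x2]; ring

/-- The pentagon. -/
def pent (a b c d e : Pt) : ZMod 5 → Pt := ![a, b, c, d, e]

lemma zmod5 (P : ZMod 5 → Prop) (h0 : P 0) (h1 : P 1) (h2 : P 2) (h3 : P 3) (h4 : P 4) :
    ∀ i, P i := by
  intro i
  have : i = 0 ∨ i = 1 ∨ i = 2 ∨ i = 3 ∨ i = 4 := by revert i; decide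
  rcases this with rfl | rfl | rfl | rfl | rfl <;> assumption

lemma pent_area (v : ZMod 5 → Pt) : signedArea 5 v = cross2 (v 0) (v 1) + cross2 (v 1) (v 2) +
    cross2 (v 2) (v 3) + cross2 (v 3) (v 4) + cross2 (v 4) (v 0) := by
  unfold signedArea
  rw [dif_neg (by norm_num)]
  exact Fin.sum_univ_five _

lemma vtx_ori (n : ℕ) (v : ZMod n → Pt) (i : ZMod n) :
    vtxCross n v i = ori (v (i - 1)) (v i) (v (i + 1)) := by
  unfold vtxCross cross2 ori
  simp only [Prod.fst_sub, Prod.snd_sub]; ring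

lemma escape {B : Set Pt} {x a : Pt} (hxa : x ≠ a)
    (h : ∀ t : ℝ, 0 ≤ t → x + t • (x - a) ∉ B) :
    ¬ Bornology.IsBounded (connectedComponentIn Bᶜ x) := by
  intro hb
  set R : Set Pt := (fun t : ℝ => x + t • (x - a)) '' Ici 0 with hR
  have hpre : IsPreconnected R :=
    (convex_Ici (0 : ℝ)).isPreconnected.image _ (by fun_prop)
  have hxR : x ∈ R := ⟨0, by simp, by simp⟩
  have hsub : R ⊆ Bᶜ := by
    rintro _ ⟨t, ht, rfl⟩; exact h t ht
  have hb' := hb.subset (hpre.subset_connectedComponentIn hxR hsub)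
  obtain ⟨C, hC⟩ := hb'.exists_norm_le
  have hpos : 0 < ‖x - a‖ := norm_pos_iff.2 (sub_ne_zero.2 hxa)
  have hC0 : 0 ≤ C := (norm_nonneg _).trans (hC x hxR)
  have h1 := hC _ ⟨(C + ‖x‖ + 1) / ‖x - a‖, by
    have := norm_nonneg x
    simp only [mem_Ici]; positivity, rfl⟩
  have h2 : ‖((C + ‖x‖ + 1) / ‖x - a‖) • (x - a)‖ = C + ‖x‖ + 1 := by
    rw [norm_smul, Real.norm_of_nonneg (by have := norm_nonneg x; positivity)]
    field_simp
  have h3 := norm_sub_le (x + ((C + ‖x‖ + 1) / ‖x - a‖) • (x - a)) x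
  rw [add_sub_cancel_left, h2] at h3
  simp only at h1
  linarith

lemma pt5 {S : Set Pt} (hS : GP S) {a b p q c : Pt} (ha : a ∈ S) (hb : b ∈ S) (hp : p ∈ S)
    (hq : q ∈ S) (hc : c ∈ S) (h1 : 0 < ori a b p) (h2 : 0 < ori a p q) (h3 : 0 < ori a q c)
    (h4 : ori b p q < 0) (h5 : ori p q c < 0) (h6 : 0 < ori a b c) (h7 : 0 < ori a b q)
    (h8 : 0 < ori a p c) (e1 : ∀ x ∈ S, ¬ InT x a b p) (e2 : ∀ x ∈ S, ¬ InT x a p q)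
    (e3 : ∀ x ∈ S, ¬ InT x a q c) : HasEmptyPseudoTriangle 5 S := by
  set v := pent a b p q c with hv
  have v0 : v 0 = a := rfl
  have v1 : v 1 = b := rfl
  have v2 : v 2 = p := rfl
  have v3 : v 3 = q := rfl
  have v4 : v 4 = c := rfl
  have n01 : a ≠ b := by rintro rfl; rw [ori_self1] at h1; exact lt_irrefl _ h1
  have n02 : a ≠ p := by rintro rfl; rw [ori_self2] at h1; exact lt_irrefl _ h1
  have n03 : a ≠ q := by rintro rfl; rw [ori_self2] at h2; exact lt_irrefl _ h2
  have n04 : a ≠ c := by rintro rfl; rw [ori_self2] at h6; exact lt_irrefl _ h6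
  have n12 : b ≠ p := by rintro rfl; rw [ori_self3] at h1; exact lt_irrefl _ h1
  have n13 : b ≠ q := by rintro rfl; rw [ori_self3] at h7; exact lt_irrefl _ h7
  have n14 : b ≠ c := by rintro rfl; rw [ori_self3] at h6; exact lt_irrefl _ h6
  have n23 : p ≠ q := by rintro rfl; rw [ori_self3] at h2; exact lt_irrefl _ h2
  have n24 : p ≠ c := by rintro rfl; rw [ori_self3] at h8; exact lt_irrefl _ h8
  have n34 : q ≠ c := by rintro rfl; rw [ori_self3] at h3; exact lt_irrefl _ h3
  have s0 : (0 : ZMod 5) + 1 = 1 := rfl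
  have s1 : (1 : ZMod 5) + 1 = 2 := rfl
  have s2 : (2 : ZMod 5) + 1 = 3 := rfl
  have s3 : (3 : ZMod 5) + 1 = 4 := rfl
  have s4 : (4 : ZMod 5) + 1 = 0 := rfl
  have t0 : (0 : ZMod 5) + 2 = 2 := rfl
  have t1 : (1 : ZMod 5) + 2 = 3 := rfl
  have t2 : (2 : ZMod 5) + 2 = 4 := rfl
  have t3 : (3 : ZMod 5) + 2 = 0 := rfl
  have t4 : (4 : ZMod 5) + 2 = 1 := rfl
  have m0 : (0 : ZMod 5) - 1 = 4 := rfl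
  have m1 : (1 : ZMod 5) - 1 = 0 := rfl
  have m2 : (2 : ZMod 5) - 1 = 1 := rfl
  have m3 : (3 : ZMod 5) - 1 = 2 := rfl
  have m4 : (4 : ZMod 5) - 1 = 3 := rfl
  have x0 : 0 < vtxCross 5 v 0 := by rw [vtx_ori, m0, s0, v0, v1, v4, ori_rot']; exact h6
  have x1 : 0 < vtxCross 5 v 1 := by rw [vtx_ori, m1, s1, v0, v1, v2]; exact h1
  have x2 : vtxCross 5 v 2 < 0 := by rw [vtx_ori, m2, s2, v1, v2, v3]; exact h4
  have x3 : vtxCross 5 v 3 < 0 := by rw [vtx_ori, m3, s3, v2, v3, v4]; exact h5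
  have x4 : 0 < vtxCross 5 v 4 := by rw [vtx_ori, m4, s4, v3, v4, v0, ori_rot]; exact h3
  have hA : 0 < signedArea 5 v := by
    have : signedArea 5 v = ori a b p + ori a p q + ori a q c := by
      rw [pent_area, v0, v1, v2, v3, v4]; unfold cross2 ori; ring
    rw [this]; linarith
  have hvS : ∀ i, v i ∈ S := zmod5 _ ha hb hp hq hc
  refine ⟨v, ?_, ⟨⟨by norm_num, ?_, ?_, ?_⟩, ?_, ?_⟩, ?_⟩
  · rintro _ ⟨i, rfl⟩; exact hvS i
  · intro i j
    revert i j
    refine zmod5 _ ?_ ?_ ?_ ?_ ?_ <;> refine zmod5 _ ?_ ?_ ?_ ?_ ?_ <;> intro h <;>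
      first
      | rfl
      | exact absurd h (by rw [v0, v1]; exact n01)
      | exact absurd h.symm (by rw [v0, v1]; exact n01)
      | exact absurd h n02
      | exact absurd h.symm n02
      | exact absurd h n03
      | exact absurd h.symm n03
      | exact absurd h n04
      | exact absurd h.symm n04
      | exact absurd h n12
      | exact absurd h.symm n12
      | exact absurd h n13
      | exact absurd h.symm n13
      | exact absurd h n14
      | exact absurd h.symm n14
      | exact absurd h n23
      | exact absurd h.symm n23
      | exact absurd h n24
      | exact absurd h.symm n24
      | exact absurd h n34
      | exact absurd h.symm n34
  · have d02 : segment ℝ a b ∩ segment ℝ p q = ∅ :=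
      seg_disj (u := a) (w := b) (ori_self2 _ _).le (ori_self3 _ _).le h1 h7
    have d03 : segment ℝ a b ∩ segment ℝ q c = ∅ :=
      seg_disj (u := a) (w := b) (ori_self2 _ _).le (ori_self3 _ _).le h7 h6
    have d13 : segment ℝ b p ∩ segment ℝ q c = ∅ :=
      seg_disj (u := a) (w := p) (by rw [ori_swap']; linarith) (ori_self3 _ _).le h2 h8
    have d41 : segment ℝ c a ∩ segment ℝ b p = ∅ :=
      seg_disj (u := c) (w := a) (ori_self2 _ _).le (ori_self3 _ _).le
        (by rw [ori_rot']; exact h6) (by rw [ori_rot']; exact h8)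
    have d42 : segment ℝ c a ∩ segment ℝ p q = ∅ :=
      seg_disj (u := c) (w := a) (ori_self2 _ _).le (ori_self3 _ _).le
        (by rw [ori_rot']; exact h8) (by rw [ori_rot']; exact h3)
    intro i j
    revert i j
    refine zmod5 _ ?_ ?_ ?_ ?_ ?_ <;> refine zmod5 _ ?_ ?_ ?_ ?_ ?_ <;> intro hh1 hh2 hh3 <;>
      first
      | exact absurd rfl hh1
      | exact absurd rfl hh2
      | exact absurd rfl hh3
      | exact d02
      | exact d03
      | exact d13
      | exact d41
      | exact d42
      | (rw [Set.inter_comm]; first | exact d02 | exact d03 | exact d13 | exact d41 | exact d42)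
  · refine zmod5 _ ?_ ?_ ?_ ?_ ?_
    · rw [s0, t0, v0, v1, v2]; exact seg_adj h1.ne'
    · rw [s1, t1, v1, v2, v3]; exact seg_adj h4.ne
    · rw [s2, t2, v2, v3, v4]; exact seg_adj h5.ne
    · rw [s3, t3, v3, v4, v0]; exact seg_adj (by rw [ori_rot]; exact h3.ne')
    · rw [s4, t4, v4, v0, v1]; exact seg_adj (by rw [ori_rot']; exact h6.ne')
  · exact zmod5 _ x0.ne' x1.ne' x2.ne x3.ne x4.ne'
  · have : {i : ZMod 5 | IsConvexVtx 5 v i} = {0, 1, 4} := by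
      ext i
      revert i
      refine zmod5 _ ?_ ?_ ?_ ?_ ?_
      · exact iff_of_true (mul_pos x0 hA) (by simp)
      · exact iff_of_true (mul_pos x1 hA) (by simp)
      · exact iff_of_false (not_lt.2 (mul_neg_of_neg_of_pos x2 hA).le) (by decide)
      · exact iff_of_false (not_lt.2 (mul_neg_of_neg_of_pos x3 hA).le) (by decide)
      · exact iff_of_true (mul_pos x4 hA) (by simp)
    rw [this, Set.ncard_eq_three]
    exact ⟨0, 1, 4, by decide, by decide, by decide, rfl⟩
  · unfold EmptyIn
    rw [Set.eq_empty_iff_forall_notMem]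
    rintro x ⟨⟨hxb, hbd⟩, hxS⟩
    have hne : ∀ i, x ≠ v i := by
      rintro i rfl
      exact hxb (mem_iUnion.2 ⟨i, left_mem_segment _ _ _⟩)
    have xa : x ≠ a := hne 0
    have xb : x ≠ b := hne 1
    have xp : x ≠ p := hne 2
    have xq : x ≠ q := hne 3
    have xc : x ≠ c := hne 4
    refine escape xa ?_ hbd
    intro t ht hm
    obtain ⟨i, hi⟩ := mem_iUnion.1 hm
    have hpt : 0 < 1 + t := by linarith
    have onl : ∀ u, ori a u x ≠ 0 → x + t • (x - a) ∉ segment ℝ a u := by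
      intro u hu hmm
      obtain ⟨s, r, hs, hr, hsr, f1, f2⟩ := mem_seg hmm
      have g := seg_ori hsr f1 f2 a u
      rw [ori_self2, ori_self3] at g
      have : ori a u (x + t • (x - a)) = (1 + t) * ori a u x := by
        unfold ori; simp; ring
      rw [this] at g
      simp [hpt.ne', hu] at g
    revert i
    refine zmod5 _ ?_ ?_ ?_ ?_ ?_ <;> intro hi
    · rw [s0, v0, v1] at hi
      exact onl b (hS a ha b hb x hxS n01 xa.symm xb.symm) hi
    · exact e1 x hxS (ray_inT ht hi (hS a ha b hb x hxS n01 xa.symm xb.symm)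
        (hS b hb p hp x hxS n12 xb.symm xp.symm) (hS p hp a ha x hxS n02.symm xp.symm xa.symm))
    · exact e2 x hxS (ray_inT ht hi (hS a ha p hp x hxS n02 xa.symm xp.symm)
        (hS p hp q hq x hxS n23 xp.symm xq.symm) (hS q hq a ha x hxS n03.symm xq.symm xa.symm))
    · exact e3 x hxS (ray_inT ht hi (hS a ha q hq x hxS n03 xa.symm xq.symm)
        (hS q hq c hc x hxS n34 xq.symm xc.symm) (hS c hc a ha x hxS n04.symm xc.symm xa.symm))
    · rw [s4, v0, v4, segment_symm] at hi
      exact onl c (hS a ha c hc x hxS n04 xa.symm xc.symm) hi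

end

open Set
noncomputable section

/-- the points of `S` inside the triangle `abc` -/
def InsT (S : Set Pt) (a b c : Pt) : Set Pt := {x ∈ S | InT x a b c}

lemma exists_extreme {S : Set Pt} (hf : S.Finite) (hS : GP S) {a b c : Pt} 
    (hb : b ∈ S) (hp : 0 < ori a b c) (hne : (InsT S a b c).Nonempty) :
    ∃ x ∈ InsT S a b c, ∀ y ∈ InsT S a b c, y ≠ x → 0 < ori b y x := by
  obtain ⟨x, hx, hmax⟩ := Set.exists_max_image (InsT S a b c)
    (fun y => ori b c y / ori a b y) (hf.subset (sep_subset _ _)) hne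
  refine ⟨x, hx, fun y hy hyx => ?_⟩
  have h := hmax y hy
  obtain ⟨x1, x2, x3⟩ := hx.2.pos hp
  obtain ⟨y1, y2, y3⟩ := hy.2.pos hp
  rw [div_le_div_iff₀ y1 x1] at h
  have id1 : ori b c x * ori a b y - ori b c y * ori a b x = ori a b c * ori b y x := by
    unfold ori; ring
  have h0 : 0 ≤ ori b y x := by
    by_contra hcon
    push Not at hcon
    have := mul_neg_of_pos_of_neg hp hcon
    linarith
  have yb := (hy.2.ne_vertex hp.ne').2.1
  have xb := (hx.2.ne_vertex hp.ne').2.1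
  exact lt_of_le_of_ne h0 (hS b hb y hy.1 x hx.1 yb.symm xb.symm hyx).symm

lemma inT_trans1 {a b c x y : Pt} (hp : 0 < ori a b c) (hx : InT x a b c) (hy : InT y a b x) :
    InT y a b c := by
  obtain ⟨x1, x2, x3⟩ := hx.pos hp
  obtain ⟨y1, y2, y3⟩ := hy.pos x1
  obtain ⟨α, β, γ, h1, h2, h3, h4, h5⟩ := hy.ori_eq
  apply InT.of_pos y1
  · rw [h5, ori_self2, ori_rot a b c]
    have := mul_pos h1 hp
    have := mul_pos h3 x2
    linarith
  · rw [h5, ori_self3, ori_rot' a b c]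
    have := mul_pos h2 hp
    have := mul_pos h3 x3
    linarith

theorem ac_of_no_pt {S : Set Pt} (hf : S.Finite) (hS : GP S) (hno : ¬ HasEmptyPseudoTriangle 5 S) :
    AC S := by
  classical
  by_contra hac
  have hex : ∃ n, ∃ a ∈ S, ∃ b ∈ S, ∃ c ∈ S, 0 < ori a b c ∧ (InsT S a b c).ncard = n ∧ 2 ≤ n := by
    unfold AC at hac
    push Not at hac
    obtain ⟨a, ha, b, hb, c, hc, h0, u, hu, v, hv, hiu, hiv, huv⟩ := hac
    have two : ∀ a b c, InT u a b c → InT v a b c → 2 ≤ (InsT S a b c).ncard := by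
      intro a b c h1 h2
      rw [← Set.ncard_pair huv]
      refine Set.ncard_le_ncard ?_ (hf.subset (sep_subset _ _))
      rintro x (rfl | rfl)
      · exact ⟨hu, h1⟩
      · exact ⟨hv, h2⟩
    rcases lt_or_gt_of_ne h0 with h | h
    · exact ⟨_, b, hb, a, ha, c, hc, by rw [ori_swap]; linarith, rfl, two _ _ _ hiu.swap hiv.swap⟩
    · exact ⟨_, a, ha, b, hb, c, hc, h, rfl, two _ _ _ hiu hiv⟩
  obtain ⟨a, ha, b, hb, c, hc, hp, hcard, h2⟩ := Nat.find_spec hex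
  have hmin := fun m (hm : m < Nat.find hex) => Nat.find_min hex hm
  have hne : (InsT S a b c).Nonempty := by
    apply Set.nonempty_of_ncard_ne_zero; omega
  obtain ⟨x, hx, hext⟩ := exists_extreme hf hS hb hp hne
  obtain ⟨x1, x2, x3⟩ := hx.2.pos hp
  have hfinI : (InsT S a b c).Finite := hf.subset (sep_subset _ _)
  -- sub-triangles contain at most one point
  have small : ∀ d ∈ S, ∀ e ∈ S, ∀ g ∈ S, 0 < ori d e g → InsT S d e g ⊆ InsT S a b c \ {x} →
      ∀ u ∈ InsT S d e g, ∀ v ∈ InsT S d e g, u = v := by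
    intro d hd e he g hg ho hsub u hu v hv
    by_contra huv
    have hlt : (InsT S d e g).ncard < Nat.find hex := by
      have h3 := Set.ncard_le_ncard hsub (hfinI.subset sdiff_subset)
      rw [Set.ncard_sdiff_singleton_of_mem hx] at h3
      omega
    refine hmin _ hlt ⟨d, hd, e, he, g, hg, ho, rfl, ?_⟩
    rw [← Set.ncard_pair huv]
    refine Set.ncard_le_ncard ?_ (hf.subset (sep_subset _ _))
    rintro w (rfl | rfl)
    · exact hu
    · exact hv
  have xbc : 0 < ori x b c := by linarith [ori_rot x b c]
  have xca : 0 < ori x c a := by linarith [ori_rot x c a]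
  have hne_x : ∀ {u d e g : Pt}, 0 < ori d e g → InT u d e g → (x = d ∨ x = e ∨ x = g) → u ≠ x := by
    intro u d e g ho hu h e
    have := hu.ne_vertex ho.ne'
    rcases h with rfl | rfl | rfl
    · exact this.1 e
    · exact this.2.1 e
    · exact this.2.2 e
  have empty1 : ∀ u ∈ S, ¬ InT u a b x := by
    intro u hu hi
    have h3 := inT_trans1 hp hx.2 hi
    have h4 := hext u ⟨hu, h3⟩ (hne_x x1 hi (by simp))
    have h5 := (hi.pos x1).2.1
    rw [ori_swap'] at h4
    linarith
  have sub2 : InsT S x b c ⊆ InsT S a b c \ {x} := by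
    intro u hu
    refine ⟨⟨hu.1, ?_⟩, hne_x xbc hu.2 (by simp)⟩
    have : InT u b c a := inT_trans1 (by rw [ori_rot]; exact hp) hx.2.rot hu.2.rot
    exact this.rot.rot
  have sub3 : InsT S x c a ⊆ InsT S a b c \ {x} := by
    intro u hu
    refine ⟨⟨hu.1, ?_⟩, hne_x xca hu.2 (by simp)⟩
    have : InT u c a b := inT_trans1 (by rw [ori_rot']; exact hp) hx.2.rot.rot hu.2.rot
    exact this.rot
  have one2 := small x hx.1 b hb c hc xbc sub2
  have one3 := small x hx.1 c hc a ha xca sub3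
  -- a second point
  obtain ⟨y, hy, hyx⟩ : ∃ y ∈ InsT S a b c, y ≠ x :=
    Set.exists_ne_of_one_lt_ncard (by omega) x
  by_cases hz : ∃ z, z ∈ InsT S x c a
  · obtain ⟨z, hz⟩ := hz
    have hzz := sub3 hz
    obtain ⟨z1, z2, z3⟩ := hz.2.pos xca
    obtain ⟨w1, w2, w3⟩ := hzz.1.2.pos hp
    have hzb := hext z hzz.1 hzz.2
    refine hno (pt5 hS ha hb hx.1 hz.1 hc x1 z3 (by rw [ori_rot]; exact w3) ?_ ?_ hp w1 ?_
      empty1 ?_ ?_)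
    · rw [ori_swap']; linarith
    · rw [ori_swap']; linarith
    · linarith [ori_rot c a x]
    · intro u hu hi
      have h3 : InT u a x c := inT_trans1 (by linarith [ori_rot a x c]) hz.2.rot.rot.swap'.swap'.swap'.swap' hi
      have h4 := one3 u ⟨hu, h3.rot⟩ z hz
      exact (hi.ne_vertex z3.ne').2.2 h4
    · intro u hu hi
      have h3 : InT u c a x := inT_trans1 (by linarith [ori_rot a x c]) hz.2.rot hi.rot.rot
      have h4 := one3 u ⟨hu, h3.rot.rot⟩ z hz
      exact (hi.ne_vertex (by rw [ori_rot]; exact w3.ne')).2.1 h4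
  · have hyb := hext y hy hyx
    obtain ⟨y1, y2, y3⟩ := hy.2.pos hp
    have hyc : y ≠ c := (hy.2.ne_vertex hp.ne').2.2
    have hxc : x ≠ c := (hx.2.ne_vertex hp.ne').2.2
    have hya : y ≠ a := (hy.2.ne_vertex hp.ne').1
    have hxa : x ≠ a := (hx.2.ne_vertex hp.ne').1
    have hcxy : 0 < ori c x y := by
      rcases lt_or_gt_of_ne (hS c hc x hx.1 y hy.1 hxc.symm hyc.symm hyx.symm) with h | h
      · exfalso
        refine hz ⟨y, hy.1, InT.of_pos (by rw [ori_swap]; linarith) y3 ?_⟩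
        obtain ⟨α, β, γ, g1, g2, g3, g4, g5⟩ := hx.2.ori_eq
        have g6 := g5 x y
        rw [ori_self2] at g6
        have k1 : ori x y b < 0 := by linarith [ori_rot b x y, ori_swap' b y x]
        have k2 : ori x y c < 0 := by linarith [ori_rot c x y]
        have k3 := mul_neg_of_pos_of_neg g2 k1
        have k4 := mul_neg_of_pos_of_neg g3 k2
        rw [← ori_rot]
        by_contra hcon
        push Not at hcon
        have := mul_nonpos_of_nonneg_of_nonpos g1.le hcon
        linarith
      · exact h
    have hyI : y ∈ InsT S x b c :=
      ⟨hy.1, InT.of_pos (by linarith [ori_rot x b y]) y2 hcxy⟩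
    have bcx : 0 < ori b c x := x2
    have emp2 : ∀ u ∈ S, ¬ InT u b c y := by
      intro u hu hi
      have h3 : InT u b c x := inT_trans1 bcx hyI.2.rot hi
      exact (hi.ne_vertex y2.ne').2.2 (one2 u ⟨hu, h3.rot.rot⟩ y hyI)
    rcases lt_or_gt_of_ne (hS y hy.1 x hx.1 a ha hyx hya hxa) with h | h
    · refine hno (pt5 hS hb hc hy.1 hx.1 ha y2 hyb (by linarith [ori_rot b x a, ori_rot a b x]) ?_ h
        (by rw [ori_rot]; exact hp) bcx (by linarith [ori_rot a b y]) emp2 ?_ ?_)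
      · rw [ori_swap']; linarith
      · intro u hu hi
        have h3 : InT u x b c := inT_trans1 xbc hyI.2 hi.rot.rot
        exact (hi.ne_vertex hyb.ne').2.1 (one2 u ⟨hu, h3⟩ y hyI)
      · intro u hu hi
        exact empty1 u hu hi.rot.rot
    · refine hno (pt5 hS hc ha hx.1 hy.1 hb x3 hcxy (by linarith [ori_rot b c y, ori_rot c y b])
        ?_ ?_ (by rw [ori_rot']; exact hp) y3 (by linarith [ori_rot x b c, ori_rot b c x]) ?_ ?_ ?_)
      · linarith [ori_swap' y a x, ori_rot a x y, ori_rot y a x]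
      · linarith [ori_rot b x y, ori_swap' b x y]
      · intro u hu hi
        exact hz ⟨u, hu, hi.rot.rot⟩
      · intro u hu hi
        have h3 : InT u c x b := inT_trans1 (by linarith [ori_rot x b c, ori_rot b c x]) hyI.2.rot.rot hi
        exact (hi.ne_vertex hcxy.ne').2.2 (one2 u ⟨hu, h3.rot⟩ y hyI)
      · intro u hu hi
        exact emp2 u hu hi.rot.rot

end

open Set
noncomputable section

/-! ### Almost convex sets have no 5-pseudo-triangle -/

lemma bool_core : ∀ t012 t013 t014 t023 t024 t034 t123 t124 t134 t234 : Bool,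
    (((t012).toNat + (t123).toNat + (t234).toNat + (t034).toNat + (t014).toNat == 2) || ((t012).toNat + (t123).toNat + (t234).toNat + (t034).toNat + (t014).toNat == 3)) = true →
    (!(((t012 == t034) == (t013 != t024)) && ((t013 != t024) == (t014 == t023)))) = true →
    (!((((!t012) == t134) == ((!t013) != t124)) && (((!t013) != t124) == ((!t014) == t123)))) = true →
    (!(((t012 == t234) == ((!t023) != (!t124))) && (((!t023) != (!t124)) == ((!t024) == (!t123))))) = true →
    (!(((t013 == (!t234)) == (t023 != (!t134))) && ((t023 != (!t134)) == ((!t034) == t123)))) = true →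
    (!(((t014 == t234) == (t024 != t134)) && ((t024 != t134) == (t034 == t124)))) = true →
    (!((t012 != t013) && (t023 != t123))) = true →
    (!((t013 != t014) && (t034 != t134))) = true →
    (!((t123 != t124) && (t134 != t234))) = true →
    (!((t124 != t012) && (t014 != t024))) = true →
    (!((t234 != t023) && (t024 != t034))) = true →
    (((t013 == t123 && t123 == (!t023)) && (t014 == t124 && t124 == (!t024))) ||
      ((t012 == (!t123) && (!t123) == t023) && (t014 == t134 && t134 == (!t034))) ||
      ((t012 == (!t124) && (!t124) == t024) && (t013 == (!t134) && (!t134) == t034)) ||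
      (((!t012) == t123 && t123 == t013) && (t024 == t234 && t234 == (!t034))) ||
      (((!t012) == t124 && t124 == t014) && (t023 == (!t234) && (!t234) == t034)) ||
      (((!t013) == t134 && t134 == t014) && ((!t023) == t234 && t234 == t024)) ||
      ((t012 == t023 && t023 == (!t013)) && (t124 == t234 && t234 == (!t134))) ||
      ((t012 == t024 && t024 == (!t014)) && (t123 == (!t234) && (!t234) == t134)) ||
      ((t013 == t034 && t034 == (!t014)) && ((!t123) == t234 && t234 == t124)) ||
      ((t023 == t034 && t034 == (!t024)) && (t123 == t134 && t134 == (!t124)))) = true := by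
  decide +kernel

/-- the sign of the orientation -/
def sg (a b c : Pt) : Bool := decide (0 < ori a b c)

lemma sg_rot (a b c : Pt) : sg b c a = sg a b c := by unfold sg; rw [ori_rot]

lemma sg_swap {S : Set Pt} (hS : GP S) {a b c : Pt} (ha : a ∈ S) (hb : b ∈ S) (hc : c ∈ S)
    (hab : a ≠ b) (hac : a ≠ c) (hbc : b ≠ c) : sg b a c = !sg a b c := by
  have := hS a ha b hb c hc hab hac hbc
  unfold sg
  rw [ori_swap]
  rcases lt_or_gt_of_ne this with h | h
  · simp [h, h.le]
  · simp [h, h.le]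

lemma in_of_sg {S : Set Pt} (hS : GP S) {a b c x : Pt} (ha : a ∈ S) (hb : b ∈ S) (hc : c ∈ S)
    (hx : x ∈ S) (hab : a ≠ b) (hac : a ≠ c) (hbc : b ≠ c) (hxa : x ≠ a) (hxb : x ≠ b)
    (hxc : x ≠ c) (h1 : sg a b x = sg b c x) (h2 : sg b c x = sg c a x) : InT x a b c := by
  have e1 := hS a ha b hb x hx hab hxa.symm hxb.symm
  have e2 := hS b hb c hc x hx hbc hxb.symm hxc.symm
  have e3 := hS c hc a ha x hx hac.symm hxc.symm hxa.symm
  unfold sg at h1 h2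
  rw [decide_eq_decide] at h1 h2
  by_cases h : 0 < ori a b x
  · exact InT.of_pos h (h1.1 h) (h2.1 (h1.1 h))
  · have k1 : ori a b x < 0 := lt_of_le_of_ne (not_lt.1 h) e1
    have k2 : ori b c x < 0 := lt_of_le_of_ne (not_lt.1 fun h' => h (h1.2 h')) e2
    have k3 : ori c a x < 0 := lt_of_le_of_ne (not_lt.1 fun h' => h (h1.2 (h2.2 h'))) e3
    have : InT x b a c := InT.of_pos (by rw [ori_swap]; linarith) (by rw [ori_swap]; linarith)
      (by rw [ori_swap]; linarith)
    exact this.swap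

lemma sg_plu {S : Set Pt} (hS : GP S) {a b c d e : Pt} (ha : a ∈ S) (hb : b ∈ S) (hc : c ∈ S)
    (hd : d ∈ S) (he : e ∈ S) (hab : a ≠ b) (hac : a ≠ c) (had : a ≠ d) (hae : a ≠ e)
    (hbc : b ≠ c) (hbd : b ≠ d) (hbe : b ≠ e) (hcd : c ≠ d) (hce : c ≠ e) (hde : d ≠ e) :
    (!(((sg a b c == sg a d e) == (sg a b d != sg a c e)) &&
      ((sg a b d != sg a c e) == (sg a b e == sg a c d)))) = true := by
  have id1 : ori a b c * ori a d e - ori a b d * ori a c e + ori a b e * ori a c d = 0 := by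
    unfold ori; ring
  have k1 := hS a ha b hb c hc hab hac hbc
  have k2 := hS a ha d hd e he had hae hde
  have k3 := hS a ha b hb d hd hab had hbd
  have k4 := hS a ha c hc e he hac hae hce
  have k5 := hS a ha b hb e he hab hae hbe
  have k6 := hS a ha c hc d hd hac had hcd
  have key : ∀ x y : ℝ, x ≠ 0 → y ≠ 0 → (decide (0 < x) == decide (0 < y)) = decide (0 < x * y) := by
    intro x y hx hy
    rcases lt_or_gt_of_ne hx with h1 | h1 <;> rcases lt_or_gt_of_ne hy with h2 | h2
    · simp [not_lt.2 h1.le, not_lt.2 h2.le, mul_pos_of_neg_of_neg h1 h2]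
    · simp [h1.le, h2, (mul_neg_of_neg_of_pos h1 h2).le]
    · simp [h1, h2.le, (mul_neg_of_pos_of_neg h1 h2).le]
    · simp [h1, h2, mul_pos h1 h2]
  have key2 : ∀ x y : ℝ, x ≠ 0 → y ≠ 0 → (decide (0 < x) != decide (0 < y)) = !decide (0 < x * y) := by
    intro x y hx hy
    rw [← key x y hx hy]; rfl
  unfold sg
  rw [key _ _ k1 k2, key2 _ _ k3 k4, key _ _ k5 k6]
  have n1 := mul_ne_zero k1 k2
  have n2 := mul_ne_zero k3 k4
  have n3 := mul_ne_zero k5 k6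
  generalize ori a b c * ori a d e = X at *
  generalize ori a b d * ori a c e = Y at *
  generalize ori a b e * ori a c d = Z at *
  by_cases h1 : 0 < X <;> by_cases h2 : 0 < Y <;> by_cases h3 : 0 < Z <;> simp [h1, h2, h3]
  · linarith
  · have := lt_of_le_of_ne (not_lt.1 h1) n1
    have := lt_of_le_of_ne (not_lt.1 h3) n3
    linarith

lemma sg_cross {S : Set Pt} (hS : GP S) {a b c d : Pt} (ha : a ∈ S) (hb : b ∈ S) (hc : c ∈ S)
    (hd : d ∈ S) (hab : a ≠ b) (hac : a ≠ c) (had : a ≠ d) (hbc : b ≠ c) (hbd : b ≠ d)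
    (hcd : c ≠ d) (hdis : segment ℝ a b ∩ segment ℝ c d = ∅) :
    (!((sg a b c != sg a b d) && (sg c d a != sg c d b))) = true := by
  have k1 := hS a ha b hb c hc hab hac hbc
  have k2 := hS a ha b hb d hd hab had hbd
  have k3 := hS c hc d hd a ha hcd hac.symm had.symm
  have k4 := hS c hc d hd b hb hcd hbc.symm hbd.symm
  by_contra hcon
  simp only [sg, Bool.not_eq_true, Bool.not_eq_false', Bool.and_eq_true, bne_iff_ne, ne_eq,
    decide_eq_decide] at hcon
  obtain ⟨h1, h2⟩ := hcon
  have par : ∀ x y : ℝ, x ≠ 0 → y ≠ 0 → ¬ (0 < x ↔ 0 < y) → 0 < x / (x - y) ∧ 0 < - y / (x - y)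
      ∧ x - y ≠ 0 := by
    intro x y hx hy hn
    rcases lt_or_gt_of_ne hx with h1 | h1 <;> rcases lt_or_gt_of_ne hy with h2 | h2
    · exact (hn ⟨fun h => (lt_asymm h h1).elim, fun h => (lt_asymm h h2).elim⟩).elim
    · exact ⟨div_pos_of_neg_of_neg h1 (by linarith), div_pos_of_neg_of_neg (by linarith) (by linarith),
        by linarith⟩
    · exact ⟨div_pos h1 (by linarith), div_pos (by linarith) (by linarith), by linarith⟩
    · exact (hn ⟨fun _ => h2, fun _ => h1⟩).elim
  obtain ⟨p1, p2, p3⟩ := par _ _ k1 k2 h1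
  obtain ⟨q1, q2, q3⟩ := par _ _ k3 k4 h2
  -- intersection point
  have hmem : (- ori a b d / (ori a b c - ori a b d)) • c + (ori a b c / (ori a b c - ori a b d)) • d
      ∈ segment ℝ a b ∩ segment ℝ c d := by
    refine ⟨⟨- ori c d b / (ori c d a - ori c d b), ori c d a / (ori c d a - ori c d b), q2.le, q1.le,
      ?_, ?_⟩, ⟨_, _, p2.le, p1.le, ?_, rfl⟩⟩
    · field_simp; ring
    · have e : ori a b c - ori a b d = - (ori c d a - ori c d b) := by unfold ori; ring
      have f1 : -ori c d b * a.1 + ori c d a * b.1 = ori a b d * c.1 - ori a b c * d.1 := by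
        unfold ori; ring
      have f2 : -ori c d b * a.2 + ori c d a * b.2 = ori a b d * c.2 - ori a b c * d.2 := by
        unfold ori; ring
      rw [e]
      generalize ori c d a - ori c d b = D at *
      ext
      · simp only [Prod.fst_add, Prod.smul_fst, smul_eq_mul]; field_simp; linear_combination f1
      · simp only [Prod.snd_add, Prod.smul_snd, smul_eq_mul]; field_simp; linear_combination f2
    · field_simp; ring
  rw [hdis] at hmem
  exact hmem

theorem no_pt_of_ac {S : Set Pt} (hS : GP S) (hac : AC S) : ¬ HasEmptyPseudoTriangle 5 S := by
  rintro ⟨v, hv, ⟨hsim, hnz, hcard⟩, -⟩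
  have hm : ∀ i, v i ∈ S := fun i => hv ⟨i, rfl⟩
  have ne : ∀ i j, i ≠ j → v i ≠ v j := fun i j h e => h (hsim.inj e)
  have n01 : v 0 ≠ v 1 := ne _ _ (by decide)
  have n02 : v 0 ≠ v 2 := ne _ _ (by decide)
  have n03 : v 0 ≠ v 3 := ne _ _ (by decide)
  have n04 : v 0 ≠ v 4 := ne _ _ (by decide)
  have n12 : v 1 ≠ v 2 := ne _ _ (by decide)
  have n13 : v 1 ≠ v 3 := ne _ _ (by decide)
  have n14 : v 1 ≠ v 4 := ne _ _ (by decide)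
  have n23 : v 2 ≠ v 3 := ne _ _ (by decide)
  have n24 : v 2 ≠ v 4 := ne _ _ (by decide)
  have n34 : v 3 ≠ v 4 := ne _ _ (by decide)
  have hcnt : (((sg (v 0) (v 1) (v 2)).toNat + (sg (v 1) (v 2) (v 3)).toNat + (sg (v 2) (v 3) (v 4)).toNat +
      (sg (v 0) (v 3) (v 4)).toNat + (sg (v 0) (v 1) (v 4)).toNat == 2) ||
      ((sg (v 0) (v 1) (v 2)).toNat + (sg (v 1) (v 2) (v 3)).toNat + (sg (v 2) (v 3) (v 4)).toNat +
      (sg (v 0) (v 3) (v 4)).toNat + (sg (v 0) (v 1) (v 4)).toNat == 3)) = true := by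
    classical
    have hsum0 : (∑ i : ZMod 5, if IsConvexVtx 5 v i then 1 else 0) = 3 := by
      rw [← hcard, Set.ncard_eq_toFinset_card', ← Finset.card_filter]
      congr 1
      ext i; simp
    have hsum : (if IsConvexVtx 5 v 0 then 1 else 0) + (if IsConvexVtx 5 v 1 then 1 else 0) +
        (if IsConvexVtx 5 v 2 then 1 else 0) + (if IsConvexVtx 5 v 3 then 1 else 0) +
        (if IsConvexVtx 5 v 4 then 1 else 0) = 3 := by
      have hfive : ∀ g : ZMod 5 → ℕ, ∑ i, g i = g 0 + g 1 + g 2 + g 3 + g 4 :=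
        fun g => Fin.sum_univ_five (M := ℕ) g
      rw [hfive] at hsum0
      exact hsum0
    have c0 : vtxCross 5 v 0 = ori (v 0) (v 1) (v 4) := by
      rw [vtx_ori]; exact ori_rot' _ _ _
    have c1 : vtxCross 5 v 1 = ori (v 0) (v 1) (v 2) := by rw [vtx_ori]; rfl
    have c2 : vtxCross 5 v 2 = ori (v 1) (v 2) (v 3) := by rw [vtx_ori]; rfl
    have c3 : vtxCross 5 v 3 = ori (v 2) (v 3) (v 4) := by rw [vtx_ori]; rfl
    have c4 : vtxCross 5 v 4 = ori (v 0) (v 3) (v 4) := by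
      rw [vtx_ori]; exact ori_rot _ _ _
    have hA : signedArea 5 v ≠ 0 := by
      intro h0
      simp [IsConvexVtx, h0] at hsum
    unfold sg
    rw [← c0, ← c1, ← c2, ← c3, ← c4]
    rcases lt_or_gt_of_ne hA with h | h
    · have hc : ∀ i : ZMod 5, (decide (0 < vtxCross 5 v i)).toNat = 1 - (if IsConvexVtx 5 v i then 1 else 0) := by
        intro i
        unfold IsConvexVtx
        rcases lt_or_gt_of_ne (hnz i) with h1 | h1
        · rw [if_pos (mul_pos_of_neg_of_neg h1 h), decide_eq_false (not_lt.2 h1.le)]; rfl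
        · rw [if_neg (not_lt.2 (mul_neg_of_pos_of_neg h1 h).le), decide_eq_true h1]; rfl
      rw [hc, hc, hc, hc, hc]
      simp only [Bool.or_eq_true, beq_iff_eq]
      left
      split_ifs at hsum ⊢ <;> omega
    · have hc : ∀ i : ZMod 5, (decide (0 < vtxCross 5 v i)).toNat = (if IsConvexVtx 5 v i then 1 else 0) := by
        intro i
        unfold IsConvexVtx
        rcases lt_or_gt_of_ne (hnz i) with h1 | h1
        · rw [if_neg (not_lt.2 (mul_neg_of_neg_of_pos h1 h).le), decide_eq_false (not_lt.2 h1.le)]; rfl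
        · rw [if_pos (mul_pos h1 h), decide_eq_true h1]; rfl
      rw [hc, hc, hc, hc, hc]
      simp only [Bool.or_eq_true, beq_iff_eq]
      right
      split_ifs at hsum ⊢ <;> omega
  have r120 : sg (v 1) (v 2) (v 0) = sg (v 0) (v 1) (v 2) := sg_rot _ _ _
  have r201 : sg (v 2) (v 0) (v 1) = sg (v 0) (v 1) (v 2) := by rw [sg_rot (v 1) (v 2) (v 0), sg_rot]
  have r102 : sg (v 1) (v 0) (v 2) = !sg (v 0) (v 1) (v 2) := sg_swap hS (hm _) (hm _) (hm _) n01 n02 n12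
  have r021 : sg (v 0) (v 2) (v 1) = !sg (v 0) (v 1) (v 2) := by rw [← r102, sg_rot (v 1) (v 0) (v 2)]
  have r210 : sg (v 2) (v 1) (v 0) = !sg (v 0) (v 1) (v 2) := by rw [← r102, sg_rot (v 2) (v 1) (v 0)]
  have r130 : sg (v 1) (v 3) (v 0) = sg (v 0) (v 1) (v 3) := sg_rot _ _ _
  have r301 : sg (v 3) (v 0) (v 1) = sg (v 0) (v 1) (v 3) := by rw [sg_rot (v 1) (v 3) (v 0), sg_rot]
  have r103 : sg (v 1) (v 0) (v 3) = !sg (v 0) (v 1) (v 3) := sg_swap hS (hm _) (hm _) (hm _) n01 n03 n13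
  have r031 : sg (v 0) (v 3) (v 1) = !sg (v 0) (v 1) (v 3) := by rw [← r103, sg_rot (v 1) (v 0) (v 3)]
  have r310 : sg (v 3) (v 1) (v 0) = !sg (v 0) (v 1) (v 3) := by rw [← r103, sg_rot (v 3) (v 1) (v 0)]
  have r140 : sg (v 1) (v 4) (v 0) = sg (v 0) (v 1) (v 4) := sg_rot _ _ _
  have r401 : sg (v 4) (v 0) (v 1) = sg (v 0) (v 1) (v 4) := by rw [sg_rot (v 1) (v 4) (v 0), sg_rot]
  have r104 : sg (v 1) (v 0) (v 4) = !sg (v 0) (v 1) (v 4) := sg_swap hS (hm _) (hm _) (hm _) n01 n04 n14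
  have r041 : sg (v 0) (v 4) (v 1) = !sg (v 0) (v 1) (v 4) := by rw [← r104, sg_rot (v 1) (v 0) (v 4)]
  have r410 : sg (v 4) (v 1) (v 0) = !sg (v 0) (v 1) (v 4) := by rw [← r104, sg_rot (v 4) (v 1) (v 0)]
  have r230 : sg (v 2) (v 3) (v 0) = sg (v 0) (v 2) (v 3) := sg_rot _ _ _
  have r302 : sg (v 3) (v 0) (v 2) = sg (v 0) (v 2) (v 3) := by rw [sg_rot (v 2) (v 3) (v 0), sg_rot]
  have r203 : sg (v 2) (v 0) (v 3) = !sg (v 0) (v 2) (v 3) := sg_swap hS (hm _) (hm _) (hm _) n02 n03 n23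
  have r032 : sg (v 0) (v 3) (v 2) = !sg (v 0) (v 2) (v 3) := by rw [← r203, sg_rot (v 2) (v 0) (v 3)]
  have r320 : sg (v 3) (v 2) (v 0) = !sg (v 0) (v 2) (v 3) := by rw [← r203, sg_rot (v 3) (v 2) (v 0)]
  have r240 : sg (v 2) (v 4) (v 0) = sg (v 0) (v 2) (v 4) := sg_rot _ _ _
  have r402 : sg (v 4) (v 0) (v 2) = sg (v 0) (v 2) (v 4) := by rw [sg_rot (v 2) (v 4) (v 0), sg_rot]
  have r204 : sg (v 2) (v 0) (v 4) = !sg (v 0) (v 2) (v 4) := sg_swap hS (hm _) (hm _) (hm _) n02 n04 n24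
  have r042 : sg (v 0) (v 4) (v 2) = !sg (v 0) (v 2) (v 4) := by rw [← r204, sg_rot (v 2) (v 0) (v 4)]
  have r420 : sg (v 4) (v 2) (v 0) = !sg (v 0) (v 2) (v 4) := by rw [← r204, sg_rot (v 4) (v 2) (v 0)]
  have r340 : sg (v 3) (v 4) (v 0) = sg (v 0) (v 3) (v 4) := sg_rot _ _ _
  have r403 : sg (v 4) (v 0) (v 3) = sg (v 0) (v 3) (v 4) := by rw [sg_rot (v 3) (v 4) (v 0), sg_rot]
  have r304 : sg (v 3) (v 0) (v 4) = !sg (v 0) (v 3) (v 4) := sg_swap hS (hm _) (hm _) (hm _) n03 n04 n34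
  have r043 : sg (v 0) (v 4) (v 3) = !sg (v 0) (v 3) (v 4) := by rw [← r304, sg_rot (v 3) (v 0) (v 4)]
  have r430 : sg (v 4) (v 3) (v 0) = !sg (v 0) (v 3) (v 4) := by rw [← r304, sg_rot (v 4) (v 3) (v 0)]
  have r231 : sg (v 2) (v 3) (v 1) = sg (v 1) (v 2) (v 3) := sg_rot _ _ _
  have r312 : sg (v 3) (v 1) (v 2) = sg (v 1) (v 2) (v 3) := by rw [sg_rot (v 2) (v 3) (v 1), sg_rot]
  have r213 : sg (v 2) (v 1) (v 3) = !sg (v 1) (v 2) (v 3) := sg_swap hS (hm _) (hm _) (hm _) n12 n13 n23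
  have r132 : sg (v 1) (v 3) (v 2) = !sg (v 1) (v 2) (v 3) := by rw [← r213, sg_rot (v 2) (v 1) (v 3)]
  have r321 : sg (v 3) (v 2) (v 1) = !sg (v 1) (v 2) (v 3) := by rw [← r213, sg_rot (v 3) (v 2) (v 1)]
  have r241 : sg (v 2) (v 4) (v 1) = sg (v 1) (v 2) (v 4) := sg_rot _ _ _
  have r412 : sg (v 4) (v 1) (v 2) = sg (v 1) (v 2) (v 4) := by rw [sg_rot (v 2) (v 4) (v 1), sg_rot]
  have r214 : sg (v 2) (v 1) (v 4) = !sg (v 1) (v 2) (v 4) := sg_swap hS (hm _) (hm _) (hm _) n12 n14 n24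
  have r142 : sg (v 1) (v 4) (v 2) = !sg (v 1) (v 2) (v 4) := by rw [← r214, sg_rot (v 2) (v 1) (v 4)]
  have r421 : sg (v 4) (v 2) (v 1) = !sg (v 1) (v 2) (v 4) := by rw [← r214, sg_rot (v 4) (v 2) (v 1)]
  have r341 : sg (v 3) (v 4) (v 1) = sg (v 1) (v 3) (v 4) := sg_rot _ _ _
  have r413 : sg (v 4) (v 1) (v 3) = sg (v 1) (v 3) (v 4) := by rw [sg_rot (v 3) (v 4) (v 1), sg_rot]
  have r314 : sg (v 3) (v 1) (v 4) = !sg (v 1) (v 3) (v 4) := sg_swap hS (hm _) (hm _) (hm _) n13 n14 n34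
  have r143 : sg (v 1) (v 4) (v 3) = !sg (v 1) (v 3) (v 4) := by rw [← r314, sg_rot (v 3) (v 1) (v 4)]
  have r431 : sg (v 4) (v 3) (v 1) = !sg (v 1) (v 3) (v 4) := by rw [← r314, sg_rot (v 4) (v 3) (v 1)]
  have r342 : sg (v 3) (v 4) (v 2) = sg (v 2) (v 3) (v 4) := sg_rot _ _ _
  have r423 : sg (v 4) (v 2) (v 3) = sg (v 2) (v 3) (v 4) := by rw [sg_rot (v 3) (v 4) (v 2), sg_rot]
  have r324 : sg (v 3) (v 2) (v 4) = !sg (v 2) (v 3) (v 4) := sg_swap hS (hm _) (hm _) (hm _) n23 n24 n34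
  have r243 : sg (v 2) (v 4) (v 3) = !sg (v 2) (v 3) (v 4) := by rw [← r324, sg_rot (v 3) (v 2) (v 4)]
  have r432 : sg (v 4) (v 3) (v 2) = !sg (v 2) (v 3) (v 4) := by rw [← r324, sg_rot (v 4) (v 3) (v 2)]
  have p0 := sg_plu hS (hm 0) (hm 1) (hm 2) (hm 3) (hm 4) n01 n02 n03 n04 n12 n13 n14 n23 n24 n34
  have p1 := sg_plu hS (hm 1) (hm 0) (hm 2) (hm 3) (hm 4) n01.symm n12 n13 n14 n02 n03 n04 n23 n24 n34
  rw [r102, r103, r104] at p1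
  have p2 := sg_plu hS (hm 2) (hm 0) (hm 1) (hm 3) (hm 4) n02.symm n12.symm n23 n24 n01 n03 n04 n13 n14 n34
  rw [r201, r203, r214, r204, r213] at p2
  have p3 := sg_plu hS (hm 3) (hm 0) (hm 1) (hm 2) (hm 4) n03.symm n13.symm n23.symm n34 n01 n02 n04 n12 n14 n24
  rw [r301, r324, r302, r314, r304, r312] at p3
  have p4 := sg_plu hS (hm 4) (hm 0) (hm 1) (hm 2) (hm 3) n04.symm n14.symm n24.symm n34.symm n01 n02 n03 n12 n13 n23
  rw [r401, r423, r402, r413, r403, r412] at p4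
  have q0 := sg_cross hS (hm 0) (hm 1) (hm 2) (hm 3) n01 n02 n03 n12 n13 n23
    (hsim.nonadj 0 2 (by decide) (by decide) (by decide))
  rw [r230, r231] at q0
  have q1 := sg_cross hS (hm 0) (hm 1) (hm 3) (hm 4) n01 n03 n04 n13 n14 n34
    (hsim.nonadj 0 3 (by decide) (by decide) (by decide))
  rw [r340, r341] at q1
  have q2 := sg_cross hS (hm 1) (hm 2) (hm 3) (hm 4) n12 n13 n14 n23 n24 n34
    (hsim.nonadj 1 3 (by decide) (by decide) (by decide))
  rw [r341, r342] at q2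
  have q3 := sg_cross hS (hm 1) (hm 2) (hm 4) (hm 0) n12 n14 n01.symm n24 n02.symm n04.symm
    (hsim.nonadj 1 4 (by decide) (by decide) (by decide))
  rw [r120, r401, r402] at q3
  have q4 := sg_cross hS (hm 2) (hm 3) (hm 4) (hm 0) n23 n24 n02.symm n34 n03.symm n04.symm
    (hsim.nonadj 2 4 (by decide) (by decide) (by decide))
  rw [r230, r402, r403] at q4
  have key := bool_core _ _ _ _ _ _ _ _ _ _ hcnt p0 p1 p2 p3 p4 q0 q1 q2 q3 q4
  simp only [Bool.or_eq_true, Bool.and_eq_true, beq_iff_eq] at key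
  have fin : ∀ a b c u w : ZMod 5, a ≠ b → a ≠ c → b ≠ c → u ≠ a → u ≠ b → u ≠ c → w ≠ a → w ≠ b →
      w ≠ c → u ≠ w → sg (v a) (v b) (v u) = sg (v b) (v c) (v u) →
      sg (v b) (v c) (v u) = sg (v c) (v a) (v u) → sg (v a) (v b) (v w) = sg (v b) (v c) (v w) →
      sg (v b) (v c) (v w) = sg (v c) (v a) (v w) → False := by
    intro a b c u w h1 h2 h3 h4 h5 h6 h7 h8 h9 h10 e1 e2 e3 e4
    have i1 := in_of_sg hS (hm a) (hm b) (hm c) (hm u) (ne _ _ h1) (ne _ _ h2) (ne _ _ h3)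
      (ne _ _ h4) (ne _ _ h5) (ne _ _ h6) e1 e2
    have i2 := in_of_sg hS (hm a) (hm b) (hm c) (hm w) (ne _ _ h1) (ne _ _ h2) (ne _ _ h3)
      (ne _ _ h7) (ne _ _ h8) (ne _ _ h9) e3 e4
    exact ne _ _ h10 (hac _ (hm a) _ (hm b) _ (hm c)
      (hS _ (hm a) _ (hm b) _ (hm c) (ne _ _ h1) (ne _ _ h2) (ne _ _ h3)) _ (hm u) _ (hm w) i1 i2)
  rcases key with (((((((((k | k) | k) | k) | k) | k) | k) | k) | k) | k)
  · refine fin 0 1 2 3 4 (by decide) (by decide) (by decide) (by decide) (by decide)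
      (by decide) (by decide) (by decide) (by decide) (by decide) ?_ ?_ ?_ ?_
    · exact k.1.1
    · rw [r203]; exact k.1.2
    · exact k.2.1
    · rw [r204]; exact k.2.2
  · refine fin 0 1 3 2 4 (by decide) (by decide) (by decide) (by decide) (by decide)
      (by decide) (by decide) (by decide) (by decide) (by decide) ?_ ?_ ?_ ?_
    · rw [r132]; exact k.1.1
    · rw [r132, r302]; exact k.1.2
    · exact k.2.1
    · rw [r304]; exact k.2.2
  · refine fin 0 1 4 2 3 (by decide) (by decide) (by decide) (by decide) (by decide)
      (by decide) (by decide) (by decide) (by decide) (by decide) ?_ ?_ ?_ ?_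
    · rw [r142]; exact k.1.1
    · rw [r142, r402]; exact k.1.2
    · rw [r143]; exact k.2.1
    · rw [r143, r403]; exact k.2.2
  · refine fin 0 2 3 1 4 (by decide) (by decide) (by decide) (by decide) (by decide)
      (by decide) (by decide) (by decide) (by decide) (by decide) ?_ ?_ ?_ ?_
    · rw [r021, r231]; exact k.1.1
    · rw [r231, r301]; exact k.1.2
    · exact k.2.1
    · rw [r304]; exact k.2.2
  · refine fin 0 2 4 1 3 (by decide) (by decide) (by decide) (by decide) (by decide)
      (by decide) (by decide) (by decide) (by decide) (by decide) ?_ ?_ ?_ ?_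
    · rw [r021, r241]; exact k.1.1
    · rw [r241, r401]; exact k.1.2
    · rw [r243]; exact k.2.1
    · rw [r243, r403]; exact k.2.2
  · refine fin 0 3 4 1 2 (by decide) (by decide) (by decide) (by decide) (by decide)
      (by decide) (by decide) (by decide) (by decide) (by decide) ?_ ?_ ?_ ?_
    · rw [r031, r341]; exact k.1.1
    · rw [r341, r401]; exact k.1.2
    · rw [r032, r342]; exact k.2.1
    · rw [r342, r402]; exact k.2.2
  · refine fin 1 2 3 0 4 (by decide) (by decide) (by decide) (by decide) (by decide)
      (by decide) (by decide) (by decide) (by decide) (by decide) ?_ ?_ ?_ ?_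
    · rw [r120, r230]; exact k.1.1
    · rw [r230, r310]; exact k.1.2
    · exact k.2.1
    · rw [r314]; exact k.2.2
  · refine fin 1 2 4 0 3 (by decide) (by decide) (by decide) (by decide) (by decide)
      (by decide) (by decide) (by decide) (by decide) (by decide) ?_ ?_ ?_ ?_
    · rw [r120, r240]; exact k.1.1
    · rw [r240, r410]; exact k.1.2
    · rw [r243]; exact k.2.1
    · rw [r243, r413]; exact k.2.2
  · refine fin 1 3 4 0 2 (by decide) (by decide) (by decide) (by decide) (by decide)
      (by decide) (by decide) (by decide) (by decide) (by decide) ?_ ?_ ?_ ?_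
    · rw [r130, r340]; exact k.1.1
    · rw [r340, r410]; exact k.1.2
    · rw [r132, r342]; exact k.2.1
    · rw [r342, r412]; exact k.2.2
  · refine fin 2 3 4 0 1 (by decide) (by decide) (by decide) (by decide) (by decide)
      (by decide) (by decide) (by decide) (by decide) (by decide) ?_ ?_ ?_ ?_
    · rw [r230, r340]; exact k.1.1
    · rw [r340, r420]; exact k.1.2
    · rw [r231, r341]; exact k.2.1
    · rw [r341, r421]; exact k.2.2

end

open Set
noncomputable section

/-! ### The lower bound construction -/

/-- The perturbed point with label `x = (p, s)`. -/
def pert (N : Pt → Pt) (e : ℝ) (x : Pt × ℝ) : Pt :=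
  (x.1.1 - x.2 * e * (N x.1).2 - x.2 ^ 2 * e ^ 2 * (N x.1).1,
   x.1.2 + x.2 * e * (N x.1).1 - x.2 ^ 2 * e ^ 2 * (N x.1).2)

/-- The set of labels. -/
def Lab (S H : Set Pt) : Set (Pt × ℝ) := S ×ˢ {0} ∪ H ×ˢ {1, -1}

lemma pert_zero (N : Pt → Pt) (e : ℝ) (p : Pt) : pert N e (p, 0) = p := by
  unfold pert; simp

lemma Lab.cases {S H : Set Pt} {x : Pt × ℝ} (h : x ∈ Lab S H) :
    (x.1 ∈ S ∧ x.2 = 0) ∨ (x.1 ∈ H ∧ x.2 = 1) ∨ (x.1 ∈ H ∧ x.2 = -1) := by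
  unfold Lab at h
  simp only [mem_union, mem_prod, mem_singleton_iff, mem_insert_iff] at h
  tauto

lemma Lab.fst {S H : Set Pt} (hHS : H ⊆ S) {x : Pt × ℝ} (h : x ∈ Lab S H) : x.1 ∈ S := by
  rcases Lab.cases h with h | h | h
  · exact h.1
  · exact hHS h.1
  · exact hHS h.1

/-- The required smallness of the perturbation. -/
structure Good (S H : Set Pt) (f : Pt × ℝ → Pt) : Prop where
  inj : InjOn f (Lab S H)
  zero : ∀ p, f (p, 0) = p
  far : ∀ x ∈ Lab S H, ∀ y ∈ Lab S H, ∀ z ∈ Lab S H, x.1 ≠ y.1 → x.1 ≠ z.1 → y.1 ≠ z.1 →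
    0 < ori (f x) (f y) (f z) * ori x.1 y.1 z.1
  two : ∀ x ∈ Lab S H, ∀ y ∈ Lab S H, ∀ z ∈ Lab S H, x.1 = y.1 → x.2 ≠ y.2 → z.1 ≠ x.1 →
    0 < ori (f x) (f y) (f z) * (x.2 - y.2)
  three : ∀ x ∈ Lab S H, ∀ y ∈ Lab S H, ∀ z ∈ Lab S H, x.1 = y.1 → x.1 = z.1 →
    x.2 ≠ y.2 → x.2 ≠ z.2 → y.2 ≠ z.2 →
    0 < ori (f x) (f y) (f z) * ((y.2 - x.2) * (z.2 - x.2) * (z.2 - y.2))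

lemma ev_pos {g : ℝ → ℝ} (hg : Continuous g) (h0 : 0 < g 0) :
    ∀ᶠ e in nhdsWithin (0 : ℝ) (Ioi 0), 0 < g e :=
  (hg.continuousAt.eventually (lt_mem_nhds h0)).filter_mono nhdsWithin_le_nhds

lemma Lab.finite {S H : Set Pt} (hf : S.Finite) (hHS : H ⊆ S) : (Lab S H).Finite :=
  (hf.prod (finite_singleton _)).union ((hf.subset hHS).prod (by simp))

lemma exists_good {S H : Set Pt} (hf : S.Finite) (hHS : H ⊆ S) (hg : GP S)
    (h2 : 2 ≤ S.ncard) (he : ∀ p ∈ H, p ∉ convexHull ℝ (S \ {p})) :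
    ∃ f, Good S H f := by
  have hN : ∀ p, ∃ n : Pt, p ∈ H → ∀ y ∈ S \ {p}, 0 < fl n.1 n.2 p y := by
    intro p
    by_cases hp : p ∈ H
    · obtain ⟨A, B, h⟩ := exists_fl (hf.subset diff_subset) (he p hp)
      exact ⟨(A, B), fun _ => h⟩
    · exact ⟨0, fun h => absurd h hp⟩
  choose N hN using hN
  have hN0 : ∀ p ∈ H, 0 < (N p).1 ^ 2 + (N p).2 ^ 2 := by
    intro p hp
    obtain ⟨y, hy, hyp⟩ := Set.exists_ne_of_one_lt_ncard (by omega : 1 < S.ncard) p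
    have h := hN p hp y ⟨hy, hyp⟩
    unfold fl at h
    by_contra hcon
    have h1 : (N p).1 = 0 := by nlinarith [sq_nonneg (N p).1, sq_nonneg (N p).2]
    have h2 : (N p).2 = 0 := by nlinarith [sq_nonneg (N p).1, sq_nonneg (N p).2]
    rw [h1, h2] at h; simp at h
  have hL := Lab.finite hf hHS
  have hcont : ∀ x, Continuous fun e => (pert N e x).1 := by
    intro x; unfold pert; fun_prop
  have hcont2 : ∀ x, Continuous fun e => (pert N e x).2 := by
    intro x; unfold pert; fun_prop
  have hp0 : ∀ x, pert N 0 x = x.1 := by intro x; unfold pert; simp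
  have inH : ∀ x ∈ Lab S H, ∀ y ∈ Lab S H, x.1 = y.1 → x.2 ≠ y.2 → x.1 ∈ H := by
    intro x hx y hy h1 h2
    rcases Lab.cases hx with h | h | h
    · rcases Lab.cases hy with h' | h' | h'
      · exact absurd (h.2.trans h'.2.symm) h2
      · exact h1 ▸ h'.1
      · exact h1 ▸ h'.1
    · exact h.1
    · exact h.1
  have e0 : ∀ᶠ e in nhdsWithin (0 : ℝ) (Ioi 0), ∀ x ∈ Lab S H, ∀ y ∈ Lab S H,
      x.1 ≠ y.1 → pert N e x ≠ pert N e y := by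
    refine (Filter.eventually_all_finite hL).2 fun x hx => (Filter.eventually_all_finite hL).2 fun y hy => ?_
    by_cases hxy : x.1 = y.1
    · exact Filter.Eventually.of_forall fun _ h => absurd hxy h
    have := ev_pos (g := fun e => ((pert N e x).1 - (pert N e y).1) ^ 2 +
      ((pert N e x).2 - (pert N e y).2) ^ 2)
      ((((hcont x).sub (hcont y)).pow 2).add (((hcont2 x).sub (hcont2 y)).pow 2)) (by
        simp only [hp0]
        by_contra hcon
        apply hxy
        ext
        · nlinarith [sq_nonneg (x.1.1 - y.1.1), sq_nonneg (x.1.2 - y.1.2)]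
        · nlinarith [sq_nonneg (x.1.1 - y.1.1), sq_nonneg (x.1.2 - y.1.2)])
    filter_upwards [this] with e h _ heq
    rw [heq] at h; simp at h
  have e1 : ∀ᶠ e in nhdsWithin (0 : ℝ) (Ioi 0), ∀ x ∈ Lab S H, ∀ y ∈ Lab S H, ∀ z ∈ Lab S H,
      x.1 ≠ y.1 → x.1 ≠ z.1 → y.1 ≠ z.1 →
      0 < ori (pert N e x) (pert N e y) (pert N e z) * ori x.1 y.1 z.1 := by
    refine (Filter.eventually_all_finite hL).2 fun x hx => (Filter.eventually_all_finite hL).2 fun y hy =>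
      (Filter.eventually_all_finite hL).2 fun z hz => ?_
    by_cases hc : x.1 ≠ y.1 ∧ x.1 ≠ z.1 ∧ y.1 ≠ z.1
    · have := ev_pos (g := fun e => ori (pert N e x) (pert N e y) (pert N e z) * ori x.1 y.1 z.1)
        (by
          have := hcont x
          have := hcont y
          have := hcont z
          have := hcont2 x
          have := hcont2 y
          have := hcont2 z
          simp only [ori]; fun_prop) (by
          simp only [hp0]
          exact mul_self_pos.2 (hg _ (Lab.fst hHS hx) _ (Lab.fst hHS hy) _ (Lab.fst hHS hz)
            hc.1 hc.2.1 hc.2.2))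
      filter_upwards [this] with e h _ _ _ using h
    · exact Filter.Eventually.of_forall fun _ h1 h2 h3 => absurd ⟨h1, h2, h3⟩ hc
  have e2 : ∀ᶠ e in nhdsWithin (0 : ℝ) (Ioi 0), ∀ x ∈ Lab S H, ∀ y ∈ Lab S H, ∀ z ∈ Lab S H,
      x.1 = y.1 → x.2 ≠ y.2 → z.1 ≠ x.1 →
      0 < ori (pert N e x) (pert N e y) (pert N e z) * (x.2 - y.2) := by
    refine (Filter.eventually_all_finite hL).2 fun x hx => (Filter.eventually_all_finite hL).2 fun y hy =>
      (Filter.eventually_all_finite hL).2 fun z hz => ?_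
    by_cases hc : x.1 = y.1 ∧ x.2 ≠ y.2 ∧ z.1 ≠ x.1
    · obtain ⟨h1, h2, h3⟩ := hc
      have hxH := inH x hx y hy h1 h2
      have hfl := hN _ hxH z.1 ⟨Lab.fst hHS hz, h3⟩
      have := ev_pos (g := fun e =>
        ((-(y.2 - x.2) * (N x.1).2 - (y.2 ^ 2 - x.2 ^ 2) * e * (N x.1).1) *
            ((pert N e z).2 - (pert N e x).2) -
          ((y.2 - x.2) * (N x.1).1 - (y.2 ^ 2 - x.2 ^ 2) * e * (N x.1).2) *
            ((pert N e z).1 - (pert N e x).1)) * (x.2 - y.2))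
        (by
          have := hcont x
          have := hcont z
          have := hcont2 x
          have := hcont2 z
          fun_prop) (by
          simp only [hp0]
          have : 0 < (x.2 - y.2) ^ 2 * fl (N x.1).1 (N x.1).2 x.1 z.1 :=
            mul_pos (sq_pos_of_ne_zero (sub_ne_zero.2 h2)) hfl
          unfold fl at this
          nlinarith [this])
      filter_upwards [this, self_mem_nhdsWithin] with e h hepos _ _ _
      have h' := mul_pos (mem_Ioi.1 hepos) h
      refine h'.trans_eq ?_
      unfold ori
      have hy1 : (pert N e y).1 - (pert N e x).1 =
          e * (-(y.2 - x.2) * (N x.1).2 - (y.2 ^ 2 - x.2 ^ 2) * e * (N x.1).1) := by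
        unfold pert; rw [← h1]; ring
      have hy2 : (pert N e y).2 - (pert N e x).2 =
          e * ((y.2 - x.2) * (N x.1).1 - (y.2 ^ 2 - x.2 ^ 2) * e * (N x.1).2) := by
        unfold pert; rw [← h1]; ring
      rw [hy1, hy2]; ring
    · exact Filter.Eventually.of_forall fun _ h1 h2 h3 => absurd ⟨h1, h2, h3⟩ hc
  obtain ⟨e, ⟨⟨h0, h1⟩, h2'⟩, hepos⟩ := ((e0.and e1).and e2 |>.and self_mem_nhdsWithin).exists
  have hepos : 0 < e := hepos
  refine ⟨pert N e, ?_, pert_zero N e, h1, h2', ?_⟩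
  · intro x hx y hy hxy
    by_contra hne
    by_cases hb : x.1 = y.1
    · have hs : x.2 ≠ y.2 := fun h => hne (Prod.ext hb h)
      have hxH := inH x hx y hy hb hs
      have hn := hN0 _ hxH
      have q1 := congrArg Prod.fst hxy
      have q2 := congrArg Prod.snd hxy
      unfold pert at q1 q2
      simp only [← hb] at q1 q2
      have : (x.2 - y.2) * e * ((N x.1).1 ^ 2 + (N x.1).2 ^ 2) = 0 := by
        linear_combination (-(N x.1).2) * q1 + (N x.1).1 * q2
      rcases mul_eq_zero.1 this with h | h
      · rcases mul_eq_zero.1 h with h | h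
        · exact hs (by linarith)
        · linarith
      · linarith
    · exact h0 x hx y hy hb hxy
  · intro x hx y hy z hz hxy hxz s1 s2 s3
    have hxH := inH x hx y hy hxy s1
    have hn := hN0 _ hxH
    have key : ori (pert N e x) (pert N e y) (pert N e z) =
        e ^ 3 * ((N x.1).1 ^ 2 + (N x.1).2 ^ 2) * ((y.2 - x.2) * (z.2 - x.2) * (z.2 - y.2)) := by
      unfold ori pert
      rw [← hxy, ← hxz]
      ring
    rw [key, mul_assoc]
    refine mul_pos (by positivity) (mul_self_pos.2 ?_)
    exact mul_ne_zero (mul_ne_zero (sub_ne_zero.2 s1.symm) (sub_ne_zero.2 s2.symm))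
      (sub_ne_zero.2 s3.symm)

end

open Set
noncomputable section

lemma pos_of_mul_pos_left' {a b : ℝ} (h : 0 < a * b) (ha : 0 < a) : 0 < b := by
  by_contra hb; nlinarith
lemma neg_of_mul_pos_left' {a b : ℝ} (h : 0 < a * b) (ha : a < 0) : b < 0 := by
  by_contra hb; nlinarith

/-- a point with the base of a vertex is not in a triangle with distinct bases -/
lemma Good.caseA {S H : Set Pt} {f : Pt × ℝ → Pt} (hG : Good S H f) {x a b c : Pt × ℝ}
    (hx : x ∈ Lab S H) (ha : a ∈ Lab S H) (hb : b ∈ Lab S H) (hc : c ∈ Lab S H)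
    (hab : b.1 ≠ a.1) (hac : c.1 ≠ a.1) (p1 : 0 < ori (f a) (f b) (f x))
    (p3 : 0 < ori (f c) (f a) (f x)) : x.1 ≠ a.1 := by
  intro h
  have hs : a.2 ≠ x.2 := by
    intro h2
    have : x = a := Prod.ext h h2.symm
    rw [this, ori_self2] at p1; linarith
  have t1 := hG.two a ha x hx b hb h.symm hs hab
  have t2 := hG.two a ha x hx c hc h.symm hs hac
  rw [ori_swap'] at t1
  have r : ori (f c) (f a) (f x) = ori (f a) (f x) (f c) := by unfold ori; ring
  have t3 := pos_of_mul_pos_left' t2 (r ▸ p3)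
  have t4 := neg_of_mul_pos_left' t1 (by linarith)
  linarith

lemma Good.caseB {S H : Set Pt} {f : Pt × ℝ → Pt} (hG : Good S H f) {x a b c : Pt × ℝ}
    (hx : x ∈ Lab S H) (ha : a ∈ Lab S H) (hb : b ∈ Lab S H) (hc : c ∈ Lab S H)
    (hab : a.1 = b.1) (hac : c.1 ≠ a.1) (p0 : 0 < ori (f a) (f b) (f c))
    (p1 : 0 < ori (f a) (f b) (f x)) (p2 : 0 < ori (f b) (f c) (f x))
    (p3 : 0 < ori (f c) (f a) (f x)) : x = (a.1, 0) := by
  have r3 : ori (f x) (f a) (f c) = - ori (f c) (f a) (f x) := by unfold ori; ring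
  have r2 : ori (f b) (f x) (f c) = - ori (f b) (f c) (f x) := by unfold ori; ring
  have r4 : ori (f c) (f x) (f a) = - ori (f c) (f a) (f x) := by unfold ori; ring
  have r5 : ori (f c) (f x) (f b) = ori (f b) (f c) (f x) := by unfold ori; ring
  have hbc : c.1 ≠ b.1 := hab ▸ hac
  by_cases h : x.1 = a.1
  · have hsa : x.2 ≠ a.2 := by
      intro h2
      have : x = a := Prod.ext h h2
      rw [this, ori_self2] at p1; linarith
    have hsb : b.2 ≠ x.2 := by
      intro h2
      have : x = b := Prod.ext (h.trans hab) h2.symm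
      rw [this, ori_self3] at p1; linarith
    have t1 := hG.two x hx a ha c hc h hsa (h ▸ hac)
    have t2 := hG.two b hb x hx c hc (by rw [h, hab]) hsb hbc
    rw [r3] at t1; rw [r2] at t2
    have t3 := neg_of_mul_pos_left' t1 (by linarith)
    have t4 := neg_of_mul_pos_left' t2 (by linarith)
    refine Prod.ext h ?_
    show x.2 = 0
    rcases Lab.cases hx with q | q | q
    · exact q.2
    · rcases Lab.cases ha with q' | q' | q' <;> linarith [q.2, q'.2]
    · rcases Lab.cases hb with q' | q' | q' <;> linarith [q.2, q'.2]
  · exfalso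
    by_cases h' : x.1 = c.1
    · have hsc : c.2 ≠ x.2 := by
        intro h2
        have : x = c := Prod.ext h' h2.symm
        rw [this, ori_self3] at p2; linarith
      have t1 := hG.two c hc x hx a ha h'.symm hsc hac.symm
      have t2 := hG.two c hc x hx b hb h'.symm hsc hbc.symm
      rw [r4] at t1; rw [r5] at t2
      have t3 := neg_of_mul_pos_left' t1 (by linarith)
      have t4 := pos_of_mul_pos_left' t2 (by linarith)
      linarith
    · have t1 := hG.far b hb c hc x hx hbc.symm (by rw [← hab]; exact Ne.symm h) (Ne.symm h')
      have t2 := hG.far c hc a ha x hx hac (Ne.symm h') (Ne.symm h)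
      have t3 := pos_of_mul_pos_left' t1 p2
      have t4 := pos_of_mul_pos_left' t2 p3
      rw [← hab] at t3
      rw [ori_swap] at t4
      linarith

lemma Good.caseC {S H : Set Pt} {f : Pt × ℝ → Pt} (hG : Good S H f) {x a b c : Pt × ℝ}
    (hx : x ∈ Lab S H) (ha : a ∈ Lab S H) (hb : b ∈ Lab S H) (hc : c ∈ Lab S H)
    (hab : a.1 = b.1) (hac : a.1 = c.1) (p0 : 0 < ori (f a) (f b) (f c))
    (p1 : 0 < ori (f a) (f b) (f x)) (p2 : 0 < ori (f b) (f c) (f x))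
    (p3 : 0 < ori (f c) (f a) (f x)) : False := by
  have sab : a.2 ≠ b.2 := by
    intro h2
    rw [show a = b from Prod.ext hab h2, ori_self1] at p0; linarith
  have sac : c.2 ≠ a.2 := by
    intro h2
    rw [show c = a from Prod.ext hac.symm h2, ori_self2] at p0; linarith
  have sbc : b.2 ≠ c.2 := by
    intro h2
    rw [show b = c from Prod.ext (hab.symm.trans hac) h2, ori_self3] at p0; linarith
  by_cases h : x.1 = a.1
  · have hsa : x.2 ≠ a.2 := by
      intro h2
      have : x = a := Prod.ext h h2
      rw [this, ori_self2] at p1; linarith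
    have hsb : b.2 ≠ x.2 := by
      intro h2
      have : x = b := Prod.ext (h.trans hab) h2.symm
      rw [this, ori_self3] at p1; linarith
    have hsc : c.2 ≠ x.2 := by
      intro h2
      have : x = c := Prod.ext (h.trans hac) h2.symm
      rw [this, ori_self3] at p2; linarith
    have ga : ∀ y ∈ Lab S H, y.2 = 0 ∨ y.2 = 1 ∨ y.2 = -1 := fun y hy => by
      rcases Lab.cases hy with q | q | q <;> simp [q.2]
    rcases ga a ha with q | q | q <;> rcases ga b hb with q' | q' | q' <;>
      rcases ga c hc with r | r | r <;> rcases ga x hx with r' | r' | r' <;>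
      simp_all
  · have t1 := pos_of_mul_pos_left' (hG.two a ha b hb x hx hab sab h) p1
    have t2 := pos_of_mul_pos_left' (hG.two b hb c hc x hx (hab.symm.trans hac) sbc (hab ▸ h)) p2
    have t3 := pos_of_mul_pos_left' (hG.two c hc a ha x hx hac.symm sac (hac ▸ h)) p3
    linarith

lemma Good.inT_cases {S H : Set Pt} {f : Pt × ℝ → Pt} (hG : Good S H f) {x a b c : Pt × ℝ}
    (hx : x ∈ Lab S H) (ha : a ∈ Lab S H) (hb : b ∈ Lab S H) (hc : c ∈ Lab S H)
    (p0 : ori (f a) (f b) (f c) ≠ 0) (hi : InT (f x) (f a) (f b) (f c)) :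
    (a.1 ≠ b.1 ∧ a.1 ≠ c.1 ∧ b.1 ≠ c.1 ∧ InT x.1 a.1 b.1 c.1) ∨
    (a.1 = b.1 ∧ c.1 ≠ a.1 ∧ x = (a.1, 0)) ∨ (b.1 = c.1 ∧ a.1 ≠ b.1 ∧ x = (b.1, 0)) ∨
    (c.1 = a.1 ∧ b.1 ≠ c.1 ∧ x = (c.1, 0)) := by
  have main : ∀ a ∈ Lab S H, ∀ b ∈ Lab S H, ∀ c ∈ Lab S H, 0 < ori (f a) (f b) (f c) →
      InT (f x) (f a) (f b) (f c) →
      (a.1 ≠ b.1 ∧ a.1 ≠ c.1 ∧ b.1 ≠ c.1 ∧ InT x.1 a.1 b.1 c.1) ∨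
      (a.1 = b.1 ∧ c.1 ≠ a.1 ∧ x = (a.1, 0)) ∨ (b.1 = c.1 ∧ a.1 ≠ b.1 ∧ x = (b.1, 0)) ∨
      (c.1 = a.1 ∧ b.1 ≠ c.1 ∧ x = (c.1, 0)) := by
    clear ha hb hc p0 hi a b c
    intro a ha b hb c hc p0 hi
    obtain ⟨p1, p2, p3⟩ := hi.pos p0
    have p0' : 0 < ori (f b) (f c) (f a) := by rw [ori_rot]; exact p0
    have p0'' : 0 < ori (f c) (f a) (f b) := by rw [ori_rot']; exact p0
    by_cases hab : a.1 = b.1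
    · by_cases hac : c.1 = a.1
      · exact (hG.caseC hx ha hb hc hab hac.symm p0 p1 p2 p3).elim
      · exact Or.inr (Or.inl ⟨hab, hac, hG.caseB hx ha hb hc hab hac p0 p1 p2 p3⟩)
    by_cases hbc : b.1 = c.1
    · exact Or.inr (Or.inr (Or.inl ⟨hbc, hab, hG.caseB hx hb hc ha hbc hab p0' p2 p3 p1⟩))
    by_cases hca : c.1 = a.1
    · exact Or.inr (Or.inr (Or.inr ⟨hca, hbc, hG.caseB hx hc ha hb hca hbc p0'' p3 p1 p2⟩))
    have n1 := hG.caseA hx ha hb hc (Ne.symm hab) hca p1 p3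
    have n2 := hG.caseA hx hb hc ha (Ne.symm hbc) hab p2 p1
    have n3 := hG.caseA hx hc ha hb (Ne.symm hca) hbc p3 p2
    refine Or.inl ⟨hab, Ne.symm hca, hbc, InT.of_pos ?_ ?_ ?_⟩
    · exact pos_of_mul_pos_left' (hG.far a ha b hb x hx hab n1.symm n2.symm) p1
    · exact pos_of_mul_pos_left' (hG.far b hb c hc x hx hbc n2.symm n3.symm) p2
    · exact pos_of_mul_pos_left' (hG.far c hc a ha x hx hca n3.symm n1.symm) p3
  rcases lt_or_gt_of_ne p0 with h | h
  · rcases main b hb a ha c hc (by rw [ori_swap]; linarith) hi.swap with q | q | q | q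
    · exact Or.inl ⟨q.1.symm, q.2.2.1, q.2.1, q.2.2.2.swap⟩
    · obtain ⟨q1, q2, q3⟩ := q
      exact Or.inr (Or.inl ⟨q1.symm, q1 ▸ q2, q1 ▸ q3⟩)
    · obtain ⟨q1, q2, q3⟩ := q
      exact Or.inr (Or.inr (Or.inr ⟨q1.symm, by rw [← q1]; exact q2, by rw [← q1]; exact q3⟩))
    · obtain ⟨q1, q2, q3⟩ := q
      exact Or.inr (Or.inr (Or.inl ⟨q1.symm, by rw [← q1]; exact q2, by rw [← q1]; exact q3⟩))
  · exact main a ha b hb c hc h hi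

lemma Good.gp {S H : Set Pt} {f : Pt × ℝ → Pt} (hG : Good S H f) {a b c : Pt × ℝ}
    (ha : a ∈ Lab S H) (hb : b ∈ Lab S H) (hc : c ∈ Lab S H)
    (hab : a ≠ b) (hac : a ≠ c) (hbc : b ≠ c) : ori (f a) (f b) (f c) ≠ 0 := by
  have hs : ∀ {x y : Pt × ℝ}, x ≠ y → x.1 = y.1 → x.2 ≠ y.2 := fun h h1 h2 => h (Prod.ext h1 h2)
  intro h0
  by_cases h1 : a.1 = b.1
  · by_cases h2 : a.1 = c.1
    · have := hG.three a ha b hb c hc h1 h2 (hs hab h1) (hs hac h2) (hs hbc (h1.symm.trans h2))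
      rw [h0] at this; simp at this
    · have := hG.two a ha b hb c hc h1 (hs hab h1) (Ne.symm h2)
      rw [h0] at this; simp at this
  by_cases h2 : b.1 = c.1
  · have := hG.two b hb c hc a ha h2 (hs hbc h2) h1
    rw [ori_rot, h0] at this; simp at this
  by_cases h3 : c.1 = a.1
  · have := hG.two c hc a ha b hb h3 (hs hac.symm h3) h2
    rw [ori_rot', h0] at this; simp at this
  have := hG.far a ha b hb c hc h1 (Ne.symm h3) h2
  rw [h0] at this; simp at this

end

open Set
noncomputable section

lemma Good.inT_far {S H : Set Pt} {f : Pt × ℝ → Pt} (hHS : H ⊆ S) (hG : Good S H f) (hg : GP S)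
    {w : Pt} {a b c : Pt × ℝ}
    (hw : w ∈ S) (ha : a ∈ Lab S H) (hb : b ∈ Lab S H) (hc : c ∈ Lab S H)
    (hab : a.1 ≠ b.1) (hac : a.1 ≠ c.1) (hbc : b.1 ≠ c.1) (hi : InT w a.1 b.1 c.1) :
    InT w (f a) (f b) (f c) := by
  have main : ∀ a ∈ Lab S H, ∀ b ∈ Lab S H, ∀ c ∈ Lab S H, a.1 ≠ b.1 → a.1 ≠ c.1 → b.1 ≠ c.1 →
      0 < ori a.1 b.1 c.1 → InT w a.1 b.1 c.1 → InT w (f a) (f b) (f c) := by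
    clear ha hb hc hab hac hbc hi a b c
    intro a ha b hb c hc hab hac hbc h0 hi
    obtain ⟨p1, p2, p3⟩ := hi.pos h0
    obtain ⟨n1, n2, n3⟩ := hi.ne_vertex h0.ne'
    have hwL : ((w, 0) : Pt × ℝ) ∈ Lab S H := Or.inl ⟨hw, rfl⟩
    have t1 := hG.far a ha b hb (w, 0) hwL hab n1.symm n2.symm
    have t2 := hG.far b hb c hc (w, 0) hwL hbc n2.symm n3.symm
    have t3 := hG.far c hc a ha (w, 0) hwL hac.symm n3.symm n1.symm
    rw [hG.zero, mul_comm] at t1 t2 t3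
    exact InT.of_pos (pos_of_mul_pos_left' t1 p1) (pos_of_mul_pos_left' t2 p2)
      (pos_of_mul_pos_left' t3 p3)
  have h0 := hg _ (Lab.fst hHS ha) _ (Lab.fst hHS hb) _ (Lab.fst hHS hc) hab hac hbc
  rcases lt_or_gt_of_ne h0 with h | h
  · exact (main b hb a ha c hc hab.symm hbc hac (by rw [ori_swap]; linarith) hi.swap).swap
  · exact main a ha b hb c hc hab hac hbc h hi

lemma Good.inT_near {S H : Set Pt} {f : Pt × ℝ → Pt} (hHS : H ⊆ S) (hG : Good S H f)
    {a b c : Pt × ℝ} (ha : a ∈ H ×ˢ ({1, -1} : Set ℝ)) (hb : b ∈ H ×ˢ ({1, -1} : Set ℝ))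
    (hc : c ∈ H ×ˢ ({1, -1} : Set ℝ)) (hne : a ≠ b) (hac : a ≠ c) (hbc : b ≠ c)
    (hab : a.1 = b.1) : InT a.1 (f a) (f b) (f c) := by
  have hca : c.1 ≠ a.1 := by
    intro h
    obtain ⟨_, ha2⟩ := ha
    obtain ⟨_, hb2⟩ := hb
    obtain ⟨_, hc2⟩ := hc
    have s1 : a.2 ≠ b.2 := fun h' => hne (Prod.ext hab h')
    have s2 : a.2 ≠ c.2 := fun h' => hac (Prod.ext h.symm h')
    have s3 : b.2 ≠ c.2 := fun h' => hbc (Prod.ext (hab.symm.trans h.symm) h')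
    simp only [mem_insert_iff, mem_singleton_iff] at ha2 hb2 hc2
    rcases ha2 with q | q <;> rcases hb2 with q' | q' <;> rcases hc2 with q'' | q'' <;> simp_all
  have main : ∀ a ∈ H ×ˢ ({1, -1} : Set ℝ), ∀ b ∈ H ×ˢ ({1, -1} : Set ℝ), a.1 = b.1 → c.1 ≠ a.1 →
      a.2 = 1 → b.2 = -1 → InT a.1 (f a) (f b) (f c) := by
    clear ha hb hne hab hca hac hbc a b
    intro a ha b hb hab hca s1 s2
    have haL : a ∈ Lab S H := Or.inr ha
    have hbL : b ∈ Lab S H := Or.inr hb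
    have hcL : c ∈ Lab S H := Or.inr hc
    have hpL : ((a.1, 0) : Pt × ℝ) ∈ Lab S H := Or.inl ⟨hHS ha.1, rfl⟩
    have t1 := hG.three a haL b hbL (a.1, 0) hpL hab rfl (by rw [s1, s2]; norm_num)
      (by rw [s1]; norm_num) (by rw [s2]; norm_num)
    have t2 := hG.two (a.1, 0) hpL b hbL c hcL hab (by rw [s2]; norm_num) hca
    have t3 := hG.two a haL (a.1, 0) hpL c hcL rfl (by rw [s1]; norm_num) hca
    rw [hG.zero, s1, s2] at t1
    rw [hG.zero, s2] at t2
    rw [hG.zero, s1] at t3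
    refine InT.of_pos ?_ ?_ ?_
    · norm_num at t1; exact t1
    · rw [ori_rot]; norm_num at t2; exact t2
    · have r : ori (f c) (f a) a.1 = ori (f a) a.1 (f c) := by unfold ori; ring
      rw [r]
      norm_num at t3; exact t3
  have ha2 := ha.2
  have hb2 := hb.2
  have s1 : a.2 ≠ b.2 := fun h' => hne (Prod.ext hab h')
  simp only [mem_insert_iff, mem_singleton_iff] at ha2 hb2
  rcases ha2 with q | q <;> rcases hb2 with q' | q'
  · exact absurd (q.trans q'.symm) s1
  · exact main a ha b hb hab hca q q'
  · have := main b hb a ha hab.symm (hab ▸ hca) q' q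
    rw [← hab] at this
    exact this.swap
  · exact absurd (q.trans q'.symm) s1

/-- The invariant of the construction. -/
structure Cfg (k : ℕ) (S H : Set Pt) : Prop where
  fin : S.Finite
  sub : H ⊆ S
  gp : GP S
  ac : AC S
  tri : ∀ a ∈ H, ∀ b ∈ H, ∀ c ∈ H, a ≠ b → a ≠ c → b ≠ c → ∃ w ∈ S, InT w a b c
  hole : ¬ HasHole k S
  hull : ∀ p ∈ H, p ∉ convexHull ℝ (S \ {p})
  card : S.ncard + 2 = 2 * H.ncard
  two : 2 ≤ S.ncard

lemma isHole_tri {k : ℕ} {S K : Set Pt} (h : IsHole k S K) {u a b c : Pt} (hu : u ∈ S) (ha : a ∈ K)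
    (hb : b ∈ K) (hc : c ∈ K) (h0 : ori a b c ≠ 0) : ¬ InT u a b c := by
  intro hi
  obtain ⟨n1, n2, n3⟩ := hi.ne_vertex h0
  by_cases huK : u ∈ K
  · exact h.2.2.1 u huK (hi.mem_convexHull ⟨ha, n1.symm⟩ ⟨hb, n2.symm⟩ ⟨hc, n3.symm⟩)
  · apply huK
    apply h.2.2.2 u hu
    rw [mem_interior_iff_mem_nhds]
    have main : ∀ a ∈ K, ∀ b ∈ K, ∀ c ∈ K, 0 < ori a b c → InT u a b c →
        convexHull ℝ K ∈ nhds u := by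
      intro a ha b hb c hc h0 hi
      obtain ⟨p1, p2, p3⟩ := hi.pos h0
      have hcont : ∀ x y : Pt, Continuous fun v : Pt => ori x y v := by
        intro x y; unfold ori; fun_prop
      have e1 := (hcont a b).continuousAt.eventually (lt_mem_nhds p1)
      have e2 := (hcont b c).continuousAt.eventually (lt_mem_nhds p2)
      have e3 := (hcont c a).continuousAt.eventually (lt_mem_nhds p3)
      filter_upwards [e1, e2, e3] with v h1 h2 h3
      exact (InT.of_pos h1 h2 h3).mem_convexHull ha hb hc
    rcases lt_or_gt_of_ne h0 with h | h
    · exact main b hb a ha c hc (by rw [ori_swap]; linarith) hi.swap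
    · exact main a ha b hb c hc h hi

lemma Cfg.step {k : ℕ} {S H : Set Pt} (h : Cfg k S H) :
    ∃ S' H', Cfg (k + 2) S' H' ∧ S'.ncard = 2 * S.ncard + 2 := by
  obtain ⟨f, hG⟩ := exists_good h.fin h.sub h.gp h.two h.hull
  have hLf := Lab.finite h.fin h.sub
  have hHf := h.fin.subset h.sub
  set LH : Set (Pt × ℝ) := H ×ˢ {1, -1} with hLH
  have hLHs : LH ⊆ Lab S H := subset_union_right
  have hcH : (f '' LH).ncard = 2 * H.ncard := by
    rw [ncard_image_of_injOn (hG.inj.mono hLHs), hLH, ncard_prod,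
      Set.ncard_pair (by norm_num)]; ring
  have hcS : (f '' Lab S H).ncard = 2 * S.ncard + 2 := by
    rw [ncard_image_of_injOn hG.inj]
    unfold Lab
    rw [ncard_union_eq ?_ (h.fin.prod (finite_singleton _)) (hHf.prod (by simp)), ncard_prod, ncard_prod,
      Set.ncard_pair (by norm_num), ncard_singleton]
    · have := h.card
      omega
    · rw [Set.disjoint_left]
      rintro x ⟨_, hx⟩ ⟨_, hy⟩
      simp only [mem_insert_iff, mem_singleton_iff] at hx hy
      rw [hx] at hy; norm_num at hy
  have hgp : GP (f '' Lab S H) := by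
    rintro _ ⟨a, ha, rfl⟩ _ ⟨b, hb, rfl⟩ _ ⟨c, hc, rfl⟩ hab hac hbc
    exact hG.gp ha hb hc (fun h => hab (h ▸ rfl)) (fun h => hac (h ▸ rfl)) (fun h => hbc (h ▸ rfl))
  have hSsub : S ⊆ f '' Lab S H := fun p hp => ⟨(p, 0), Or.inl ⟨hp, rfl⟩, hG.zero p⟩
  have htri : ∀ a ∈ f '' LH, ∀ b ∈ f '' LH, ∀ c ∈ f '' LH, a ≠ b → a ≠ c → b ≠ c →
      ∃ w ∈ f '' Lab S H, InT w a b c := by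
    rintro _ ⟨a, ha, rfl⟩ _ ⟨b, hb, rfl⟩ _ ⟨c, hc, rfl⟩ hab hac hbc
    have hab' : a ≠ b := fun h => hab (h ▸ rfl)
    have hac' : a ≠ c := fun h => hac (h ▸ rfl)
    have hbc' : b ≠ c := fun h => hbc (h ▸ rfl)
    by_cases e1 : a.1 = b.1
    · exact ⟨a.1, hSsub (h.sub ha.1), hG.inT_near h.sub ha hb hc hab' hac' hbc' e1⟩
    by_cases e2 : b.1 = c.1
    · exact ⟨b.1, hSsub (h.sub hb.1),
        (hG.inT_near h.sub hb hc ha hbc' hab'.symm hac'.symm e2).rot.rot⟩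
    by_cases e3 : a.1 = c.1
    · exact ⟨a.1, hSsub (h.sub ha.1), (hG.inT_near h.sub ha hc hb hac' hab' hbc'.symm e3).swap'⟩
    obtain ⟨w, hw, hi⟩ := h.tri _ ha.1 _ hb.1 _ hc.1 e1 e3 e2
    exact ⟨w, hSsub hw, hG.inT_far h.sub h.gp hw (hLHs ha) (hLHs hb) (hLHs hc) e1 e3 e2 hi⟩
  refine ⟨f '' Lab S H, f '' LH, ⟨hLf.image f, image_mono hLHs, hgp, ?_, htri, ?_, ?_, ?_, ?_⟩, hcS⟩
  · rintro _ ⟨a, ha, rfl⟩ _ ⟨b, hb, rfl⟩ _ ⟨c, hc, rfl⟩ h0 _ ⟨u, hu, rfl⟩ _ ⟨v, hv, rfl⟩ hiu hiv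
    have hbase : ∀ x ∈ Lab S H, a.1 ≠ b.1 → a.1 ≠ c.1 → b.1 ≠ c.1 → InT x.1 a.1 b.1 c.1 →
        x.2 = 0 := by
      intro x hx n1 n2 n3 hi
      have hn : x.1 ∉ H := by
        intro hxH
        obtain ⟨m1, m2, m3⟩ := hi.ne_vertex (h.gp _ (Lab.fst h.sub ha) _ (Lab.fst h.sub hb) _
          (Lab.fst h.sub hc) n1 n2 n3)
        exact h.hull _ hxH (hi.mem_convexHull ⟨Lab.fst h.sub ha, m1.symm⟩
          ⟨Lab.fst h.sub hb, m2.symm⟩ ⟨Lab.fst h.sub hc, m3.symm⟩)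
      rcases Lab.cases hx with q | q | q
      · exact q.2
      · exact absurd q.1 hn
      · exact absurd q.1 hn
    congr 1
    rcases hG.inT_cases hu ha hb hc h0 hiu with q | q | q | q <;>
      rcases hG.inT_cases hv ha hb hc h0 hiv with r | r | r | r
    · have z1 := hbase u hu q.1 q.2.1 q.2.2.1 q.2.2.2
      have z2 := hbase v hv q.1 q.2.1 q.2.2.1 r.2.2.2
      refine Prod.ext ?_ (z1.trans z2.symm)
      exact h.ac _ (Lab.fst h.sub ha) _ (Lab.fst h.sub hb) _ (Lab.fst h.sub hc)
        (h.gp _ (Lab.fst h.sub ha) _ (Lab.fst h.sub hb) _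
          (Lab.fst h.sub hc) q.1 q.2.1 q.2.2.1) _ (Lab.fst h.sub hu) _ (Lab.fst h.sub hv)
        q.2.2.2 r.2.2.2
    all_goals grind
  · rintro ⟨K, hK⟩
    obtain ⟨hKs, hKc, -, -⟩ := id hK
    have hKf : K.Finite := (hLf.image f).subset hKs
    have h2 : (K ∩ f '' LH).ncard ≤ 2 := by
      by_contra hcon
      obtain ⟨a, b, c, ha, hb, hc, hab, hac, hbc⟩ :=
        (Set.two_lt_ncard_iff (s := K ∩ f '' LH) (hKf.subset inter_subset_left)).1 (by omega)
      obtain ⟨w, hw, hi⟩ := htri a ha.2 b hb.2 c hc.2 hab hac hbc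
      exact isHole_tri hK hw ha.1 hb.1 hc.1
        (hgp _ (hKs ha.1) _ (hKs hb.1) _ (hKs hc.1) hab hac hbc) hi
    have hcov : K ⊆ (K ∩ S) ∪ (K ∩ f '' LH) := by
      intro x hx
      obtain ⟨y, hy, rfl⟩ := hKs hx
      rcases hy with hy | hy
      · left
        refine ⟨hx, ?_⟩
        have : y = (y.1, 0) := Prod.ext rfl hy.2
        rw [this, hG.zero]; exact hy.1
      · exact Or.inr ⟨hx, y, hy, rfl⟩
    have h3 := ncard_le_ncard hcov
      ((hKf.subset inter_subset_left).union (hKf.subset inter_subset_left))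
    have h4 := ncard_union_le (K ∩ S) (K ∩ f '' LH)
    apply h.hole
    refine HoleT.hasHole h.fin (K := K ∩ S) (HoleT.of_tri h.gp inter_subset_right ?_) (by omega)
    intro a ha b hb c hc hab hac hbc u hu
    exact isHole_tri hK (hSsub hu) ha.1 hb.1 hc.1 (h.gp _ ha.2 _ hb.2 _ hc.2 hab hac hbc)
  · rintro _ ⟨x, hx, rfl⟩ hm
    obtain ⟨_, ha, _, hb, _, hc, hab, hac, hbc, hi⟩ := car hgp diff_subset
      (mem_image_of_mem f (hLHs hx)) (by simp) hm
    obtain ⟨⟨a, ha, rfl⟩, -⟩ := ha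
    obtain ⟨⟨b, hb, rfl⟩, -⟩ := hb
    obtain ⟨⟨c, hc, rfl⟩, -⟩ := hc
    have h0 := hgp _ ⟨a, ha, rfl⟩ _ ⟨b, hb, rfl⟩ _ ⟨c, hc, rfl⟩ hab hac hbc
    have hx2 : x.2 ≠ 0 := by
      intro h0
      have := hx.2
      rw [h0] at this; simp at this
    rcases hG.inT_cases (hLHs hx) ha hb hc h0 hi with q | q | q | q
    · obtain ⟨n1, n2, n3, hi'⟩ := q
      obtain ⟨m1, m2, m3⟩ := hi'.ne_vertex (h.gp _ (Lab.fst h.sub ha) _ (Lab.fst h.sub hb) _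
          (Lab.fst h.sub hc) n1 n2 n3)
      exact h.hull _ hx.1 (hi'.mem_convexHull ⟨Lab.fst h.sub ha, m1.symm⟩
          ⟨Lab.fst h.sub hb, m2.symm⟩ ⟨Lab.fst h.sub hc, m3.symm⟩)
    · exact hx2 (by rw [q.2.2])
    · exact hx2 (by rw [q.2.2])
    · exact hx2 (by rw [q.2.2])
  · rw [hcS, hcH]; have := h.card; omega
  · rw [hcS]; omega

end

open Set
noncomputable section

lemma cfg_three : Cfg 3 {((0 : ℝ), (0 : ℝ)), ((1 : ℝ), (0 : ℝ))} {((0 : ℝ), (0 : ℝ)), ((1 : ℝ), (0 : ℝ))} := by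
  have hc : ({((0 : ℝ), (0 : ℝ)), ((1 : ℝ), (0 : ℝ))} : Set Pt).ncard = 2 :=
    Set.ncard_pair (by simp)
  have hfin : ({((0 : ℝ), (0 : ℝ)), ((1 : ℝ), (0 : ℝ))} : Set Pt).Finite := by simp
  have h3 : ∀ a ∈ ({((0 : ℝ), (0 : ℝ)), ((1 : ℝ), (0 : ℝ))} : Set Pt),
      ∀ b ∈ ({((0 : ℝ), (0 : ℝ)), ((1 : ℝ), (0 : ℝ))} : Set Pt),
      ∀ c ∈ ({((0 : ℝ), (0 : ℝ)), ((1 : ℝ), (0 : ℝ))} : Set Pt), a ≠ b → a ≠ c → b ≠ c → False := by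
    intro a ha b hb c hc hab hac hbc
    simp only [mem_insert_iff, mem_singleton_iff] at ha hb hc
    rcases ha with rfl | rfl <;> rcases hb with rfl | rfl <;> rcases hc with rfl | rfl <;> simp at *
  refine ⟨hfin, Subset.rfl, ?_, ?_, ?_, ?_, ?_, by rw [hc], by rw [hc]⟩
  · intro a ha b hb c hc hab hac hbc
    exact (h3 a ha b hb c hc hab hac hbc).elim
  · intro a ha b hb c hc h0
    exfalso
    refine h3 a ha b hb c hc ?_ ?_ ?_
    · rintro rfl; exact h0 (ori_self1 _ _)
    · rintro rfl; exact h0 (ori_self2 _ _)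
    · rintro rfl; exact h0 (ori_self3 _ _)
  · intro a ha b hb c hc hab hac hbc
    exact (h3 a ha b hb c hc hab hac hbc).elim
  · rintro ⟨K, hK⟩
    have := ncard_le_ncard hK.1 hfin
    have := hK.2.1
    omega
  · intro p hp
    simp only [mem_insert_iff, mem_singleton_iff] at hp
    rcases hp with rfl | rfl
    · apply not_mem_of_fl (A := 1) (B := 0)
      rintro y ⟨hy, hn⟩
      simp only [mem_insert_iff, mem_singleton_iff] at hy hn
      rcases hy with rfl | rfl
      · exact absurd rfl hn
      · norm_num [fl]
    · apply not_mem_of_fl (A := -1) (B := 0)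
      rintro y ⟨hy, hn⟩
      simp only [mem_insert_iff, mem_singleton_iff] at hy hn
      rcases hy with rfl | rfl
      · norm_num [fl]
      · exact absurd rfl hn

lemma cfg_four : ∃ S H, Cfg 4 S H ∧ S.ncard = 4 := by
  obtain ⟨o, ho⟩ : ∃ o : Pt, o = ((0 : ℝ), (0 : ℝ)) := ⟨_, rfl⟩
  obtain ⟨p, hp⟩ : ∃ o : Pt, o = ((3 : ℝ), (0 : ℝ)) := ⟨_, rfl⟩
  obtain ⟨q, hq⟩ : ∃ o : Pt, o = ((0 : ℝ), (3 : ℝ)) := ⟨_, rfl⟩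
  obtain ⟨r, hr⟩ : ∃ o : Pt, o = ((1 : ℝ), (1 : ℝ)) := ⟨_, rfl⟩
  have hop : o ≠ p := by rw [ho, hp]; simp
  have hoq : o ≠ q := by rw [ho, hq]; simp
  have hor : o ≠ r := by rw [ho, hr]; simp
  have hpq : p ≠ q := by rw [hp, hq]; simp
  have hpr : p ≠ r := by rw [hp, hr]; simp
  have hqr : q ≠ r := by rw [hq, hr]; simp
  have hfin : ({o, p, q, r} : Set Pt).Finite := by simp
  have hcS : ({o, p, q, r} : Set Pt).ncard = 4 := by
    rw [ncard_insert_of_notMem (by simp [*]), ncard_insert_of_notMem (by simp [*]),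
      ncard_pair hqr]
  have hcH : ({o, p, q} : Set Pt).ncard = 3 := by
    rw [ncard_insert_of_notMem (by simp [*]), ncard_pair hpq]
  have hsub : ({o, p, q} : Set Pt) ⊆ {o, p, q, r} := by
    intro x hx
    simp only [mem_insert_iff, mem_singleton_iff] at hx ⊢
    tauto
  have hgp : GP {o, p, q, r} := by
    intro a ha b hb c hc hab hac hbc
    simp only [mem_insert_iff, mem_singleton_iff] at ha hb hc
    rcases ha with rfl | rfl | rfl | rfl <;> rcases hb with rfl | rfl | rfl | rfl <;>
      first
      | exact absurd rfl hab
      | (rcases hc with rfl | rfl | rfl | rfl <;>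
          first
          | exact absurd rfl hac
          | exact absurd rfl hbc
          | (rw [ho, hp, hq]; norm_num [ori])
          | (rw [ho, hp, hr]; norm_num [ori])
          | (rw [ho, hq, hr]; norm_num [ori])
          | (rw [hp, hq, hr]; norm_num [ori]))
  have hin : InT r o p q :=
    ⟨1 / 3, 1 / 3, 1 / 3, by norm_num, by norm_num, by norm_num, by norm_num,
      by rw [hr, ho, hp, hq]; norm_num, by rw [hr, ho, hp, hq]; norm_num⟩
  have hhull : ∀ x ∈ ({o, p, q} : Set Pt), x ∉ convexHull ℝ ({o, p, q, r} \ {x}) := by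
    intro x hx
    simp only [mem_insert_iff, mem_singleton_iff] at hx
    rcases hx with rfl | rfl | rfl
    · apply not_mem_of_fl (A := 1) (B := 1)
      rintro y ⟨hy, hn⟩
      simp only [mem_insert_iff, mem_singleton_iff] at hy hn
      rcases hy with rfl | rfl | rfl | rfl
      · exact absurd rfl hn
      · rw [ho, hp]; norm_num [fl]
      · rw [ho, hq]; norm_num [fl]
      · rw [ho, hr]; norm_num [fl]
    · apply not_mem_of_fl (A := -1) (B := 0)
      rintro y ⟨hy, hn⟩
      simp only [mem_insert_iff, mem_singleton_iff] at hy hn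
      rcases hy with rfl | rfl | rfl | rfl
      · rw [ho, hp]; norm_num [fl]
      · exact absurd rfl hn
      · rw [hp, hq]; norm_num [fl]
      · rw [hp, hr]; norm_num [fl]
    · apply not_mem_of_fl (A := 0) (B := -1)
      rintro y ⟨hy, hn⟩
      simp only [mem_insert_iff, mem_singleton_iff] at hy hn
      rcases hy with rfl | rfl | rfl | rfl
      · rw [ho, hq]; norm_num [fl]
      · rw [hp, hq]; norm_num [fl]
      · exact absurd rfl hn
      · rw [hq, hr]; norm_num [fl]
  refine ⟨{o, p, q, r}, {o, p, q}, ⟨hfin, hsub, hgp, ?_, ?_, ?_, hhull, by rw [hcS, hcH],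
    by rw [hcS]; norm_num⟩, hcS⟩
  · intro a ha b hb c hc h0
    have key : ∀ u ∈ ({o, p, q, r} : Set Pt), InT u a b c → u = r := by
      intro u hu hi
      by_contra hur
      have huH : u ∈ ({o, p, q} : Set Pt) := by
        simp only [mem_insert_iff, mem_singleton_iff] at hu ⊢
        tauto
      obtain ⟨n1, n2, n3⟩ := hi.ne_vertex h0
      exact hhull u huH (hi.mem_convexHull ⟨ha, n1.symm⟩ ⟨hb, n2.symm⟩ ⟨hc, n3.symm⟩)
    intro u hu v hv hiu hiv
    rw [key u hu hiu, key v hv hiv]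
  · intro a ha b hb c hc hab hac hbc
    refine ⟨r, by simp, ?_⟩
    simp only [mem_insert_iff, mem_singleton_iff] at ha hb hc
    rcases ha with rfl | rfl | rfl <;> rcases hb with rfl | rfl | rfl <;>
      rcases hc with rfl | rfl | rfl <;>
      first
      | exact absurd rfl hab
      | exact absurd rfl hac
      | exact absurd rfl hbc
      | exact hin
      | exact hin.rot
      | exact hin.rot.rot
      | exact hin.swap
      | exact hin.swap.rot
      | exact hin.swap.rot.rot
  · rintro ⟨K, hK⟩
    have hKe : K = {o, p, q, r} := Set.eq_of_subset_of_ncard_le hK.1 (by rw [hcS, hK.2.1]) hfin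
    have h0 : ori o p q ≠ 0 := by rw [ho, hp, hq]; norm_num [ori]
    exact isHole_tri hK (u := r) (a := o) (b := p) (c := q) (by simp) (by rw [hKe]; simp)
      (by rw [hKe]; simp) (by rw [hKe]; simp) h0 hin

lemma exists_cfg {k : ℕ} (hk : 3 ≤ k) : ∃ S H, Cfg k S H ∧ S.ncard = Mval k - 1 := by
  have h1 : ∀ i, ∃ S H, Cfg (2 * i + 3) S H ∧ S.ncard = Mval (2 * i + 3) - 1 := by
    intro i
    induction i with
    | zero =>
      refine ⟨_, _, cfg_three, ?_⟩
      rw [Set.ncard_pair (by simp), Mval_odd]; norm_num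
    | succ i ih =>
      obtain ⟨S, H, h, hc⟩ := ih
      obtain ⟨S', H', h', hc'⟩ := h.step
      refine ⟨S', H', h', ?_⟩
      rw [hc', hc, Mval_odd, Mval_odd, show i + 1 + 2 = (i + 2) + 1 by ring, pow_succ 2 (i + 2)]
      have : 4 ≤ 2 ^ (i + 2) := by
        rw [pow_add]; have := Nat.one_le_two_pow (n := i); omega
      omega
  have h2 : ∀ i, ∃ S H, Cfg (2 * i + 4) S H ∧ S.ncard = Mval (2 * i + 4) - 1 := by
    intro i
    induction i with
    | zero =>
      obtain ⟨S, H, h, hc⟩ := cfg_four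
      refine ⟨S, H, h, ?_⟩
      rw [hc, Mval_even]; norm_num
    | succ i ih =>
      obtain ⟨S, H, h, hc⟩ := ih
      obtain ⟨S', H', h', hc'⟩ := h.step
      refine ⟨S', H', h', ?_⟩
      rw [hc', hc, Mval_even, Mval_even, show i + 1 + 1 = (i + 1) + 1 by ring, pow_succ 2 (i + 1)]
      have : 2 ≤ 2 ^ (i + 1) := by
        rw [pow_add]; have := Nat.one_le_two_pow (n := i); omega
      omega
  rcases Nat.even_or_odd' k with ⟨i, rfl | rfl⟩
  · obtain ⟨i, rfl⟩ : ∃ j, i = j + 2 := ⟨i - 2, by omega⟩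
    exact h2 i
  · obtain ⟨i, rfl⟩ : ∃ j, i = j + 1 := ⟨i - 1, by omega⟩
    exact h1 i

lemma main_thm (k : ℕ) (hk : 3 ≤ k) :
    (∀ S : Set Pt, S.Finite → GenPos S → Mval k ≤ S.ncard →
      HasHole k S ∨ HasEmptyPseudoTriangle 5 S) ∧
    (∃ S : Set Pt, S.Finite ∧ GenPos S ∧ S.ncard = Mval k - 1 ∧
      ¬ HasHole k S ∧ ¬ HasEmptyPseudoTriangle 5 S) := by
  constructor
  · intro S hf hg hc
    by_cases h : HasEmptyPseudoTriangle 5 S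
    · exact Or.inr h
    · have hg' := genPos_iff.1 hg
      exact Or.inl (ac_hole hf hg' (ac_of_no_pt hf hg' h) hk hc)
  · obtain ⟨S, H, h, hc⟩ := exists_cfg hk
    exact ⟨S, h.fin, genPos_iff.2 h.gp, hc, h.hole, no_pt_of_ac h.gp h.ac⟩

end

/-- `E(k,5) = M_k`. -/
theorem statement_7 (k : ℕ) (hk : 3 ≤ k) :
    (∀ S : Set Pt, S.Finite → GenPos S → Mval k ≤ S.ncard →
      HasHole k S ∨ HasEmptyPseudoTriangle 5 S) ∧
    (∃ S : Set Pt, S.Finite ∧ GenPos S ∧ S.ncard = Mval k - 1 ∧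
      ¬ HasHole k S ∧ ¬ HasEmptyPseudoTriangle 5 S) := by
  exact main_thm k hk
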